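/- There exist absolute constants c, C > 0 such that the following holds. If σ ≤ c·(σ_min(A)/κ⁴)·√n/(√d·(√(nd)+√m+√(2γ n log n))), then with probability at least 1 − C·n^{−γ+2} the GPM sequence {Sᵗ}_{t≥0} with spectral initialization converges to a unique limit S^∞ ∈ O(d)^{⊗n} with linear rate: d_F(Sᵗ, S^∞) ≤ ρᵗ · d_F(S⁰, S^∞) for all t ≥ 0, where ρ = 1/2. -/

import Mathlib

open MeasureTheory Matrix Filter

namespace GOPP

/-- Frobenius norm of a real matrix. -/
noncomputable def frob {α β : Type*} [Fintype α] [Fintype β] (X : Matrix α β ℝ) : ℝ :=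
  Real.sqrt (∑ i, ∑ j, X i j ^ 2)

/-- Euclidean norm of a vector. -/
noncomputable def vnorm {β : Type*} [Fintype β] (v : β → ℝ) : ℝ :=
  Real.sqrt (∑ j, v j ^ 2)

/-- Operator (spectral) norm: the supremum of ‖Xu‖ over unit vectors u. -/
noncomputable def opNorm {α β : Type*} [Fintype α] [Fintype β] (X : Matrix α β ℝ) : ℝ :=
  sSup {r : ℝ | ∃ u : β → ℝ, vnorm u = 1 ∧ r = vnorm (X.mulVec u)}

/-- Smallest singular value: the infimum of ‖uᵀX‖ over unit vectors u (for a d×m matrix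
with d ≤ m this is the d-th largest singular value; for square matrices it is σ_min). -/
noncomputable def sigmaMin {α β : Type*} [Fintype α] [Fintype β] (X : Matrix α β ℝ) : ℝ :=
  sInf {r : ℝ | ∃ u : α → ℝ, vnorm u = 1 ∧ r = vnorm (Matrix.vecMul u X)}

/-- Condition number κ = σ_max/σ_min. -/
noncomputable def kappa {d m : ℕ} (A : Matrix (Fin d) (Fin m) ℝ) : ℝ :=
  opNorm A / sigmaMin A

/-- Q is an orthogonal matrix. -/
def IsOrth {d : ℕ} (Q : Matrix (Fin d) (Fin d) ℝ) : Prop :=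
  Qᵀ * Q = 1 ∧ Q * Qᵀ = 1

/-- Nuclear norm, via the dual characterization ‖M‖_* = max_{Q ∈ O(d)} ⟨Q, M⟩. -/
noncomputable def nuclearNorm {d : ℕ} (M : Matrix (Fin d) (Fin d) ℝ) : ℝ :=
  sSup {r : ℝ | ∃ Q : Matrix (Fin d) (Fin d) ℝ, IsOrth Q ∧ r = Matrix.trace (Qᵀ * M)}

/-- The i-th d×k block of an (nd)×k block matrix. -/
def blk {n d k : ℕ} (S : Matrix (Fin n × Fin d) (Fin k) ℝ) (i : Fin n) :
    Matrix (Fin d) (Fin k) ℝ :=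
  Matrix.of fun a b => S (i, a) b

/-- The i-th diagonal d×d block of an (nd)×(nd) matrix. -/
def dblk {n d : ℕ} (G : Matrix (Fin n × Fin d) (Fin n × Fin d) ℝ) (i : Fin n) :
    Matrix (Fin d) (Fin d) ℝ :=
  Matrix.of fun a b => G (i, a) (i, b)

/-- S ∈ O(d)^{⊗n}: each of the n d×d blocks of S is orthogonal. -/
def OrthBlocks {n d : ℕ} (S : Matrix (Fin n × Fin d) (Fin d) ℝ) : Prop :=
  ∀ i, IsOrth (blk S i)

/-- Z ∈ ℝ^{nd×d}: the vertical stack of n copies of I_d. -/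
def ZStack (n d : ℕ) : Matrix (Fin n × Fin d) (Fin d) ℝ :=
  Matrix.of fun p j => if p.2 = j then 1 else 0

/-- Vertical stack of n given d×k matrices. -/
def stack {n d k : ℕ} (B : Fin n → Matrix (Fin d) (Fin k) ℝ) :
    Matrix (Fin n × Fin d) (Fin k) ℝ :=
  Matrix.of fun p b => B p.1 p.2 b

/-- d_F(X,Y) = min_{Q ∈ O(d)} ‖X − YQ‖_F. -/
noncomputable def dF {n d : ℕ} (X Y : Matrix (Fin n × Fin d) (Fin d) ℝ) : ℝ :=
  sInf {r : ℝ | ∃ Q, IsOrth Q ∧ r = frob (X - Y * Q)}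

/-- R is a polar factor P(X) of X: an orthogonal global minimizer of ‖X − Q‖_F over O(d). -/
def IsPolar {d : ℕ} (X R : Matrix (Fin d) (Fin d) ℝ) : Prop :=
  IsOrth R ∧ ∀ Q : Matrix (Fin d) (Fin d) ℝ, IsOrth Q → frob (X - R) ≤ frob (X - Q)

/-- S = P_n(X): blockwise polar factor. -/
def IsPolarBlocks {n d : ℕ} (X S : Matrix (Fin n × Fin d) (Fin d) ℝ) : Prop :=
  ∀ i, IsPolar (blk X i) (blk S i)

/-- U collects (an orthonormal basis of the span of) the top d left singular vectors of D:
U has orthonormal columns and maximizes the Ky Fan quantity trace(Uᵀ(DDᵀ)U). -/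
def IsTopSingVecs {N : Type*} [Fintype N] {d m : ℕ} (D : Matrix N (Fin m) ℝ)
    (U : Matrix N (Fin d) ℝ) : Prop :=
  Uᵀ * U = 1 ∧ ∀ Q : Matrix N (Fin d) ℝ, Qᵀ * Q = 1 →
    Matrix.trace (Qᵀ * (D * Dᵀ) * Q) ≤ Matrix.trace (Uᵀ * (D * Dᵀ) * U)

/-- (U, S, V) is a top-d singular triple of D: orthonormal U, V, diagonal nonnegative S,
DV = US, DᵀU = VS, and U spans a top-d left singular subspace. -/
def IsSVDTriple {N : Type*} [Fintype N] {d m : ℕ} (D : Matrix N (Fin m) ℝ)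
    (U : Matrix N (Fin d) ℝ) (S : Matrix (Fin d) (Fin d) ℝ)
    (V : Matrix (Fin m) (Fin d) ℝ) : Prop :=
  Vᵀ * V = 1 ∧ (∀ a b, a ≠ b → S a b = 0) ∧ (∀ a, 0 ≤ S a a) ∧
    D * V = U * S ∧ Dᵀ * U = V * S ∧ IsTopSingVecs D U

/-- The generalized power method sequence with spectral initialization, run on the data
matrix D (so with C = DDᵀ): S⁰ = P_n(U) for top singular vectors U of D, and
S^{t+1} = P_n(C Sᵗ). -/
def IsGPM {n d m : ℕ} (D : Matrix (Fin n × Fin d) (Fin m) ℝ)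
    (S : ℕ → Matrix (Fin n × Fin d) (Fin d) ℝ) : Prop :=
  (∃ U, IsTopSingVecs D U ∧ IsPolarBlocks U (S 0)) ∧
    ∀ t, IsPolarBlocks (D * Dᵀ * S t) (S (t + 1))

/-- W^(i): W with its i-th block row replaced by 0. -/
def mask {n d m : ℕ} (W : Matrix (Fin n × Fin d) (Fin m) ℝ) (i : Fin n) :
    Matrix (Fin n × Fin d) (Fin m) ℝ :=
  Matrix.of fun p b => if p.1 = i then 0 else W p b

/-- The noise matrix Δ = WAᵀZᵀ + ZAWᵀ + σWWᵀ. -/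
noncomputable def delta {n d m : ℕ} (A : Matrix (Fin d) (Fin m) ℝ)
    (W : Matrix (Fin n × Fin d) (Fin m) ℝ) (σ : ℝ) :
    Matrix (Fin n × Fin d) (Fin n × Fin d) ℝ :=
  W * Aᵀ * (ZStack n d)ᵀ + ZStack n d * A * Wᵀ + σ • (W * Wᵀ)

/-- The i-th block column Δ_i = WAᵀ + ZAW_iᵀ + σWW_iᵀ of Δ. -/
noncomputable def deltaCol {n d m : ℕ} (A : Matrix (Fin d) (Fin m) ℝ)
    (W : Matrix (Fin n × Fin d) (Fin m) ℝ) (σ : ℝ) (i : Fin n) :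
    Matrix (Fin n × Fin d) (Fin d) ℝ :=
  W * Aᵀ + ZStack n d * A * (blk W i)ᵀ + σ • (W * (blk W i)ᵀ)

/-- The operator L S = C S/(n‖A‖²) with C = ZAAᵀZᵀ + σΔ. -/
noncomputable def Lop {n d m : ℕ} (A : Matrix (Fin d) (Fin m) ℝ)
    (W : Matrix (Fin n × Fin d) (Fin m) ℝ) (σ : ℝ)
    (S : Matrix (Fin n × Fin d) (Fin d) ℝ) : Matrix (Fin n × Fin d) (Fin d) ℝ :=
  ((n : ℝ) * opNorm A ^ 2)⁻¹ •
    ((ZStack n d * A * Aᵀ * (ZStack n d)ᵀ + σ • delta A W σ) * S)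

/-- √(nd) + √m + √(2γ n log n). -/
noncomputable def bnd1 (n d m : ℕ) (γ : ℝ) : ℝ :=
  Real.sqrt ((n : ℝ) * d) + Real.sqrt (m : ℝ) + Real.sqrt (2 * γ * n * Real.log n)

/-- √(nd) + √m + √(2γ log n). -/
noncomputable def bnd2 (n d m : ℕ) (γ : ℝ) : ℝ :=
  Real.sqrt ((n : ℝ) * d) + Real.sqrt (m : ℝ) + Real.sqrt (2 * γ * Real.log n)

/-- The basin of attraction N_ε. -/
def memNeps {n d : ℕ} (ε : ℝ) (S : Matrix (Fin n × Fin d) (Fin d) ℝ) : Prop :=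
  OrthBlocks S ∧ dF S (ZStack n d) ≤ ε * Real.sqrt ((n : ℝ) * d)

/-- The basin of attraction N_{ξ,∞}. -/
def memNxi {n d m : ℕ} (W : Matrix (Fin n × Fin d) (Fin m) ℝ) (γ ξ : ℝ)
    (S : Matrix (Fin n × Fin d) (Fin d) ℝ) : Prop :=
  OrthBlocks S ∧ ∀ i, frob (blk W i * Wᵀ * S) ≤ ξ * Real.sqrt (d : ℝ) * bnd1 n d m γ ^ 2

/-- The distribution of a matrix with i.i.d. standard Gaussian N(0,1) entries. -/
noncomputable def stdGaussian (ι κ : Type*) [Fintype ι] [Fintype κ] :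
    Measure (ι → κ → ℝ) :=
  Measure.pi fun _ : ι => Measure.pi fun _ : κ => ProbabilityTheory.gaussianReal 0 1

/-! ### Euclidean and Frobenius norms -/

section Norms

variable {α β δ : Type*} [Fintype α] [Fintype β] [Fintype δ]

lemma vnorm_eq_norm (v : β → ℝ) : vnorm v = ‖WithLp.toLp 2 v‖ := by
  rw [EuclideanSpace.norm_eq]
  simp [vnorm]

lemma vnorm_nonneg (v : β → ℝ) : 0 ≤ vnorm v := Real.sqrt_nonneg _

lemma vnorm_sq (v : β → ℝ) : vnorm v ^ 2 = v ⬝ᵥ v := by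
  rw [vnorm, Real.sq_sqrt (Finset.sum_nonneg fun _ _ => sq_nonneg _)]
  simp [dotProduct, sq]

lemma vnorm_add_le (u v : β → ℝ) : vnorm (u + v) ≤ vnorm u + vnorm v := by
  simp only [vnorm_eq_norm, WithLp.toLp_add]
  exact norm_add_le _ _

lemma vnorm_smul (c : ℝ) (v : β → ℝ) : vnorm (c • v) = |c| * vnorm v := by
  simp only [vnorm_eq_norm, WithLp.toLp_smul, norm_smul, Real.norm_eq_abs]

lemma vnorm_neg (v : β → ℝ) : vnorm (-v) = vnorm v := by
  simp [vnorm]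

lemma vnorm_zero : vnorm (0 : β → ℝ) = 0 := by
  simp [vnorm]

lemma vnorm_eq_zero {v : β → ℝ} : vnorm v = 0 ↔ v = 0 := by
  rw [vnorm_eq_norm, norm_eq_zero]
  exact WithLp.toLp_eq_zero 2

lemma vnorm_sub_ge (u v : β → ℝ) : vnorm u - vnorm v ≤ vnorm (u + v) := by
  have h := vnorm_add_le (u + v) (-v)
  rw [vnorm_neg, add_neg_cancel_right] at h
  linarith

lemma dotProduct_le (u v : β → ℝ) : u ⬝ᵥ v ≤ vnorm u * vnorm v := by
  rw [vnorm_eq_norm, vnorm_eq_norm, mul_comm]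
  exact real_inner_le_norm (WithLp.toLp 2 v) (WithLp.toLp 2 u)

lemma vnorm_normalize {u : β → ℝ} (hu : u ≠ 0) : vnorm ((vnorm u)⁻¹ • u) = 1 := by
  have h : vnorm u ≠ 0 := fun h => hu (vnorm_eq_zero.1 h)
  rw [vnorm_smul, abs_of_nonneg (inv_nonneg.2 (vnorm_nonneg u)), inv_mul_cancel₀ h]

lemma frob_eq_vnorm (X : Matrix α β ℝ) : frob X = vnorm fun p : α × β => X p.1 p.2 := by
  rw [frob, vnorm, Fintype.sum_prod_type]

lemma frob_nonneg (X : Matrix α β ℝ) : 0 ≤ frob X := Real.sqrt_nonneg _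

lemma frob_sq_eq_sum (X : Matrix α β ℝ) : frob X ^ 2 = ∑ i, ∑ j, X i j ^ 2 :=
  Real.sq_sqrt (Finset.sum_nonneg fun _ _ => Finset.sum_nonneg fun _ _ => sq_nonneg _)

lemma frob_sq (X : Matrix α β ℝ) : frob X ^ 2 = trace (Xᵀ * X) := by
  rw [frob_sq_eq_sum, Finset.sum_comm]
  simp [trace, mul_apply, sq]

lemma frob_sq_cols (X : Matrix α β ℝ) : frob X ^ 2 = ∑ j, vnorm (fun i => X i j) ^ 2 := by
  rw [frob_sq_eq_sum, Finset.sum_comm]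
  refine Finset.sum_congr rfl fun j _ => ?_
  rw [vnorm, Real.sq_sqrt (Finset.sum_nonneg fun _ _ => sq_nonneg _)]

lemma frob_add_le (X Y : Matrix α β ℝ) : frob (X + Y) ≤ frob X + frob Y := by
  simp only [frob_eq_vnorm]
  exact vnorm_add_le _ _

lemma frob_neg (X : Matrix α β ℝ) : frob (-X) = frob X := by
  simp [frob]

lemma frob_sub_le (X Y : Matrix α β ℝ) : frob (X - Y) ≤ frob X + frob Y := by
  rw [sub_eq_add_neg, ← frob_neg Y]
  exact frob_add_le _ _

lemma frob_sub_comm (X Y : Matrix α β ℝ) : frob (X - Y) = frob (Y - X) := by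
  rw [← frob_neg, neg_sub]

lemma frob_smul (c : ℝ) (X : Matrix α β ℝ) : frob (c • X) = |c| * frob X := by
  simp only [frob_eq_vnorm]
  exact vnorm_smul _ _

lemma frob_transpose (X : Matrix α β ℝ) : frob Xᵀ = frob X := by
  rw [frob, frob, Finset.sum_comm]
  simp

lemma frob_zero : frob (0 : Matrix α β ℝ) = 0 := by
  simp [frob]

lemma trace_transpose_mul_le (X Y : Matrix α β ℝ) : trace (Xᵀ * Y) ≤ frob X * frob Y := by
  have h := dotProduct_le (fun p : α × β => X p.1 p.2) fun p => Y p.1 p.2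
  rw [← frob_eq_vnorm, ← frob_eq_vnorm] at h
  refine le_trans (le_of_eq ?_) h
  rw [dotProduct, Fintype.sum_prod_type, Finset.sum_comm]
  simp [trace, mul_apply]

lemma trace_transpose_mul_comm (X Y : Matrix α β ℝ) : trace (Xᵀ * Y) = trace (Yᵀ * X) := by
  rw [← trace_transpose, transpose_mul, transpose_transpose]

lemma frob_sub_sq (X Y : Matrix α β ℝ) :
    frob (X - Y) ^ 2 = frob X ^ 2 + frob Y ^ 2 - 2 * trace (Yᵀ * X) := by
  rw [frob_sq, frob_sq, frob_sq, transpose_sub, Matrix.sub_mul, Matrix.mul_sub, Matrix.mul_sub, trace_sub,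
    trace_sub,
    trace_sub, trace_transpose_mul_comm X Y]
  ring

/-- `b` bounds the operator norm of `X`. -/
def OpLe (X : Matrix α β ℝ) (b : ℝ) : Prop := ∀ u : β → ℝ, vnorm (X *ᵥ u) ≤ b * vnorm u

namespace OpLe

variable {X Y : Matrix α β ℝ} {b c : ℝ}

lemma mono (h : OpLe X b) (hbc : b ≤ c) : OpLe X c := fun u =>
  (h u).trans (mul_le_mul_of_nonneg_right hbc (vnorm_nonneg u))

lemma add (hX : OpLe X b) (hY : OpLe Y c) : OpLe (X + Y) (b + c) := fun u => by
  rw [add_mulVec, add_mul]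
  exact (vnorm_add_le _ _).trans (add_le_add (hX u) (hY u))

lemma smul (r : ℝ) (hX : OpLe X b) : OpLe (r • X) (|r| * b) := fun u => by
  rw [smul_mulVec, vnorm_smul, mul_assoc]
  exact mul_le_mul_of_nonneg_left (hX u) (abs_nonneg r)

lemma mul {Y : Matrix β δ ℝ} (hX : OpLe X b) (hb : 0 ≤ b) (hY : OpLe Y c) :
    OpLe (X * Y) (b * c) := fun u => by
  rw [← mulVec_mulVec, mul_assoc]
  exact (hX _).trans (mul_le_mul_of_nonneg_left (hY u) hb)

lemma transpose (hX : OpLe X b) (hb : 0 ≤ b) : OpLe Xᵀ b := fun u => by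
  rcases (vnorm_nonneg (Xᵀ *ᵥ u)).eq_or_lt with h | h
  · rw [← h]
    exact mul_nonneg hb (vnorm_nonneg u)
  · have h1 : vnorm (Xᵀ *ᵥ u) ^ 2 ≤ vnorm u * (b * vnorm (Xᵀ *ᵥ u)) := by
      rw [vnorm_sq, dotProduct_mulVec, ← mulVec_transpose, transpose_transpose, dotProduct_comm]
      exact (dotProduct_le _ _).trans (mul_le_mul_of_nonneg_left (hX _) (vnorm_nonneg u))
    rw [sq] at h1
    nlinarith

lemma frob_mul_le {Y : Matrix β δ ℝ} (hX : OpLe X b) (hb : 0 ≤ b) :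
    frob (X * Y) ≤ b * frob Y := by
  refine le_of_abs_le (abs_le_of_sq_le_sq ?_ (mul_nonneg hb (frob_nonneg Y)))
  rw [mul_pow, frob_sq_cols, frob_sq_cols, Finset.mul_sum]
  refine Finset.sum_le_sum fun j _ => ?_
  rw [← mul_pow]
  exact pow_le_pow_left₀ (vnorm_nonneg _) (hX fun i => Y i j) 2

end OpLe

lemma opLe_frob (X : Matrix α β ℝ) : OpLe X (frob X) := fun u => by
  refine le_of_abs_le (abs_le_of_sq_le_sq ?_ (mul_nonneg (frob_nonneg X) (vnorm_nonneg u)))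
  rw [mul_pow, frob_sq_eq_sum, Finset.sum_mul, vnorm_sq, vnorm_sq, dotProduct]
  refine Finset.sum_le_sum fun i _ => ?_
  have h := Finset.sum_mul_sq_le_sq_mul_sq Finset.univ (X i) u
  simpa [mulVec, dotProduct, sq] using h

lemma opLe_one [DecidableEq α] : OpLe (1 : Matrix α α ℝ) 1 := fun u => by simp

lemma frob_mul_le (X : Matrix α β ℝ) (Y : Matrix β δ ℝ) : frob (X * Y) ≤ frob X * frob Y :=
  (opLe_frob X).frob_mul_le (frob_nonneg X)

lemma frob_one [DecidableEq α] : frob (1 : Matrix α α ℝ) = Real.sqrt (Fintype.card α) := by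
  rw [frob]
  simp [one_apply]

lemma OpLe.frob_le [DecidableEq β] {X : Matrix α β ℝ} {b : ℝ} (hX : OpLe X b) (hb : 0 ≤ b) :
    frob X ≤ b * Real.sqrt (Fintype.card β) := by
  have h := hX.frob_mul_le (Y := (1 : Matrix β β ℝ)) hb
  rwa [Matrix.mul_one, frob_one] at h

lemma opLe_of_transpose_mul_self [DecidableEq β] {X : Matrix α β ℝ} {r : ℝ} (hr : 0 ≤ r)
    (h : Xᵀ * X = r • 1) : OpLe X (Real.sqrt r) := fun u => by
  refine le_of_abs_le (abs_le_of_sq_le_sq ?_ (mul_nonneg (Real.sqrt_nonneg r) (vnorm_nonneg u)))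
  rw [mul_pow, Real.sq_sqrt hr, vnorm_sq, vnorm_sq, dotProduct_mulVec, ← mulVec_transpose,
    mulVec_mulVec, h, smul_mulVec, one_mulVec, smul_dotProduct, smul_eq_mul]

lemma frob_of_transpose_mul_self [DecidableEq β] {X : Matrix α β ℝ} {r : ℝ}
    (h : Xᵀ * X = r • 1) : frob X ^ 2 = r * Fintype.card β := by
  rw [frob_sq, h, trace_smul, trace_one, smul_eq_mul]

lemma frob_mul_of_mul_transpose [DecidableEq β] {Q : Matrix β β ℝ} (hQ : Q * Qᵀ = 1)
    (X : Matrix α β ℝ) : frob (X * Q) = frob X := by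
  refine (pow_left_inj₀ (frob_nonneg _) (frob_nonneg _) two_ne_zero).1 ?_
  rw [← frob_transpose, ← frob_transpose X, frob_sq, frob_sq, transpose_transpose,
    transpose_transpose, transpose_mul, ← Matrix.mul_assoc, Matrix.mul_assoc X, hQ,
    Matrix.mul_one]

lemma frob_mul_of_transpose_mul [DecidableEq α] {Q : Matrix α α ℝ} (hQ : Qᵀ * Q = 1)
    (X : Matrix α β ℝ) : frob (Q * X) = frob X := by
  refine (pow_left_inj₀ (frob_nonneg _) (frob_nonneg _) two_ne_zero).1 ?_
  rw [frob_sq, frob_sq, transpose_mul, Matrix.mul_assoc, ← Matrix.mul_assoc Qᵀ, hQ, Matrix.one_mul]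

/-- `s` bounds the singular values of `X` (seen as a map on row vectors) from below. -/
def LowLe (X : Matrix α β ℝ) (s : ℝ) : Prop := ∀ y : α → ℝ, s * vnorm y ≤ vnorm (Xᵀ *ᵥ y)

lemma LowLe.add {X Y : Matrix α β ℝ} {s b : ℝ} (hX : LowLe X s) (hY : OpLe Y b) (hb : 0 ≤ b) :
    LowLe (X + Y) (s - b) := fun y => by
  have h1 := hX y
  have h2 := hY.transpose hb y
  have h3 := vnorm_sub_ge (Xᵀ *ᵥ y) (Yᵀ *ᵥ y)
  rw [transpose_add, add_mulVec]
  linarith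

lemma LowLe.mono {X : Matrix α β ℝ} {s r : ℝ} (hX : LowLe X s) (h : r ≤ s) : LowLe X r :=
  fun y => (mul_le_mul_of_nonneg_right h (vnorm_nonneg y)).trans (hX y)

end Norms

/-! ### Orthogonal matrices and polar factors -/

section Polar

variable {d : ℕ}

lemma linear_coeff_eq_zero_of_nonpos {x y z : ℝ} (h : ∀ τ : ℝ, x * τ + y * τ ^ 2 + z * τ ^ 3 ≤ 0) :
    x = 0 := by
  have hd : HasDerivAt (fun τ : ℝ => x * τ + y * τ ^ 2 + z * τ ^ 3) x 0 := by
    have h1 := (((hasDerivAt_id' (0 : ℝ)).const_mul x).fun_add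
      ((hasDerivAt_pow 2 (0 : ℝ)).const_mul y)).fun_add ((hasDerivAt_pow 3 (0 : ℝ)).const_mul z)
    exact h1.congr_deriv (by norm_num)
  have hmax : IsLocalMax (fun τ : ℝ => x * τ + y * τ ^ 2 + z * τ ^ 3) 0 :=
    Eventually.of_forall fun τ => by simpa using h τ
  exact hmax.hasDerivAt_eq_zero hd

lemma IsOrth.one : IsOrth (1 : Matrix (Fin d) (Fin d) ℝ) := by simp [IsOrth]

lemma isOrth_of_transpose_mul {Q : Matrix (Fin d) (Fin d) ℝ} (h : Qᵀ * Q = 1) : IsOrth Q :=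
  ⟨h, mul_eq_one_comm.1 h⟩

lemma IsOrth.mul {P Q : Matrix (Fin d) (Fin d) ℝ} (hP : IsOrth P) (hQ : IsOrth Q) :
    IsOrth (P * Q) := isOrth_of_transpose_mul <| by
  rw [transpose_mul, mul_assoc, ← mul_assoc Pᵀ, hP.1, one_mul, hQ.1]

lemma IsOrth.transpose {Q : Matrix (Fin d) (Fin d) ℝ} (hQ : IsOrth Q) : IsOrth Qᵀ := by
  simpa [IsOrth, and_comm] using hQ

lemma IsOrth.vnorm_mulVec {Q : Matrix (Fin d) (Fin d) ℝ} (hQ : IsOrth Q) (u : Fin d → ℝ) :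
    vnorm (Q *ᵥ u) = vnorm u := by
  refine (pow_left_inj₀ (vnorm_nonneg _) (vnorm_nonneg _) two_ne_zero).1 ?_
  rw [vnorm_sq, vnorm_sq, dotProduct_mulVec, ← mulVec_transpose, mulVec_mulVec, hQ.1, one_mulVec]

lemma IsOrth.opLe {Q : Matrix (Fin d) (Fin d) ℝ} (hQ : IsOrth Q) : OpLe Q 1 := fun u => by
  rw [hQ.vnorm_mulVec, one_mul]

lemma IsOrth.frob_sq {Q : Matrix (Fin d) (Fin d) ℝ} (hQ : IsOrth Q) : frob Q ^ 2 = d := by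
  rw [GOPP.frob_sq, hQ.1, trace_one, Fintype.card_fin]

lemma isPolar_iff {X P : Matrix (Fin d) (Fin d) ℝ} :
    IsPolar X P ↔ IsOrth P ∧ ∀ Q, IsOrth Q → trace (Qᵀ * X) ≤ trace (Pᵀ * X) := by
  refine and_congr_right fun hP => forall₂_congr fun Q hQ => ?_
  rw [← pow_le_pow_iff_left₀ (frob_nonneg _) (frob_nonneg _) two_ne_zero, frob_sub_sq, frob_sub_sq,
    hP.frob_sq, hQ.frob_sq]
  constructor <;> intro h <;> linarith

/-- The reflection across the hyperplane orthogonal to `v` (the identity when `v = 0`). -/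
noncomputable def refl {α : Type*} [Fintype α] [DecidableEq α] (v : α → ℝ) : Matrix α α ℝ :=
  1 - (2 / (v ⬝ᵥ v)) • vecMulVec v v

lemma refl_transpose {α : Type*} [Fintype α] [DecidableEq α] (v : α → ℝ) : (refl v)ᵀ = refl v := by
  rw [refl, transpose_sub, transpose_one, transpose_smul, transpose_vecMulVec]

lemma vecMulVec_mul_vecMulVec_self {α : Type*} [Fintype α] (u v : α → ℝ) :
    vecMulVec u u * vecMulVec v v = (u ⬝ᵥ v) • vecMulVec u v := by
  rw [vecMulVec_mul_vecMulVec, vecMulVec_smul]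

lemma refl_mul_self {α : Type*} [Fintype α] [DecidableEq α] (v : α → ℝ) :
    refl v * refl v = 1 := by
  by_cases hv : v ⬝ᵥ v = 0
  · simp [refl, hv]
  · rw [refl, sub_mul, mul_sub, mul_sub, one_mul, one_mul, mul_one, smul_mul_smul_comm,
      vecMulVec_mul_vecMulVec_self, smul_smul, sub_sub, ← add_sub_assoc, ← add_smul, ← sub_smul]
    have : 2 / (v ⬝ᵥ v) + 2 / (v ⬝ᵥ v) - 2 / (v ⬝ᵥ v) * (2 / (v ⬝ᵥ v)) * (v ⬝ᵥ v) = 0 := by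
      field_simp
      ring
    rw [this, zero_smul, sub_zero]

lemma isOrth_refl (v : Fin d → ℝ) : IsOrth (refl v) := isOrth_of_transpose_mul <| by
  rw [refl_transpose, refl_mul_self]

lemma trace_vecMulVec_mul {α : Type*} [Fintype α] (u v : α → ℝ) (N : Matrix α α ℝ) :
    trace (vecMulVec u v * N) = v ⬝ᵥ N *ᵥ u := by
  rw [vecMulVec_mul, trace_vecMulVec, dotProduct_comm, dotProduct_mulVec]

lemma dotProduct_mulVec_nonneg_of_trace_max {N : Matrix (Fin d) (Fin d) ℝ}
    (h : ∀ H, IsOrth H → trace (H * N) ≤ trace N) (v : Fin d → ℝ) : 0 ≤ v ⬝ᵥ N *ᵥ v := by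
  have h1 := h _ (isOrth_refl v)
  by_cases hv : v = 0
  · simp [hv]
  have hpos : 0 < v ⬝ᵥ v := by
    rw [← vnorm_sq]
    exact pow_pos (lt_of_le_of_ne (vnorm_nonneg v) fun h => hv (vnorm_eq_zero.1 h.symm)) 2
  rw [refl, sub_mul, one_mul, trace_sub, smul_mul, trace_smul, trace_vecMulVec_mul,
    smul_eq_mul] at h1
  by_contra! hneg
  have : 2 / (v ⬝ᵥ v) * (v ⬝ᵥ N *ᵥ v) < 0 := mul_neg_of_pos_of_neg (by positivity) hneg
  linarith

lemma two_dotProduct_le_of_trace_max {N : Matrix (Fin d) (Fin d) ℝ}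
    (h : ∀ H, IsOrth H → trace (H * N) ≤ trace N) (u v : Fin d → ℝ) :
    2 * (u ⬝ᵥ v) * (v ⬝ᵥ N *ᵥ u) ≤ (v ⬝ᵥ v) * (u ⬝ᵥ N *ᵥ u) + (u ⬝ᵥ u) * (v ⬝ᵥ N *ᵥ v) := by
  have hpos : ∀ {w : Fin d → ℝ}, w ≠ 0 → 0 < w ⬝ᵥ w := fun {w} hw => by
    rw [← vnorm_sq]
    exact pow_pos (lt_of_le_of_ne (vnorm_nonneg w) fun h => hw (vnorm_eq_zero.1 h.symm)) 2
  by_cases hu : u = 0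
  · simp [hu]
  by_cases hv : v = 0
  · simp [hv]
  have h1 := h _ ((isOrth_refl u).mul (isOrth_refl v))
  have ha := hpos hu
  have hb := hpos hv
  rw [refl, refl, sub_mul, mul_sub, mul_sub, one_mul, one_mul, mul_one, smul_mul_smul_comm,
    vecMulVec_mul_vecMulVec_self, smul_smul, sub_mul, sub_mul, sub_mul, one_mul, trace_sub,
    trace_sub, trace_sub, smul_mul, smul_mul, smul_mul, trace_smul, trace_smul, trace_smul,
    trace_vecMulVec_mul, trace_vecMulVec_mul, trace_vecMulVec_mul, smul_eq_mul, smul_eq_mul,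
    smul_eq_mul] at h1
  have h2 : 2 / (u ⬝ᵥ u) * (2 / (v ⬝ᵥ v)) * (u ⬝ᵥ v) * (v ⬝ᵥ N *ᵥ u) ≤
      2 / (v ⬝ᵥ v) * (v ⬝ᵥ N *ᵥ v) + 2 / (u ⬝ᵥ u) * (u ⬝ᵥ N *ᵥ u) := by linarith
  have h3 := mul_le_mul_of_nonneg_left h2 (mul_pos ha hb).le
  field_simp at h3
  linarith

lemma dotProduct_add_smul (u w : Fin d → ℝ) (τ : ℝ) :
    (u + τ • w) ⬝ᵥ (u + τ • w) = u ⬝ᵥ u + 2 * τ * (u ⬝ᵥ w) + τ ^ 2 * (w ⬝ᵥ w) := by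
  simp only [add_dotProduct, dotProduct_add, smul_dotProduct, dotProduct_smul, smul_eq_mul]
  rw [dotProduct_comm w u]
  ring

lemma isSymm_of_trace_max {N : Matrix (Fin d) (Fin d) ℝ}
    (h : ∀ H, IsOrth H → trace (H * N) ≤ trace N) : Nᵀ = N := by
  have key : ∀ u w : Fin d → ℝ, (u ⬝ᵥ u) * (w ⬝ᵥ N *ᵥ u - u ⬝ᵥ N *ᵥ w) = 0 := by
    intro u w
    refine linear_coeff_eq_zero_of_nonpos
      (y := 2 * (u ⬝ᵥ w) * (w ⬝ᵥ N *ᵥ u) - (w ⬝ᵥ w) * (u ⬝ᵥ N *ᵥ u) - (u ⬝ᵥ u) * (w ⬝ᵥ N *ᵥ w))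
      (z := 0) fun τ => ?_
    have h1 := two_dotProduct_le_of_trace_max h u (u + τ • w)
    rw [dotProduct_add_smul] at h1
    simp only [mulVec_add, mulVec_smul, add_dotProduct, dotProduct_add, smul_dotProduct,
      dotProduct_smul, smul_eq_mul] at h1
    nlinarith
  ext i j
  have h1 := key (Pi.single i 1) (Pi.single j 1)
  simp at h1
  simp only [transpose_apply]
  linarith

lemma dotProduct_mulVec_ge {N : Matrix (Fin d) (Fin d) ℝ} (hsymm : Nᵀ = N)
    (hpos : ∀ v, 0 ≤ v ⬝ᵥ N *ᵥ v) {s : ℝ} (hs : 0 < s) (hlow : LowLe N s) (y : Fin d → ℝ) :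
    s * (y ⬝ᵥ y) ≤ y ⬝ᵥ N *ᵥ y := by
  have hsw : ∀ u v : Fin d → ℝ, u ⬝ᵥ N *ᵥ v = v ⬝ᵥ N *ᵥ u := fun u v => by
    rw [dotProduct_mulVec, ← mulVec_transpose, hsymm, dotProduct_comm]
  rw [LowLe, hsymm] at hlow
  have hinj : Function.Injective N.mulVecLin := by
    rw [← LinearMap.ker_eq_bot, LinearMap.ker_eq_bot']
    intro v hv
    have h1 := hlow v
    rw [mulVecLin_apply] at hv
    rw [hv, vnorm_zero] at h1
    exact vnorm_eq_zero.1 (le_antisymm (by nlinarith [vnorm_nonneg v]) (vnorm_nonneg v))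
  obtain ⟨z, hz⟩ := LinearMap.injective_iff_surjective.1 hinj y
  rw [mulVecLin_apply] at hz
  have hzy : s * vnorm z ≤ vnorm y := hz ▸ hlow z
  have hcs : ∀ τ : ℝ, 0 ≤ y ⬝ᵥ N *ᵥ y - 2 * τ * (y ⬝ᵥ y) + τ ^ 2 * (z ⬝ᵥ y) := by
    intro τ
    have h1 := hpos (y - τ • z)
    simp only [mulVec_sub, mulVec_smul, sub_dotProduct, dotProduct_sub, smul_dotProduct,
      dotProduct_smul, smul_eq_mul, hz] at h1
    rw [hsw z y, hz] at h1
    nlinarith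
  have h1 := hcs s
  have h2 : z ⬝ᵥ y ≤ vnorm z * vnorm y := dotProduct_le z y
  have h3 : s * (z ⬝ᵥ y) ≤ y ⬝ᵥ y := by
    rw [← vnorm_sq]
    nlinarith [vnorm_nonneg y]
  nlinarith

lemma trace_transpose_mul_mul_ge {N E : Matrix (Fin d) (Fin d) ℝ} {s : ℝ}
    (h : ∀ y : Fin d → ℝ, s * (y ⬝ᵥ y) ≤ y ⬝ᵥ N *ᵥ y) :
    s * frob E ^ 2 ≤ trace (Eᵀ * N * E) := by
  rw [frob_sq_cols, Finset.mul_sum, trace]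
  refine Finset.sum_le_sum fun j _ => ?_
  rw [vnorm_sq]
  refine (h _).trans (le_of_eq ?_)
  rw [diag_apply, Matrix.mul_assoc, mul_apply, dotProduct]
  rfl

lemma IsPolar.trace_max {X P : Matrix (Fin d) (Fin d) ℝ} (h : IsPolar X P) :
    ∀ H, IsOrth H → trace (H * (Pᵀ * X)) ≤ trace (Pᵀ * X) := fun H hH => by
  have h1 := (isPolar_iff.1 h).2 (P * Hᵀ) (h.1.mul hH.transpose)
  rwa [transpose_mul, transpose_transpose, mul_assoc] at h1

lemma IsPolar.strong_concavity {X P R : Matrix (Fin d) (Fin d) ℝ} (h : IsPolar X P) {s : ℝ}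
    (hs : 0 < s) (hlow : LowLe X s) (hR : IsOrth R) :
    s / 2 * frob (P - R) ^ 2 ≤ trace ((P - R)ᵀ * X) := by
  set N := Pᵀ * X with hN
  have hsymm : Nᵀ = N := isSymm_of_trace_max h.trace_max
  have hX : X = P * N := by rw [hN, ← mul_assoc, h.1.2, one_mul]
  have hlowN : LowLe N s := fun y => by
    rw [hN, transpose_mul, transpose_transpose, ← mulVec_mulVec, ← h.1.vnorm_mulVec y]
    exact hlow _
  have hge := dotProduct_mulVec_ge hsymm (dotProduct_mulVec_nonneg_of_trace_max h.trace_max) hs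
    hlowN
  set R' := Pᵀ * R with hR'
  have hRe : R = P * R' := by rw [hR', ← mul_assoc, h.1.2, one_mul]
  have hR'o : IsOrth R' := h.1.transpose.mul hR
  have hfrob : frob (P - R) = frob (1 - R') := by
    rw [← frob_mul_of_transpose_mul h.1.1 (1 - R'), mul_sub, mul_one, ← hRe]
  have htr : trace ((P - R)ᵀ * X) = trace ((1 - R')ᵀ * N) := by
    have : P - R = P * (1 - R') := by rw [mul_sub, mul_one, ← hRe]
    rw [this, transpose_mul, mul_assoc, ← hN]
  have h2 : trace ((1 - R')ᵀ * N * (1 - R')) = 2 * trace ((1 - R')ᵀ * N) := by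
    have e1 : trace (N * R') = trace (R'ᵀ * N) := by
      rw [← trace_transpose (N * R'), transpose_mul, hsymm]
    have e2 : trace (R'ᵀ * N * R') = trace N := by
      rw [trace_mul_comm, ← mul_assoc, hR'o.2, one_mul]
    rw [transpose_sub, transpose_one, sub_mul, one_mul, sub_mul, mul_sub, mul_sub, mul_one, mul_one,
      trace_sub, trace_sub, trace_sub, trace_sub, e1, e2]
    ring
  rw [hfrob, htr]
  have := trace_transpose_mul_mul_ge (E := 1 - R') hge
  linarith

/-- Lipschitz stability of the polar factor at a well-conditioned matrix. -/
lemma IsPolar.lipschitz {X Y P R : Matrix (Fin d) (Fin d) ℝ} {s : ℝ} (hP : IsPolar X P)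
    (hR : IsPolar Y R) (hs : 0 < s) (hlow : LowLe X s) :
    frob (P - R) ≤ 2 / s * frob (X - Y) := by
  have h1 := hP.strong_concavity hs hlow hR.1
  have h2 := (isPolar_iff.1 hR).2 P hP.1
  have h3 := trace_transpose_mul_le (P - R) (X - Y)
  have h4 : trace ((P - R)ᵀ * X) ≤ trace ((P - R)ᵀ * (X - Y)) := by
    rw [mul_sub, trace_sub, transpose_sub, sub_mul, sub_mul, trace_sub, trace_sub]
    linarith
  rcases (frob_nonneg (P - R)).eq_or_lt with h0 | h0
  · rw [← h0]
    exact mul_nonneg (by positivity) (frob_nonneg _)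
  · have h5 : frob (P - R) * (s / 2 * frob (P - R)) ≤ frob (P - R) * frob (X - Y) := by
      nlinarith
    have h6 := le_of_mul_le_mul_left h5 h0
    rw [div_mul_eq_mul_div, le_div_iff₀ hs]
    linarith

lemma isPolar_mul_transpose_mul {β : Type*} [Fintype β] (B : Matrix (Fin d) β ℝ)
    {R : Matrix (Fin d) (Fin d) ℝ} (hR : IsOrth R) : IsPolar (B * Bᵀ * R) R := by
  refine isPolar_iff.2 ⟨hR, fun Q hQ => ?_⟩
  have h1 : trace (Rᵀ * (B * Bᵀ * R)) = frob B ^ 2 := by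
    rw [trace_mul_comm, mul_assoc, hR.2, mul_one, trace_mul_comm, frob_sq]
  have h2 : trace (Qᵀ * (B * Bᵀ * R)) = trace ((Bᵀ * Q)ᵀ * (Bᵀ * R)) := by
    rw [transpose_mul, transpose_transpose]
    simp only [Matrix.mul_assoc]
  rw [h1, h2]
  refine (trace_transpose_mul_le _ _).trans (le_of_eq ?_)
  rw [frob_mul_of_mul_transpose hQ.2, frob_mul_of_mul_transpose hR.2, frob_transpose, sq]

lemma IsPolar.mul_right {X P Q : Matrix (Fin d) (Fin d) ℝ} (h : IsPolar X P) (hQ : IsOrth Q) :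
    IsPolar (X * Q) (P * Q) := by
  refine ⟨h.1.mul hQ, fun R hR => ?_⟩
  have h1 := h.2 (R * Qᵀ) (hR.mul hQ.transpose)
  rw [← frob_mul_of_mul_transpose hQ.2 (X - P), ← frob_mul_of_mul_transpose hQ.2 (X - R * Qᵀ),
    sub_mul, sub_mul, mul_assoc, hQ.1, mul_one] at h1
  exact h1

lemma IsPolar.smul {X P : Matrix (Fin d) (Fin d) ℝ} (h : IsPolar X P) {r : ℝ} (hr : 0 ≤ r) :
    IsPolar (r • X) P := by
  rw [isPolar_iff] at h ⊢
  refine ⟨h.1, fun Q hQ => ?_⟩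
  rw [Matrix.mul_smul, Matrix.mul_smul, trace_smul, trace_smul, smul_eq_mul, smul_eq_mul]
  exact mul_le_mul_of_nonneg_left (h.2 Q hQ) hr

end Polar

/-! ### Block matrices -/

section Blocks

variable {n d k m : ℕ}

lemma blk_mul {p : ℕ} (X : Matrix (Fin n × Fin d) (Fin k) ℝ) (Y : Matrix (Fin k) (Fin p) ℝ)
    (i : Fin n) : blk (X * Y) i = blk X i * Y := rfl

lemma blk_add (X Y : Matrix (Fin n × Fin d) (Fin k) ℝ) (i : Fin n) :
    blk (X + Y) i = blk X i + blk Y i := rfl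

lemma blk_sub (X Y : Matrix (Fin n × Fin d) (Fin k) ℝ) (i : Fin n) :
    blk (X - Y) i = blk X i - blk Y i := rfl

lemma blk_smul (r : ℝ) (X : Matrix (Fin n × Fin d) (Fin k) ℝ) (i : Fin n) :
    blk (r • X) i = r • blk X i := rfl

lemma blk_ZStack (i : Fin n) : blk (ZStack n d) i = 1 := by
  ext a b
  simp [blk, ZStack, one_apply]

lemma blk_ZStack_mul (A : Matrix (Fin d) (Fin k) ℝ) (i : Fin n) : blk (ZStack n d * A) i = A := by
  rw [blk_mul, blk_ZStack, Matrix.one_mul]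

lemma transpose_mul_eq_sum_blk (X : Matrix (Fin n × Fin d) (Fin k) ℝ)
    (Y : Matrix (Fin n × Fin d) (Fin m) ℝ) : Xᵀ * Y = ∑ i, (blk X i)ᵀ * blk Y i := by
  ext a b
  rw [mul_apply, Fintype.sum_prod_type, Matrix.sum_apply]
  rfl

lemma frob_sq_eq_sum_blk (X : Matrix (Fin n × Fin d) (Fin k) ℝ) :
    frob X ^ 2 = ∑ i, frob (blk X i) ^ 2 := by
  rw [frob_sq_eq_sum, Fintype.sum_prod_type]
  exact Finset.sum_congr rfl fun i _ => (frob_sq_eq_sum _).symm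

lemma frob_le_mul_of_blk {X : Matrix (Fin n × Fin d) (Fin k) ℝ}
    {Y : Matrix (Fin n × Fin d) (Fin m) ℝ} {r : ℝ} (hr : 0 ≤ r)
    (h : ∀ i, frob (blk X i) ≤ r * frob (blk Y i)) : frob X ≤ r * frob Y := by
  refine (pow_le_pow_iff_left₀ (frob_nonneg _) (mul_nonneg hr (frob_nonneg _)) two_ne_zero).1 ?_
  rw [mul_pow, frob_sq_eq_sum_blk X, frob_sq_eq_sum_blk Y, Finset.mul_sum]
  refine Finset.sum_le_sum fun i _ => ?_
  rw [← mul_pow]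
  exact pow_le_pow_left₀ (frob_nonneg _) (h i) 2

lemma vnorm_sq_eq_sum_blk (v : Fin n × Fin d → ℝ) :
    vnorm v ^ 2 = ∑ i, vnorm (fun a => v (i, a)) ^ 2 := by
  rw [vnorm_sq, dotProduct, Fintype.sum_prod_type]
  exact Finset.sum_congr rfl fun i _ => (vnorm_sq _).symm

lemma OpLe.blk {X : Matrix (Fin n × Fin d) (Fin k) ℝ} {b : ℝ} (h : OpLe X b) (i : Fin n) :
    OpLe (blk X i) b := fun u => by
  refine le_trans ?_ (h u)
  refine (pow_le_pow_iff_left₀ (vnorm_nonneg _) (vnorm_nonneg _) two_ne_zero).1 ?_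
  rw [vnorm_sq_eq_sum_blk (X *ᵥ u)]
  exact Finset.single_le_sum (f := fun i => vnorm (fun a => (X *ᵥ u) (i, a)) ^ 2)
    (fun _ _ => sq_nonneg _) (Finset.mem_univ i)

lemma blk_mask (X : Matrix (Fin n × Fin d) (Fin m) ℝ) (i j : Fin n) :
    blk (mask X j) i = if i = j then 0 else blk X i := by
  split_ifs with h
  · ext a b; simp [GOPP.blk, mask, h]
  · ext a b; simp [GOPP.blk, mask, h]

lemma OpLe.mask {X : Matrix (Fin n × Fin d) (Fin m) ℝ} {b : ℝ} (h : OpLe X b) (j : Fin n) :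
    OpLe (mask X j) b := fun u => by
  refine le_trans ?_ (h u)
  refine (pow_le_pow_iff_left₀ (vnorm_nonneg _) (vnorm_nonneg _) two_ne_zero).1 ?_
  rw [vnorm_sq_eq_sum_blk, vnorm_sq_eq_sum_blk]
  refine Finset.sum_le_sum fun i _ => ?_
  change vnorm (GOPP.blk (GOPP.mask X j) i *ᵥ u) ^ 2 ≤ vnorm (GOPP.blk X i *ᵥ u) ^ 2
  rw [blk_mask]
  split_ifs
  · rw [zero_mulVec, vnorm_zero]
    nlinarith [sq_nonneg (vnorm (GOPP.blk X i *ᵥ u))]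
  · exact le_rfl

lemma sub_mask_transpose_mul (X : Matrix (Fin n × Fin d) (Fin m) ℝ) (j : Fin n)
    (Y : Matrix (Fin n × Fin d) (Fin k) ℝ) : (X - mask X j)ᵀ * Y = (blk X j)ᵀ * blk Y j := by
  rw [transpose_mul_eq_sum_blk, Finset.sum_eq_single j]
  · rw [blk_sub, blk_mask, if_pos rfl, sub_zero]
  · intro i _ hi
    rw [blk_sub, blk_mask, if_neg hi, sub_self, transpose_zero, Matrix.zero_mul]
  · exact fun h => absurd (Finset.mem_univ j) h

lemma frob_sub_mask_mul (X : Matrix (Fin n × Fin d) (Fin m) ℝ) (j : Fin n)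
    (Y : Matrix (Fin m) (Fin k) ℝ) : frob ((X - mask X j) * Y) = frob (blk X j * Y) := by
  refine (pow_left_inj₀ (frob_nonneg _) (frob_nonneg _) two_ne_zero).1 ?_
  rw [frob_sq_eq_sum_blk, Finset.sum_eq_single j]
  · rw [blk_mul, blk_sub, blk_mask, if_pos rfl, sub_zero]
  · intro i _ hi
    rw [blk_mul, blk_sub, blk_mask, if_neg hi, sub_self, Matrix.zero_mul, frob_zero]
    norm_num
  · exact fun h => absurd (Finset.mem_univ j) h

lemma ZStack_transpose_mul_self : (ZStack n d)ᵀ * ZStack n d = (n : ℝ) • 1 := by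
  rw [transpose_mul_eq_sum_blk]
  simp [blk_ZStack, Nat.cast_smul_eq_nsmul]

lemma OrthBlocks.transpose_mul_self {S : Matrix (Fin n × Fin d) (Fin d) ℝ} (hS : OrthBlocks S) :
    Sᵀ * S = (n : ℝ) • 1 := by
  rw [transpose_mul_eq_sum_blk, Finset.sum_congr rfl fun i _ => (hS i).1]
  simp [Nat.cast_smul_eq_nsmul]

lemma OrthBlocks.mul {S : Matrix (Fin n × Fin d) (Fin d) ℝ} (hS : OrthBlocks S)
    {Q : Matrix (Fin d) (Fin d) ℝ} (hQ : IsOrth Q) : OrthBlocks (S * Q) := fun i => (hS i).mul hQ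

lemma orthBlocks_ZStack_mul {Q : Matrix (Fin d) (Fin d) ℝ} (hQ : IsOrth Q) :
    OrthBlocks (ZStack n d * Q) := fun i => by rwa [blk_ZStack_mul]

lemma IsPolarBlocks.orthBlocks {X S : Matrix (Fin n × Fin d) (Fin d) ℝ} (h : IsPolarBlocks X S) :
    OrthBlocks S := fun i => (h i).1

lemma IsPolarBlocks.mul_right {X S : Matrix (Fin n × Fin d) (Fin d) ℝ} (h : IsPolarBlocks X S)
    {Q : Matrix (Fin d) (Fin d) ℝ} (hQ : IsOrth Q) : IsPolarBlocks (X * Q) (S * Q) :=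
  fun i => (h i).mul_right hQ

end Blocks

/-! ### Compactness of the Stiefel manifold and existence of polar factors -/

section Compact

lemma isCompact_stiefel (α β : Type*) [Fintype α] [Fintype β] [DecidableEq β] :
    IsCompact {U : Matrix α β ℝ | Uᵀ * U = 1} := by
  have h1 : IsCompact (Set.univ.pi fun _ : α => Set.univ.pi fun _ : β => Set.Icc (-1 : ℝ) 1) :=
    isCompact_univ_pi fun _ => isCompact_univ_pi fun _ => isCompact_Icc
  refine h1.of_isClosed_subset (isClosed_eq ?_ continuous_const)
    fun (U : Matrix α β ℝ) hU => ?_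
  · exact (continuous_id.matrix_transpose).matrix_mul continuous_id
  · intro i _ j _
    have h2 : ∑ k, U k j ^ 2 = 1 := by
      have h3 : (Uᵀ * U) j j = (1 : Matrix β β ℝ) j j := congrFun (congrFun hU j) j
      rw [mul_apply, one_apply_eq] at h3
      simpa [sq] using h3
    have h3 := Finset.single_le_sum (f := fun k => U k j ^ 2) (fun _ _ => sq_nonneg _)
      (Finset.mem_univ i)
    simp only [h2] at h3
    exact abs_le.1 ((sq_le_one_iff_abs_le_one _).1 h3)

variable {d n : ℕ}

lemma isCompact_orth (d : ℕ) : IsCompact {Q : Matrix (Fin d) (Fin d) ℝ | IsOrth Q} := by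
  convert isCompact_stiefel (Fin d) (Fin d) using 1
  ext Q
  exact ⟨fun h => h.1, isOrth_of_transpose_mul⟩

lemma continuous_trace_transpose_mul {α β : Type*} [Fintype α] [Fintype β] (X : Matrix α β ℝ) :
    Continuous fun Q : Matrix α β ℝ => trace (Qᵀ * X) :=
  (continuous_id.matrix_transpose.matrix_mul continuous_const).matrix_trace

lemma exists_isPolar (X : Matrix (Fin d) (Fin d) ℝ) : ∃ R, IsPolar X R := by
  obtain ⟨R, hR, h⟩ := (isCompact_orth d).exists_isMaxOn ⟨1, IsOrth.one⟩
    (continuous_trace_transpose_mul X).continuousOn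
  exact ⟨R, isPolar_iff.2 ⟨hR, fun Q hQ => h hQ⟩⟩

lemma exists_isPolarBlocks (X : Matrix (Fin n × Fin d) (Fin d) ℝ) : ∃ S, IsPolarBlocks X S :=
  ⟨stack fun i => (exists_isPolar (blk X i)).choose, fun i =>
    (exists_isPolar (blk X i)).choose_spec⟩

lemma continuous_frob {α β : Type*} [Fintype α] [Fintype β] :
    Continuous fun X : Matrix α β ℝ => frob X := by
  unfold frob
  refine Real.continuous_sqrt.comp ?_
  exact continuous_finsetSum _ fun i _ => continuous_finsetSum _ fun j _ =>
    (continuous_id.matrix_elem i j).pow 2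

lemma isCompact_orthBlocks (n d : ℕ) :
    IsCompact {S : Matrix (Fin n × Fin d) (Fin d) ℝ | OrthBlocks S} := by
  have h1 : IsCompact (Set.univ.pi fun _ : Fin n => {Q : Matrix (Fin d) (Fin d) ℝ | IsOrth Q}) :=
    isCompact_univ_pi fun _ => isCompact_orth d
  have h2 : Continuous fun B : Fin n → Matrix (Fin d) (Fin d) ℝ => stack B :=
    continuous_matrix fun p b => ((continuous_apply p.1).matrix_elem p.2 b)
  convert h1.image h2 using 1
  ext S
  refine ⟨fun hS => ⟨fun i => blk S i, fun i _ => hS i, rfl⟩, ?_⟩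
  rintro ⟨B, hB, rfl⟩ i
  exact hB i trivial

end Compact

/-! ### Alignment of frames and the distance modulo rotations -/

section Align

variable {n d : ℕ} {N : Type*} [Fintype N]

lemma frob_sub_mul_sq {S T : Matrix N (Fin d) ℝ} {Q : Matrix (Fin d) (Fin d) ℝ} (hQ : IsOrth Q) :
    frob (S - T * Q) ^ 2 = frob S ^ 2 - 2 * trace (Qᵀ * (Tᵀ * S)) + frob T ^ 2 := by
  rw [frob_sub_sq, frob_mul_of_mul_transpose hQ.2, transpose_mul,
    Matrix.mul_assoc]
  ring

/-- The polar factor of `TᵀS` is the optimal rotation aligning `T` with `S`. -/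
lemma IsPolar.frob_sub_le {S T : Matrix N (Fin d) ℝ} {Q R : Matrix (Fin d) (Fin d) ℝ}
    (hQ : IsPolar (Tᵀ * S) Q) (hR : IsOrth R) : frob (S - T * Q) ≤ frob (S - T * R) := by
  refine (pow_le_pow_iff_left₀ (frob_nonneg _) (frob_nonneg _) two_ne_zero).1 ?_
  rw [frob_sub_mul_sq hQ.1, frob_sub_mul_sq hR]
  linarith [(isPolar_iff.1 hQ).2 R hR]

lemma aligned_transpose_mul {S T : Matrix N (Fin d) ℝ} {Q : Matrix (Fin d) (Fin d) ℝ} {r : ℝ}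
    (hS : Sᵀ * S = r • 1) (hT : Tᵀ * T = r • 1) (hQ : IsPolar (Tᵀ * S) Q) :
    (S - T * Q)ᵀ * (S - T * Q) = (2 : ℝ) • (Sᵀ * (S - T * Q)) := by
  have h1 : (Qᵀ * (Tᵀ * S))ᵀ = Qᵀ * (Tᵀ * S) := isSymm_of_trace_max hQ.trace_max
  have h2 : Sᵀ * (T * Q) = Qᵀ * (Tᵀ * S) := by
    rw [← h1]
    simp only [transpose_mul, transpose_transpose, Matrix.mul_assoc]
  have h3 : Qᵀ * (Tᵀ * (T * Q)) = r • 1 := by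
    rw [← Matrix.mul_assoc Tᵀ, hT, smul_mul, one_mul, Matrix.mul_smul, hQ.1.1]
  rw [transpose_sub, Matrix.sub_mul, Matrix.mul_sub, Matrix.mul_sub, transpose_mul,
    Matrix.mul_assoc Qᵀ, Matrix.mul_assoc Qᵀ, h2, h3, hS, two_smul]
  abel

lemma frob_transpose_mul_aligned_le {S T : Matrix N (Fin d) ℝ} {Q : Matrix (Fin d) (Fin d) ℝ}
    {r : ℝ} (hS : Sᵀ * S = r • 1) (hT : Tᵀ * T = r • 1) (hQ : IsPolar (Tᵀ * S) Q) :
    frob (Sᵀ * (S - T * Q)) ≤ frob (S - T * Q) ^ 2 / 2 := by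
  have h1 := frob_mul_le (S - T * Q)ᵀ (S - T * Q)
  rw [aligned_transpose_mul hS hT hQ, frob_smul, frob_transpose, abs_two] at h1
  nlinarith

/-- Procrustes distance bounded by the projection distance. -/
lemma frob_aligned_sq_le {S T : Matrix N (Fin d) ℝ} {Q : Matrix (Fin d) (Fin d) ℝ}
    {r : ℝ} (hr : 0 < r) (hS : Sᵀ * S = r • 1) (hT : Tᵀ * T = r • 1)
    (hQ : IsPolar (Tᵀ * S) Q) :
    frob (S - T * Q) ^ 2 ≤ 2 * (r * d - frob (Tᵀ * S) ^ 2 / r) := by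
  set H := Qᵀ * (Tᵀ * S) with hH
  have hsymm : Hᵀ = H := isSymm_of_trace_max hQ.trace_max
  have hpos := dotProduct_mulVec_nonneg_of_trace_max hQ.trace_max
  set E := S - T * Q with hE
  have h0 := aligned_transpose_mul hS hT hQ
  have h2 : Sᵀ * (T * Q) = H := by
    rw [← hsymm, hH]
    simp only [transpose_mul, transpose_transpose, Matrix.mul_assoc]
  have h3 : Sᵀ * E = r • 1 - H := by rw [hE, Matrix.mul_sub, hS, h2]
  rw [← hE, h3] at h0
  have h4 : frob E ^ 2 = 2 * (r * d - trace H) := by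
    rw [frob_sq, h0, trace_smul, trace_sub, trace_smul, trace_one, Fintype.card_fin]
    simp
  have h5 : frob (Tᵀ * S) ^ 2 = trace (H * H) := by
    rw [← frob_mul_of_transpose_mul (Q := Qᵀ) (by rw [transpose_transpose, hQ.1.2]) (Tᵀ * S),
      frob_sq, ← hH, hsymm]
  have h6 : 0 ≤ trace (E * H * Eᵀ) := by
    rw [trace]
    refine Finset.sum_nonneg fun i _ => ?_
    refine (hpos (E i)).trans (le_of_eq ?_)
    rw [diag_apply, Matrix.mul_assoc, mul_apply, dotProduct]
    refine Finset.sum_congr rfl fun a _ => ?_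
    rw [mulVec, mul_apply]
    rfl
  rw [Matrix.mul_assoc, trace_mul_comm, Matrix.mul_assoc, h0, Matrix.mul_smul, mul_sub,
    trace_smul, trace_sub, Matrix.mul_smul, mul_one, trace_smul, smul_eq_mul, smul_eq_mul] at h6
  rw [h4, h5]
  have h7 : trace (H * H) / r ≤ trace H := by
    rw [div_le_iff₀ hr]
    linarith
  linarith

lemma dF_bddBelow (X Y : Matrix (Fin n × Fin d) (Fin d) ℝ) :
    BddBelow {r : ℝ | ∃ Q, IsOrth Q ∧ r = frob (X - Y * Q)} := by
  refine ⟨0, ?_⟩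
  rintro r ⟨Q, -, rfl⟩
  exact frob_nonneg _

lemma dF_nonneg (X Y : Matrix (Fin n × Fin d) (Fin d) ℝ) : 0 ≤ dF X Y := by
  refine Real.sInf_nonneg ?_
  rintro r ⟨Q, -, rfl⟩
  exact frob_nonneg _

lemma dF_le {X Y : Matrix (Fin n × Fin d) (Fin d) ℝ} {Q : Matrix (Fin d) (Fin d) ℝ}
    (hQ : IsOrth Q) : dF X Y ≤ frob (X - Y * Q) := csInf_le (dF_bddBelow X Y) ⟨Q, hQ, rfl⟩

lemma IsPolar.dF_eq {S T : Matrix (Fin n × Fin d) (Fin d) ℝ} {Q : Matrix (Fin d) (Fin d) ℝ}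
    (hQ : IsPolar (Tᵀ * S) Q) : dF S T = frob (S - T * Q) := by
  refine le_antisymm (dF_le hQ.1) (le_csInf ⟨_, 1, IsOrth.one, rfl⟩ ?_)
  rintro r ⟨R, hR, rfl⟩
  exact hQ.frob_sub_le hR

lemma dF_comm (X Y : Matrix (Fin n × Fin d) (Fin d) ℝ) : dF X Y = dF Y X := by
  have key : ∀ X Y : Matrix (Fin n × Fin d) (Fin d) ℝ, dF X Y ≤ dF Y X := fun X Y => by
    obtain ⟨Q, hQ⟩ := exists_isPolar (Xᵀ * Y)
    rw [hQ.dF_eq, frob_sub_comm]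
    refine (dF_le hQ.1.transpose).trans (le_of_eq ?_)
    rw [← frob_mul_of_mul_transpose hQ.1.2, Matrix.sub_mul, Matrix.mul_assoc, hQ.1.1,
      Matrix.mul_one]
  exact le_antisymm (key X Y) (key Y X)

lemma dF_triangle (X Y T : Matrix (Fin n × Fin d) (Fin d) ℝ) : dF X T ≤ dF X Y + dF Y T := by
  obtain ⟨Q, hQ⟩ := exists_isPolar (Yᵀ * X)
  obtain ⟨R, hR⟩ := exists_isPolar (Tᵀ * Y)
  rw [hQ.dF_eq, hR.dF_eq, ← frob_mul_of_mul_transpose hQ.1.2 (Y - T * R)]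
  refine (dF_le (hR.1.mul hQ.1)).trans (le_trans (le_of_eq ?_) (frob_add_le _ _))
  rw [Matrix.sub_mul, Matrix.mul_assoc, sub_add_sub_cancel]

end Align

/-! ### Deterministic analysis of one power step -/

section PowerStep

variable {n d m : ℕ}

lemma frob_transpose_mul_aligned_le' {N : Type*} [Fintype N] {S T : Matrix N (Fin d) ℝ}
    {Q : Matrix (Fin d) (Fin d) ℝ} {r : ℝ} (hS : Sᵀ * S = r • 1) (hT : Tᵀ * T = r • 1)
    (hQ : IsPolar (Tᵀ * S) Q) : frob (Tᵀ * (S - T * Q)) ≤ frob (S - T * Q) ^ 2 / 2 := by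
  have h0 := aligned_transpose_mul hS hT hQ
  have h1 := frob_mul_le (S - T * Q)ᵀ (S - T * Q)
  have h2 : (-2 : ℝ) • (Qᵀ * (Tᵀ * (S - T * Q))) = (S - T * Q)ᵀ * (S - T * Q) := by
    have h3 : (S - T * Q)ᵀ * (S - T * Q)
        = Sᵀ * (S - T * Q) - Qᵀ * (Tᵀ * (S - T * Q)) := by
      rw [transpose_sub, Matrix.sub_mul, transpose_mul, Matrix.mul_assoc]
    have h4 : Qᵀ * (Tᵀ * (S - T * Q)) = Sᵀ * (S - T * Q) - (2 : ℝ) • (Sᵀ * (S - T * Q)) := by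
      rw [← h0, h3]
      abel
    rw [h0, h4, two_smul, neg_smul, two_smul]
    abel
  rw [← h2, frob_smul, frob_mul_of_transpose_mul (by rw [transpose_transpose, hQ.1.2]),
    frob_transpose] at h1
  norm_num at h1
  nlinarith

/-- The data of the low-noise regime: `a` and `s` bound the singular values of `A` and
`w √n` bounds the operator norm of the noise `N`. -/
structure Regime (A : Matrix (Fin d) (Fin m) ℝ) (N : Matrix (Fin n × Fin d) (Fin m) ℝ)
    (a s w : ℝ) : Prop where
  one_le_n : 1 ≤ n
  one_le_d : 1 ≤ d
  s_pos : 0 < s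
  s_le_a : s ≤ a
  opLe_A : OpLe A a
  lowLe_A : LowLe A s
  w_nonneg : 0 ≤ w
  small : a ^ 4 * w * Real.sqrt d ≤ s ^ 5 / 10000
  opLe_N : OpLe N (w * Real.sqrt n)

/-- Radius of the basin of attraction, relative to `√n`. -/
noncomputable def rad (a s : ℝ) : ℝ := s ^ 2 / (64 * a ^ 2)

/-- `S` is within `r √n` of a common rotation of the identity blocks. -/
def Near (r : ℝ) (S : Matrix (Fin n × Fin d) (Fin d) ℝ) : Prop :=
  ∃ R : Matrix (Fin d) (Fin d) ℝ, IsOrth R ∧ frob (S - ZStack n d * R) ≤ r * Real.sqrt n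

lemma Near.aligned {r : ℝ} {S : Matrix (Fin n × Fin d) (Fin d) ℝ} (h : Near r S) :
    ∃ R : Matrix (Fin d) (Fin d) ℝ,
      IsPolar ((ZStack n d)ᵀ * S) R ∧ frob (S - ZStack n d * R) ≤ r * Real.sqrt n := by
  obtain ⟨R, hR, h⟩ := h
  obtain ⟨Q, hQ⟩ := exists_isPolar ((ZStack n d)ᵀ * S)
  exact ⟨Q, hQ, (hQ.frob_sub_le hR).trans h⟩

lemma Near.mono {r q : ℝ} {S : Matrix (Fin n × Fin d) (Fin d) ℝ} (h : Near r S) (hrq : r ≤ q) :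
    Near q S := by
  obtain ⟨R, hR, h⟩ := h
  exact ⟨R, hR, h.trans (mul_le_mul_of_nonneg_right hrq (Real.sqrt_nonneg _))⟩

lemma Near.dF_le {r q : ℝ} {S T : Matrix (Fin n × Fin d) (Fin d) ℝ} (hS : Near r S)
    (hT : Near q T) : dF S T ≤ (r + q) * Real.sqrt n := by
  obtain ⟨R, hR, hS⟩ := hS
  obtain ⟨Q, hQ, hT⟩ := hT
  have h1 := dF_triangle S (ZStack n d) T
  have h2 : dF S (ZStack n d) ≤ _ := GOPP.dF_le hR
  have h3 : dF T (ZStack n d) ≤ _ := GOPP.dF_le hQ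
  rw [dF_comm] at h3
  linarith

lemma opLe_ZStack_mul {A : Matrix (Fin d) (Fin m) ℝ} {a : ℝ} (hA : OpLe A a) :
    OpLe (ZStack n d * A) (a * Real.sqrt n) := by
  rw [mul_comm]
  exact (opLe_of_transpose_mul_self (Nat.cast_nonneg n) ZStack_transpose_mul_self).mul
    (Real.sqrt_nonneg _) hA

lemma frob_eq_of_transpose_mul_self {S : Matrix (Fin n × Fin d) (Fin d) ℝ}
    (hS : Sᵀ * S = (n : ℝ) • 1) : frob S = Real.sqrt n * Real.sqrt d := by
  rw [← Real.sqrt_mul (Nat.cast_nonneg n), ← Real.sqrt_sq (frob_nonneg S),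
    frob_of_transpose_mul_self hS, Fintype.card_fin]

namespace Regime

variable {A : Matrix (Fin d) (Fin m) ℝ} {N : Matrix (Fin n × Fin d) (Fin m) ℝ} {a s w : ℝ}

lemma a_pos (h : Regime A N a s w) : 0 < a := h.s_pos.trans_le h.s_le_a

lemma rad_pos (h : Regime A N a s w) : 0 < rad a s := by
  have := h.s_pos
  have := h.a_pos
  unfold rad
  positivity

lemma sq_mul_rad (h : Regime A N a s w) : a ^ 2 * rad a s = s ^ 2 / 64 := by
  have := h.a_pos
  unfold rad
  field_simp

lemma rad_le (h : Regime A N a s w) : rad a s ≤ 1 / 64 := by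
  have h1 := h.sq_mul_rad
  have h2 := h.a_pos
  have h3 : s ^ 2 ≤ a ^ 2 := pow_le_pow_left₀ h.s_pos.le h.s_le_a 2
  refine le_of_mul_le_mul_left ?_ (pow_pos h2 2)
  linarith

lemma one_le_sqrt_n (h : Regime A N a s w) : 1 ≤ Real.sqrt n :=
  Real.one_le_sqrt.2 (by exact_mod_cast h.one_le_n)

lemma one_le_sqrt_d (h : Regime A N a s w) : 1 ≤ Real.sqrt d :=
  Real.one_le_sqrt.2 (by exact_mod_cast h.one_le_d)

lemma n_pos (h : Regime A N a s w) : (0 : ℝ) < n := by exact_mod_cast h.one_le_n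

lemma mul_small (h : Regime A N a s w) :
    a ^ 3 * (a * w * Real.sqrt d) ≤ s ^ 3 * (s ^ 2 / 10000) := by
  have := h.small
  nlinarith

lemma noise_le_rad (h : Regime A N a s w) : a * w * Real.sqrt d ≤ s ^ 2 * rad a s / 100 := by
  have h1 := h.mul_small
  have h2 := h.sq_mul_rad
  have h3 := h.a_pos
  have h4 := h.s_pos
  refine le_of_mul_le_mul_left ?_ (pow_pos h3 3)
  refine h1.trans ?_
  have h5 : a ^ 3 * (s ^ 2 * rad a s / 100) = a * s ^ 2 * (s ^ 2 / 64) / 100 := by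
    rw [← h2]
    ring
  rw [h5]
  have h6 : s ^ 4 * s ≤ s ^ 4 * a := mul_le_mul_of_nonneg_left h.s_le_a (by positivity)
  nlinarith [pow_pos h4 4, mul_pos (pow_pos h4 4) h3]

lemma noise_le (h : Regime A N a s w) : a * w * Real.sqrt d ≤ s ^ 2 / 6400 := by
  have h1 := h.noise_le_rad
  have h2 := h.rad_le
  nlinarith [pow_pos h.s_pos 2]

lemma noise_le' (h : Regime A N a s w) : a * w ≤ a * w * Real.sqrt d :=
  le_mul_of_one_le_right (mul_nonneg h.a_pos.le h.w_nonneg) h.one_le_sqrt_d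

lemma w_le (h : Regime A N a s w) : w ≤ s / 6400 := by
  have h1 := h.noise_le
  have h2 := h.noise_le'
  have h3 : s * w ≤ a * w := mul_le_mul_of_nonneg_right h.s_le_a h.w_nonneg
  refine le_of_mul_le_mul_left ?_ h.s_pos
  nlinarith

lemma opLe_data (h : Regime A N a s w) : OpLe (ZStack n d * A + N) (11 / 10 * a * Real.sqrt n) := by
  refine ((opLe_ZStack_mul h.opLe_A).add h.opLe_N).mono ?_
  rw [← add_mul]
  refine mul_le_mul_of_nonneg_right ?_ (Real.sqrt_nonneg _)
  linarith [h.w_le, h.s_le_a, h.s_pos]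

lemma data_bound_nonneg (h : Regime A N a s w) : 0 ≤ 11 / 10 * a * Real.sqrt n :=
  mul_nonneg (by linarith [h.a_pos]) (Real.sqrt_nonneg _)

lemma noise_bound_nonneg (h : Regime A N a s w) : 0 ≤ w * Real.sqrt n :=
  mul_nonneg h.w_nonneg (Real.sqrt_nonneg _)

lemma mask (h : Regime A N a s w) (j : Fin n) : Regime A (mask N j) a s w :=
  { h with opLe_N := h.opLe_N.mask j }

lemma lowLe_mul_transpose (h : Regime A N a s w) {R : Matrix (Fin d) (Fin d) ℝ} (hR : IsOrth R) :
    LowLe ((n : ℝ) • (A * Aᵀ * R)) (n * s ^ 2) := fun y => by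
  rw [transpose_smul, smul_mulVec, vnorm_smul, Nat.abs_cast, mul_assoc]
  refine mul_le_mul_of_nonneg_left ?_ (Nat.cast_nonneg n)
  rw [transpose_mul, ← mulVec_mulVec, hR.transpose.vnorm_mulVec, transpose_mul,
    transpose_transpose]
  rcases (vnorm_nonneg y).eq_or_lt with h0 | h0
  · rw [← h0, mul_zero]
    exact vnorm_nonneg _
  · have h1 := h.lowLe_A y
    have h2 := dotProduct_le y ((A * Aᵀ) *ᵥ y)
    have h3 : y ⬝ᵥ (A * Aᵀ) *ᵥ y = vnorm (Aᵀ *ᵥ y) ^ 2 := by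
      rw [vnorm_sq, ← mulVec_mulVec, dotProduct_mulVec, ← mulVec_transpose]
    have h4 : (s * vnorm y) ^ 2 ≤ vnorm (Aᵀ *ᵥ y) ^ 2 :=
      pow_le_pow_left₀ (mul_nonneg h.s_pos.le h0.le) h1 2
    refine le_of_mul_le_mul_left ?_ h0
    linarith

/-- Singular values of the blocks of `CS` are bounded below when `S` is close to a matrix `T`
that is nearly independent of the `j`-th noise block. -/
lemma lowLe_blk (h : Regime A N a s w) {S T : Matrix (Fin n × Fin d) (Fin d) ℝ} {j : Fin n}
    (hS : Sᵀ * S = (n : ℝ) • 1) (hnear : Near (rad a s) S) (hST : dF S T ≤ 5 * Real.sqrt d)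
    (hT : OpLe (blk T j) (2 * (a / s)))
    (hind : OpLe (blk N j * ((ZStack n d * A + GOPP.mask N j)ᵀ * T)) (2 * a * n * w)) :
    LowLe (blk ((ZStack n d * A + N) * (ZStack n d * A + N)ᵀ * S) j) (n * s ^ 2 / 2) := by
  obtain ⟨R, hR, hSR⟩ := hnear.aligned
  obtain ⟨Q, hQ⟩ := exists_isPolar (Tᵀ * S)
  rw [hQ.dF_eq] at hST
  have hn := Real.mul_self_sqrt (Nat.cast_nonneg (α := ℝ) n)
  set rn := Real.sqrt n
  set rd := Real.sqrt d
  set D := ZStack n d * A + N with hD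
  set D' := ZStack n d * A + GOPP.mask N j with hD'
  have ha := h.a_pos
  have hs := h.s_pos
  have hw := h.w_nonneg
  have hrn : 1 ≤ rn := h.one_le_sqrt_n
  have hrd : 1 ≤ rd := h.one_le_sqrt_d
  have hopS : OpLe S rn := opLe_of_transpose_mul_self (Nat.cast_nonneg n) hS
  have hZ : OpLe (ZStack n d)ᵀ rn := (opLe_of_transpose_mul_self (Nat.cast_nonneg n)
    ZStack_transpose_mul_self).transpose (Real.sqrt_nonneg _)
  have hDT := h.opLe_data.transpose h.data_bound_nonneg
  have hNj : OpLe (blk N j) (w * rn) := h.opLe_N.blk j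
  have hdec : blk (D * Dᵀ * S) j = (n : ℝ) • (A * Aᵀ * R)
      + (A * (Aᵀ * ((ZStack n d)ᵀ * (S - ZStack n d * R))) + A * (Nᵀ * S)
      + (blk N j * (D'ᵀ * T) * Q + blk N j * (Dᵀ * (S - T * Q) + (blk N j)ᵀ * (blk T j * Q)))) := by
    have e1 : (blk N j)ᵀ * (blk T j * Q) = (D - D')ᵀ * (T * Q) := by
      rw [← blk_mul, ← sub_mask_transpose_mul, hD, hD', add_sub_add_left_eq_sub]
    have e2 : (n : ℝ) • (A * Aᵀ * R) = A * (Aᵀ * ((ZStack n d)ᵀ * (ZStack n d * R))) := by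
      rw [← Matrix.mul_assoc (ZStack n d)ᵀ, ZStack_transpose_mul_self, smul_mul, one_mul,
        Matrix.mul_smul, Matrix.mul_smul, Matrix.mul_assoc]
    have e3 : Dᵀ * S = Aᵀ * ((ZStack n d)ᵀ * S) + Nᵀ * S := by
      rw [hD, transpose_add, Matrix.add_mul, transpose_mul, Matrix.mul_assoc]
    have e4 : Dᵀ * S = D'ᵀ * T * Q + (Dᵀ * (S - T * Q) + (D - D')ᵀ * (T * Q)) := by
      rw [transpose_sub, Matrix.sub_mul, Matrix.mul_sub, Matrix.mul_assoc]
      abel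
    have e5 : blk (D * Dᵀ * S) j = A * (Dᵀ * S) + blk N j * (Dᵀ * S) := by
      rw [Matrix.mul_assoc, blk_mul, ← Matrix.add_mul]
      congr 1
      rw [hD, blk_add, blk_ZStack_mul]
    rw [e5, e1]
    nth_rewrite 1 [e3]
    rw [e4, e2, Matrix.mul_sub (ZStack n d)ᵀ, Matrix.mul_sub Aᵀ, Matrix.mul_sub A, Matrix.mul_add A,
      Matrix.mul_add (blk N j), Matrix.mul_assoc (blk N j)]
    abel
  have p1 : OpLe (A * (Aᵀ * ((ZStack n d)ᵀ * (S - ZStack n d * R))))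
      (a * (a * (rn * (rad a s * rn)))) :=
    h.opLe_A.mul ha.le ((h.opLe_A.transpose ha.le).mul ha.le
      (hZ.mul (by positivity) ((opLe_frob _).mono hSR)))
  have p2 : OpLe (A * (Nᵀ * S)) (a * (w * rn * rn)) :=
    h.opLe_A.mul ha.le ((h.opLe_N.transpose h.noise_bound_nonneg).mul h.noise_bound_nonneg hopS)
  have p3 : OpLe (blk N j * (D'ᵀ * T) * Q) (2 * a * n * w * 1) := hind.mul (by positivity) hQ.1.opLe
  have p4 : OpLe (blk N j * (Dᵀ * (S - T * Q) + (blk N j)ᵀ * (blk T j * Q)))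
      (w * rn * (11 / 10 * a * rn * (5 * rd) + w * rn * (2 * (a / s) * 1))) :=
    hNj.mul (by positivity) ((hDT.mul h.data_bound_nonneg ((opLe_frob _).mono hST)).add
      ((hNj.transpose (by positivity)).mul (by positivity) (hT.mul (by positivity) hQ.1.opLe)))
  rw [hdec]
  have hrad := h.rad_pos
  refine ((h.lowLe_mul_transpose hR.1).add ((p1.add p2).add (p3.add p4)) (by positivity)).mono ?_
  have q1 : a * (a * (rn * (rad a s * rn))) = n * (s ^ 2 / 64) := by
    rw [← h.sq_mul_rad, ← hn]
    ring
  have q2 : w * (a / s) ≤ a := by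
    rw [mul_div_assoc', div_le_iff₀ hs]
    nlinarith [h.w_le]
  have q3 : w * rn * (11 / 10 * a * rn * (5 * rd) + w * rn * (2 * (a / s) * 1))
      = n * (11 / 2 * (a * w * rd) + 2 * w * (w * (a / s))) := by
    rw [← hn]
    ring
  have q4 : w * (w * (a / s)) ≤ a * w * rd := by
    refine le_trans ?_ h.noise_le'
    rw [mul_comm a w]
    exact mul_le_mul_of_nonneg_left q2 hw
  have q5 : a * (w * rn * rn) = n * (a * w) := by
    rw [← hn]
    ring
  rw [q1, q3, q5]
  have q6 := h.noise_le
  have q7 := h.noise_le'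
  have q8 : s ^ 2 / 64 + a * w + (2 * a * w + (11 / 2 * (a * w * rd) + 2 * (w * (w * (a / s)))))
      ≤ s ^ 2 / 2 := by
    nlinarith [pow_pos hs 2]
  have q9 := mul_le_mul_of_nonneg_left q8 h.n_pos.le
  linarith

/-- The difference of two aligned frames is nearly annihilated by the power step. -/
lemma frob_data_mul_le (h : Regime A N a s w) {S T : Matrix (Fin n × Fin d) (Fin d) ℝ}
    (hS : Sᵀ * S = (n : ℝ) • 1) (hT : Tᵀ * T = (n : ℝ) • 1) (hnear : Near (rad a s) S)
    {Q : Matrix (Fin d) (Fin d) ℝ} (hQ : IsPolar (Tᵀ * S) Q)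
    (hST : frob (S - T * Q) ≤ 2 * rad a s * Real.sqrt n) :
    frob ((ZStack n d * A + N) * (ZStack n d * A + N)ᵀ * (S - T * Q))
      ≤ n * s ^ 2 / 16 * frob (S - T * Q) := by
  obtain ⟨R, hR, hSR⟩ := hnear
  have hn := Real.mul_self_sqrt (Nat.cast_nonneg (α := ℝ) n)
  set rn := Real.sqrt n
  set E := S - T * Q with hE
  set F := S - ZStack n d * R with hF
  have ha := h.a_pos
  have hw := h.w_nonneg
  have hrad := h.rad_pos
  have hrn : 0 ≤ rn := Real.sqrt_nonneg _
  have he := frob_nonneg E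
  have h1 : (ZStack n d)ᵀ * E = R * (Sᵀ * E - Fᵀ * E) := by
    rw [← Matrix.sub_mul, ← transpose_sub, hF, sub_sub_cancel, transpose_mul, ← Matrix.mul_assoc,
      ← Matrix.mul_assoc, hR.2, Matrix.one_mul]
  have h2 : frob ((ZStack n d)ᵀ * E) ≤ 2 * rad a s * rn * frob E := by
    rw [h1, frob_mul_of_transpose_mul hR.1]
    have h3 := frob_sub_le (Sᵀ * E) (Fᵀ * E)
    have h4 := frob_transpose_mul_aligned_le hS hT hQ
    have h5 := frob_mul_le Fᵀ E
    rw [frob_transpose] at h5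
    have h6 := mul_le_mul_of_nonneg_right hSR he
    rw [← hE] at h4
    have h7 := mul_le_mul_of_nonneg_right hST he
    nlinarith
  have h3 : frob ((ZStack n d * A + N)ᵀ * E) ≤ (2 * a * rad a s + w) * rn * frob E := by
    rw [transpose_add, Matrix.add_mul, transpose_mul, Matrix.mul_assoc]
    refine (frob_add_le _ _).trans ?_
    have h4 := (h.opLe_A.transpose ha.le).frob_mul_le (Y := (ZStack n d)ᵀ * E) ha.le
    have h5 := (h.opLe_N.transpose h.noise_bound_nonneg).frob_mul_le (Y := E) h.noise_bound_nonneg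
    have h6 := mul_le_mul_of_nonneg_left h2 ha.le
    nlinarith
  rw [Matrix.mul_assoc]
  refine (h.opLe_data.frob_mul_le h.data_bound_nonneg).trans
    ((mul_le_mul_of_nonneg_left h3 h.data_bound_nonneg).trans ?_)
  have h4 : 11 / 10 * a * rn * ((2 * a * rad a s + w) * rn * frob E)
      = n * (11 / 10 * (2 * (a ^ 2 * rad a s) + a * w)) * frob E := by
    rw [← hn]
    ring
  rw [h4, h.sq_mul_rad, mul_div_assoc]
  refine mul_le_mul_of_nonneg_right (mul_le_mul_of_nonneg_left ?_ h.n_pos.le) he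
  have h5 := h.noise_le
  have h6 := h.noise_le'
  nlinarith [pow_pos h.s_pos 2]

lemma dF_step_le (h : Regime A N a s w) {S T S' T' : Matrix (Fin n × Fin d) (Fin d) ℝ}
    (hS : OrthBlocks S) (hT : OrthBlocks T) (hnear : Near (rad a s) S)
    (hST : dF S T ≤ 2 * rad a s * Real.sqrt n)
    (hlow : ∀ k, LowLe (blk ((ZStack n d * A + N) * (ZStack n d * A + N)ᵀ * S) k) (n * s ^ 2 / 2))
    (hS' : IsPolarBlocks ((ZStack n d * A + N) * (ZStack n d * A + N)ᵀ * S) S')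
    (hT' : IsPolarBlocks ((ZStack n d * A + N) * (ZStack n d * A + N)ᵀ * T) T') :
    dF S' T' ≤ 1 / 4 * dF S T := by
  obtain ⟨Q, hQ⟩ := exists_isPolar (Tᵀ * S)
  rw [hQ.dF_eq] at hST ⊢
  have h1 := h.frob_data_mul_le hS.transpose_mul_self hT.transpose_mul_self hnear hQ hST
  set C := (ZStack n d * A + N) * (ZStack n d * A + N)ᵀ
  have hpos : 0 < n * s ^ 2 / 2 := by
    have := h.n_pos
    have := h.s_pos
    positivity
  have h2 : frob (S' - T' * Q) ≤ 2 / (n * s ^ 2 / 2) * frob (C * (S - T * Q)) := by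
    refine frob_le_mul_of_blk (by positivity) fun k => ?_
    have h3 := (hS' k).lipschitz (hT'.mul_right hQ.1 k) hpos (hlow k)
    rwa [← blk_sub, ← blk_sub, Matrix.mul_assoc C T Q, ← Matrix.mul_sub] at h3
  refine (dF_le hQ.1).trans (h2.trans ?_)
  rw [div_mul_eq_mul_div, div_le_iff₀ hpos]
  linarith

/-- One step keeps the leave-one-out sequence close. -/
lemma dF_step_mask_le (h : Regime A N a s w) {S T S' T' : Matrix (Fin n × Fin d) (Fin d) ℝ}
    {j : Fin n} (hS : OrthBlocks S) (hT : OrthBlocks T) (hnear : Near (rad a s) S)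
    (hST : dF S T ≤ 2 * rad a s * Real.sqrt n) (hST' : dF S T ≤ 4 * Real.sqrt d)
    (hlow : ∀ k, LowLe (blk ((ZStack n d * A + N) * (ZStack n d * A + N)ᵀ * S) k) (n * s ^ 2 / 2))
    (hS' : IsPolarBlocks ((ZStack n d * A + N) * (ZStack n d * A + N)ᵀ * S) S')
    (hT' : IsPolarBlocks ((ZStack n d * A + GOPP.mask N j)
      * (ZStack n d * A + GOPP.mask N j)ᵀ * T) T') :
    dF S' T' ≤ 4 * Real.sqrt d := by
  obtain ⟨Q, hQ⟩ := exists_isPolar (Tᵀ * S)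
  rw [hQ.dF_eq] at hST hST'
  have h1 := h.frob_data_mul_le hS.transpose_mul_self hT.transpose_mul_self hnear hQ hST
  have hn := Real.mul_self_sqrt (Nat.cast_nonneg (α := ℝ) n)
  have hd := Real.mul_self_sqrt (Nat.cast_nonneg (α := ℝ) d)
  set rn := Real.sqrt n
  set rd := Real.sqrt d
  set D := ZStack n d * A + N with hD
  set D' := ZStack n d * A + GOPP.mask N j with hD'
  set E := S - T * Q with hE
  have hs := h.s_pos
  have ha := h.a_pos
  have hw := h.w_nonneg
  have hnp := h.n_pos
  have hrn : 0 ≤ rn := Real.sqrt_nonneg _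
  have hrd : 0 ≤ rd := Real.sqrt_nonneg _
  have hpos : 0 < n * s ^ 2 / 2 := by positivity
  have horth : ∀ {P : Matrix (Fin d) (Fin d) ℝ}, IsOrth P → frob P = rd := fun hP => by
    rw [← Real.sqrt_sq (frob_nonneg _), hP.frob_sq]
  set G := D * Dᵀ * E + D * ((blk N j)ᵀ * (blk T j * Q)) with hG
  have hGle : frob G ≤ n * s ^ 2 * rd / 2 := by
    refine (frob_add_le _ _).trans ?_
    have h2 := h.opLe_data.frob_mul_le (Y := (blk N j)ᵀ * (blk T j * Q)) h.data_bound_nonneg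
    have h3 := ((h.opLe_N.blk j).transpose h.noise_bound_nonneg).frob_mul_le
      (Y := blk T j * Q) h.noise_bound_nonneg
    rw [horth ((hT j).mul hQ.1)] at h3
    have h4 := mul_le_mul_of_nonneg_left h3 h.data_bound_nonneg
    have h5 : 11 / 10 * a * rn * (w * rn * rd) = n * (11 / 10 * (a * w * rd)) := by
      rw [← hn]
      ring
    have h6 := mul_le_mul_of_nonneg_left h.noise_le hnp.le
    have h7 : n * s ^ 2 / 16 * frob E ≤ n * s ^ 2 / 16 * (4 * rd) :=
      mul_le_mul_of_nonneg_left hST' (by positivity)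
    have h8 : n * s ^ 2 * 1 ≤ n * s ^ 2 * rd :=
      mul_le_mul_of_nonneg_left h.one_le_sqrt_d (by positivity)
    change n * (a * w * rd) ≤ _ at h6
    change frob (D * _) ≤ 11 / 10 * a * rn * _ at h2
    change 11 / 10 * a * rn * _ ≤ 11 / 10 * a * rn * _ at h4
    linarith
  have hblk : ∀ k, frob (blk (S' - T' * Q) k) ^ 2 ≤ (if k = j then (2 * rd) ^ 2 else 0)
      + (2 / (n * s ^ 2 / 2)) ^ 2 * frob (blk G k) ^ 2 := fun k => by
    split_ifs with hk
    · have h2 := frob_sub_le (blk S' k) (blk (T' * Q) k)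
      rw [horth (hS'.orthBlocks k), horth ((hT'.orthBlocks.mul hQ.1) k)] at h2
      have h3 := pow_le_pow_left₀ (frob_nonneg _) h2 2
      rw [blk_sub]
      have h4 : 0 ≤ (2 / (n * s ^ 2 / 2)) ^ 2 * frob (blk G k) ^ 2 := by positivity
      rw [← two_mul] at h3
      linarith
    · have h3 := (hS' k).lipschitz (hT'.mul_right hQ.1 k) hpos (hlow k)
      have e0 : (D - D')ᵀ * (T * Q) = (blk N j)ᵀ * (blk T j * Q) := by
        rw [← blk_mul, ← sub_mask_transpose_mul, hD, hD', add_sub_add_left_eq_sub]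
      have e1 : blk D' k = blk D k := by
        rw [hD, hD', blk_add, blk_add, blk_mask, if_neg hk]
      have e2 : blk (D * Dᵀ * S) k - blk (D' * D'ᵀ * T * Q) k = blk G k := by
        rw [hG, ← e0, Matrix.mul_assoc, Matrix.mul_assoc D', Matrix.mul_assoc D',
          Matrix.mul_assoc D, blk_mul, blk_mul, e1, ← blk_mul, ← blk_mul, ← blk_sub,
          ← Matrix.mul_sub, ← Matrix.mul_add]
        congr 2
        rw [hE, Matrix.mul_sub, transpose_sub, Matrix.sub_mul, Matrix.mul_assoc]
        abel
      rw [e2] at h3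
      rw [zero_add, ← mul_pow]
      exact pow_le_pow_left₀ (frob_nonneg _) h3 2
  have hsum : frob (S' - T' * Q) ^ 2 ≤ (2 * rd) ^ 2 + (2 / (n * s ^ 2 / 2)) ^ 2 * frob G ^ 2 := by
    rw [frob_sq_eq_sum_blk]
    refine (Finset.sum_le_sum fun k _ => hblk k).trans ?_
    rw [Finset.sum_add_distrib, ← Finset.mul_sum, ← frob_sq_eq_sum_blk]
    simp
  have hG2 : 2 / (n * s ^ 2 / 2) * frob G ≤ 2 * rd := by
    rw [div_mul_eq_mul_div, div_le_iff₀ hpos]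
    linarith
  have hG3 := pow_le_pow_left₀ (mul_nonneg (by positivity) (frob_nonneg G)) hG2 2
  rw [mul_pow] at hG3
  refine (dF_le hQ.1).trans ?_
  refine (pow_le_pow_iff_left₀ (frob_nonneg _) (by positivity) two_ne_zero).1 ?_
  nlinarith

/-- The basin of attraction is invariant under the power step. -/
lemma near_step (h : Regime A N a s w) {S S' : Matrix (Fin n × Fin d) (Fin d) ℝ}
    (hS : Sᵀ * S = (n : ℝ) • 1) (hnear : Near (rad a s) S)
    (hS' : IsPolarBlocks ((ZStack n d * A + N) * (ZStack n d * A + N)ᵀ * S) S') :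
    Near (rad a s) S' := by
  obtain ⟨R, hR, hSR⟩ := hnear.aligned
  refine ⟨R, hR.1, ?_⟩
  have h1 := frob_transpose_mul_aligned_le' hS ZStack_transpose_mul_self hR
  have hn := Real.mul_self_sqrt (Nat.cast_nonneg (α := ℝ) n)
  have hfS := frob_eq_of_transpose_mul_self hS
  set rn := Real.sqrt n
  set rd := Real.sqrt d
  set D := ZStack n d * A + N with hD
  set E := S - ZStack n d * R with hE
  have hs := h.s_pos
  have ha := h.a_pos
  have hw := h.w_nonneg
  have hnp := h.n_pos
  have hrn : 0 ≤ rn := Real.sqrt_nonneg _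
  have hrd : 0 ≤ rd := Real.sqrt_nonneg _
  have hrad := h.rad_pos
  have hpos : 0 < n * s ^ 2 := by positivity
  set G := ZStack n d * (A * (Aᵀ * ((ZStack n d)ᵀ * E) + Nᵀ * S)) + N * (Dᵀ * S) with hG
  have hdec : D * Dᵀ * S = ZStack n d * ((n : ℝ) • (A * Aᵀ * R)) + G := by
    have e2 : (n : ℝ) • (A * Aᵀ * R) = A * (Aᵀ * ((ZStack n d)ᵀ * (ZStack n d * R))) := by
      rw [← Matrix.mul_assoc (ZStack n d)ᵀ, ZStack_transpose_mul_self, smul_mul, one_mul,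
        Matrix.mul_smul, Matrix.mul_smul, Matrix.mul_assoc]
    have e3 : Dᵀ * S = Aᵀ * ((ZStack n d)ᵀ * S) + Nᵀ * S := by
      rw [hD, transpose_add, Matrix.add_mul, transpose_mul, Matrix.mul_assoc]
    have e5 : D * Dᵀ * S = ZStack n d * (A * (Dᵀ * S)) + N * (Dᵀ * S) := by
      rw [← Matrix.mul_assoc, ← Matrix.add_mul, Matrix.mul_assoc]
    rw [e5, hG, e2, hE, ← add_assoc, ← Matrix.mul_add (ZStack n d), ← Matrix.mul_add A,
      ← add_assoc, ← Matrix.mul_add Aᵀ, ← Matrix.mul_add (ZStack n d)ᵀ, add_sub_cancel, ← e3]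
  have hlip : frob (ZStack n d * R - S') ≤ 2 / (n * s ^ 2) * frob G := by
    refine frob_le_mul_of_blk (by positivity) fun k => ?_
    have h2 := ((isPolar_mul_transpose_mul A hR.1).smul hnp.le).lipschitz (hS' k) hpos
      (h.lowLe_mul_transpose hR.1)
    rw [blk_sub, blk_ZStack_mul]
    rw [hdec, blk_add, blk_ZStack_mul, sub_add_cancel_left, frob_neg] at h2
    exact h2
  have hGle : frob G ≤ n * rn * (a ^ 2 * rad a s * (rad a s) / 2 + 21 / 10 * (a * w * rd)) := by
    refine (frob_add_le _ _).trans ?_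
    have g1 : frob (Aᵀ * ((ZStack n d)ᵀ * E) + Nᵀ * S)
        ≤ n * (a * rad a s ^ 2 / 2 + w * rd) := by
      refine (frob_add_le _ _).trans ?_
      have g2 := (h.opLe_A.transpose ha.le).frob_mul_le (Y := (ZStack n d)ᵀ * E) ha.le
      have g3 := (h.opLe_N.transpose h.noise_bound_nonneg).frob_mul_le (Y := S) h.noise_bound_nonneg
      have g4 := pow_le_pow_left₀ (frob_nonneg _) hSR 2
      have g5 : frob ((ZStack n d)ᵀ * E) ≤ (rad a s * rn) ^ 2 / 2 := by linarith
      have g6 := mul_le_mul_of_nonneg_left g5 ha.le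
      have g7 : a * ((rad a s * rn) ^ 2 / 2) + w * rn * (rn * rd)
          = n * (a * rad a s ^ 2 / 2 + w * rd) := by
        rw [← hn]
        ring
      rw [hfS] at g3
      linarith
    have g2 := (opLe_ZStack_mul (n := n) h.opLe_A).frob_mul_le
      (Y := Aᵀ * ((ZStack n d)ᵀ * E) + Nᵀ * S) (by positivity)
    rw [Matrix.mul_assoc] at g2
    have g3 := mul_le_mul_of_nonneg_left g1 (show 0 ≤ a * rn by positivity)
    have g4 := h.opLe_N.frob_mul_le (Y := Dᵀ * S) h.noise_bound_nonneg
    have g5 := (h.opLe_data.transpose h.data_bound_nonneg).frob_mul_le (Y := S) h.data_bound_nonneg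
    rw [hfS] at g5
    have g6 := mul_le_mul_of_nonneg_left g5 h.noise_bound_nonneg
    have g7 : a * rn * (n * (a * rad a s ^ 2 / 2 + w * rd)) + w * rn * (11 / 10 * a * rn * (rn * rd))
        = n * rn * (a ^ 2 * rad a s * (rad a s) / 2 + 21 / 10 * (a * w * rd)) := by
      rw [← hn]
      ring
    change frob (N * (Dᵀ * S)) ≤ w * rn * frob (Dᵀ * S) at g4
    change w * rn * frob (Dᵀ * S) ≤ w * rn * _ at g6
    linarith
  rw [frob_sub_comm]
  refine hlip.trans ?_
  rw [div_mul_eq_mul_div, div_le_iff₀ hpos]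
  refine (mul_le_mul_of_nonneg_left hGle zero_le_two).trans ?_
  rw [h.sq_mul_rad]
  have g1 := h.noise_le_rad
  have g2 : s ^ 2 / 64 * rad a s / 2 + 21 / 10 * (a * w * rd) ≤ rad a s * s ^ 2 / 2 := by
    nlinarith [mul_pos (pow_pos hs 2) hrad]
  have g3 := mul_le_mul_of_nonneg_left g2 (show 0 ≤ 2 * (n * rn) by positivity)
  linarith

end Regime

end PowerStep

/-! ### Spectral initialization -/

section Spectral

variable {n d m : ℕ}

lemma trace_transpose_mul_mul_sub_smul {N : Type*} [Fintype N] {C : Matrix N N ℝ} (hC : Cᵀ = C)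
    (U M : Matrix N (Fin d) ℝ) (c : ℝ) :
    trace ((U - c • M)ᵀ * C * (U - c • M))
      = trace (Uᵀ * C * U) - 2 * c * trace (Mᵀ * (C * U)) + c ^ 2 * trace (Mᵀ * (C * M)) := by
  have h1 : trace (Uᵀ * (C * M)) = trace (Mᵀ * (C * U)) := by
    rw [trace_transpose_mul_comm, transpose_mul, hC, Matrix.mul_assoc]
  rw [transpose_sub, transpose_smul, Matrix.mul_assoc, Matrix.mul_assoc, Matrix.sub_mul,
    Matrix.mul_sub C, Matrix.mul_sub, Matrix.mul_sub, Matrix.mul_smul, Matrix.smul_mul,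
    Matrix.smul_mul, Matrix.mul_smul, Matrix.mul_smul, trace_sub, trace_sub, trace_sub, trace_smul,
    trace_smul, trace_smul, trace_smul, smul_eq_mul, smul_eq_mul, smul_eq_mul, smul_eq_mul, h1]
  ring

/-- First-order optimality of the top singular vectors along a reflection. -/
lemma IsTopSingVecs.reflection_le {N : Type*} [Fintype N] {D : Matrix N (Fin m) ℝ}
    {U : Matrix N (Fin d) ℝ} (h : IsTopSingVecs D U) (v : N → ℝ) :
    (v ⬝ᵥ (D * Dᵀ) *ᵥ v) * ((Uᵀ *ᵥ v) ⬝ᵥ (Uᵀ *ᵥ v))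
      ≤ (v ⬝ᵥ v) * (v ⬝ᵥ (D * Dᵀ) *ᵥ (U *ᵥ (Uᵀ *ᵥ v))) := by
  classical
  by_cases hv : v ⬝ᵥ v = 0
  · have : v = 0 := dotProduct_self_eq_zero.1 hv
    simp [this]
  have hvpos : 0 < v ⬝ᵥ v := lt_of_le_of_ne (by rw [← vnorm_sq]; positivity) (Ne.symm hv)
  set C := D * Dᵀ with hC
  have hCs : Cᵀ = C := by rw [hC, transpose_mul, transpose_transpose]
  set y := Uᵀ *ᵥ v with hy
  have hQ : refl v * U = U - (2 / (v ⬝ᵥ v)) • vecMulVec v y := by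
    rw [refl, Matrix.sub_mul, Matrix.one_mul, Matrix.smul_mul, vecMulVec_mul, hy, mulVec_transpose]
  have h1 := h.2 (refl v * U) (by
    rw [transpose_mul, refl_transpose, Matrix.mul_assoc, ← Matrix.mul_assoc (refl v),
      refl_mul_self, Matrix.one_mul, h.1])
  have e1 : trace ((vecMulVec v y)ᵀ * (C * U)) = v ⬝ᵥ C *ᵥ (U *ᵥ y) := by
    rw [transpose_vecMulVec, vecMulVec_mul, trace_vecMulVec, dotProduct_comm, ← dotProduct_mulVec,
      ← mulVec_mulVec]
  have e2 : trace ((vecMulVec v y)ᵀ * (C * vecMulVec v y)) = (v ⬝ᵥ C *ᵥ v) * (y ⬝ᵥ y) := by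
    rw [transpose_vecMulVec, mul_vecMulVec, vecMulVec_mul_vecMulVec, trace_vecMulVec,
      dotProduct_smul,
      smul_eq_mul]
  rw [hQ, trace_transpose_mul_mul_sub_smul hCs, e1, e2] at h1
  have h2 : (2 / (v ⬝ᵥ v)) ^ 2 * ((v ⬝ᵥ C *ᵥ v) * (y ⬝ᵥ y))
      ≤ 2 * (2 / (v ⬝ᵥ v)) * (v ⬝ᵥ C *ᵥ (U *ᵥ y)) := by linarith
  have h3 := mul_le_mul_of_nonneg_left h2 (show 0 ≤ (v ⬝ᵥ v) ^ 2 / 4 by positivity)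
  field_simp at h3
  linarith

/-- The top singular vectors span an invariant subspace of `D * Dᵀ`. -/
lemma IsTopSingVecs.mul_eq {N : Type*} [Fintype N] {D : Matrix N (Fin m) ℝ}
    {U : Matrix N (Fin d) ℝ} (h : IsTopSingVecs D U) :
    D * Dᵀ * U = U * (Uᵀ * (D * Dᵀ * U)) := by
  set C := D * Dᵀ with hC
  have hCs : Cᵀ = C := by rw [hC, transpose_mul, transpose_transpose]
  have hsymm : ∀ x y : N → ℝ, x ⬝ᵥ C *ᵥ y = y ⬝ᵥ C *ᵥ x := fun x y => by
    rw [dotProduct_mulVec, ← mulVec_transpose, hCs, dotProduct_comm]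
  have horth : ∀ (q : N → ℝ) (z : Fin d → ℝ), Uᵀ *ᵥ q = 0 → q ⬝ᵥ C *ᵥ (U *ᵥ z) = 0 := by
    intro q z hq
    by_cases hz : z ⬝ᵥ z = 0
    · rw [dotProduct_self_eq_zero.1 hz, mulVec_zero, mulVec_zero, dotProduct_zero]
    have hUq : (U *ᵥ z) ⬝ᵥ q = 0 := by
      rw [dotProduct_comm, dotProduct_mulVec, ← mulVec_transpose, hq, zero_dotProduct]
    have hUU : (U *ᵥ z) ⬝ᵥ (U *ᵥ z) = z ⬝ᵥ z := by
      rw [dotProduct_mulVec, ← mulVec_transpose, mulVec_mulVec, h.1, one_mulVec]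
    have key := linear_coeff_eq_zero_of_nonpos
      (x := (z ⬝ᵥ z) * (q ⬝ᵥ C *ᵥ (U *ᵥ z)))
      (y := (q ⬝ᵥ C *ᵥ q) * (z ⬝ᵥ z) - (q ⬝ᵥ q) * ((U *ᵥ z) ⬝ᵥ C *ᵥ (U *ᵥ z)))
      (z := - ((q ⬝ᵥ q) * (q ⬝ᵥ C *ᵥ (U *ᵥ z)))) (fun τ => by
        have h1 := h.reflection_le (U *ᵥ z + τ • q)
        have e1 : Uᵀ *ᵥ (U *ᵥ z + τ • q) = z := by
          rw [mulVec_add, mulVec_smul, hq, smul_zero, add_zero, mulVec_mulVec, h.1, one_mulVec]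
        rw [e1, ← hC, mulVec_add, mulVec_smul] at h1
        simp only [add_dotProduct, dotProduct_add, smul_dotProduct, dotProduct_smul, smul_eq_mul,
          hUU, hUq, dotProduct_comm q (U *ᵥ z), hsymm (U *ᵥ z) q] at h1
        linarith)
    exact (mul_eq_zero.1 key).resolve_left hz
  have hvec : ∀ z : Fin d → ℝ, C *ᵥ (U *ᵥ z) = U *ᵥ (Uᵀ *ᵥ (C *ᵥ (U *ᵥ z))) := fun z => by
    set p := C *ᵥ (U *ᵥ z) with hp
    have hq : Uᵀ *ᵥ (p - U *ᵥ (Uᵀ *ᵥ p)) = 0 := by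
      rw [mulVec_sub, mulVec_mulVec _ Uᵀ U, h.1, one_mulVec, sub_self]
    have h1 := horth _ z hq
    rw [← hp] at h1
    have h2 : (p - U *ᵥ (Uᵀ *ᵥ p)) ⬝ᵥ (U *ᵥ (Uᵀ *ᵥ p)) = 0 := by
      rw [dotProduct_mulVec, ← mulVec_transpose, hq, zero_dotProduct]
    have h3 : (p - U *ᵥ (Uᵀ *ᵥ p)) ⬝ᵥ (p - U *ᵥ (Uᵀ *ᵥ p)) = 0 := by
      rw [dotProduct_sub, h1, h2, sub_zero]
    exact sub_eq_zero.1 (dotProduct_self_eq_zero.1 h3)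
  refine ext_of_mulVec_single fun i => ?_
  have := hvec (Pi.single i 1)
  simpa only [mulVec_mulVec] using this

/-- Orthogonal frames of norm `√n` per column spanning a top singular subspace. -/
structure TopFrame (D : Matrix (Fin n × Fin d) (Fin m) ℝ) (T : Matrix (Fin n × Fin d) (Fin d) ℝ) :
    Prop where
  gram : Tᵀ * T = (n : ℝ) • 1
  mul_eq : (n : ℝ) • (D * (Dᵀ * T)) = T * (Tᵀ * (D * (Dᵀ * T)))
  frob_le : ∀ X : Matrix (Fin n × Fin d) (Fin d) ℝ, Xᵀ * X = (n : ℝ) • 1 →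
    frob (Dᵀ * X) ≤ frob (Dᵀ * T)

lemma IsTopSingVecs.topFrame (hn : 1 ≤ n) {D : Matrix (Fin n × Fin d) (Fin m) ℝ}
    {U : Matrix (Fin n × Fin d) (Fin d) ℝ} (h : IsTopSingVecs D U) :
    TopFrame D (Real.sqrt n • U) := by
  have hn0 : (0 : ℝ) < n := by exact_mod_cast hn
  have hs := Real.mul_self_sqrt hn0.le
  have hs0 := Real.sqrt_pos.2 hn0
  set r := Real.sqrt n
  refine ⟨?_, ?_, fun X hX => ?_⟩
  · rw [transpose_smul, Matrix.smul_mul, Matrix.mul_smul, smul_smul, h.1, hs]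
  · have := h.mul_eq
    rw [Matrix.mul_assoc] at this
    simp only [transpose_smul, Matrix.smul_mul, Matrix.mul_smul, smul_smul, hs]
    rw [← this, mul_comm]
  · have hQ : (r⁻¹ • X)ᵀ * (r⁻¹ • X) = 1 := by
      rw [transpose_smul, Matrix.smul_mul, Matrix.mul_smul, smul_smul, hX, smul_smul, ← hs]
      field_simp
      rw [one_smul]
    have htr : ∀ Y : Matrix (Fin n × Fin d) (Fin d) ℝ,
        trace (Yᵀ * (D * Dᵀ) * Y) = frob (Dᵀ * Y) ^ 2 := fun Y => by
      rw [frob_sq, transpose_mul, transpose_transpose, Matrix.mul_assoc, Matrix.mul_assoc,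
        Matrix.mul_assoc]
    have h1 := h.2 _ hQ
    rw [htr, htr, Matrix.mul_smul, frob_smul] at h1
    have h2 := abs_le_of_sq_le_sq' h1 (frob_nonneg _)
    rw [Matrix.mul_smul, frob_smul, abs_of_pos hs0]
    rw [abs_of_pos (inv_pos.2 hs0), inv_mul_le_iff₀ hs0] at h2
    exact h2.2

end Spectral

/-! ### Accuracy of the spectral initialization -/

section Residual

variable {n d m : ℕ}

lemma transpose_mul_residual {N : Type*} [Fintype N] {k : ℕ} {T : Matrix N (Fin d) ℝ} {r : ℝ}
    (hr : r ≠ 0) (hT : Tᵀ * T = r • 1) (X : Matrix N (Fin k) ℝ) :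
    Tᵀ * (X - r⁻¹ • (T * (Tᵀ * X))) = 0 := by
  rw [Matrix.mul_sub, Matrix.mul_smul, ← Matrix.mul_assoc Tᵀ T, hT, Matrix.smul_mul, Matrix.one_mul,
    smul_smul, inv_mul_cancel₀ hr, one_smul, sub_self]

lemma frob_residual_sq {N : Type*} [Fintype N] {k : ℕ} {T : Matrix N (Fin d) ℝ} {r : ℝ}
    (hr : r ≠ 0) (hT : Tᵀ * T = r • 1) (X : Matrix N (Fin k) ℝ) :
    r * frob (X - r⁻¹ • (T * (Tᵀ * X))) ^ 2 = r * frob X ^ 2 - frob (Tᵀ * X) ^ 2 := by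
  have h0 := transpose_mul_residual hr hT X
  set K := X - r⁻¹ • (T * (Tᵀ * X)) with hK
  have h1 : Kᵀ * K = Kᵀ * X := by
    conv_lhs => rw [hK, ← hK]
    rw [Matrix.mul_sub, Matrix.mul_smul, ← Matrix.mul_assoc Kᵀ T]
    have : Kᵀ * T = 0 := by
      rw [← transpose_transpose T, ← transpose_mul, h0, transpose_zero]
    rw [this, Matrix.zero_mul, smul_zero, sub_zero]
  have h2 : Kᵀ * X = Xᵀ * X - r⁻¹ • ((Tᵀ * X)ᵀ * (Tᵀ * X)) := by
    rw [hK, transpose_sub, transpose_smul, transpose_mul, Matrix.sub_mul, Matrix.smul_mul,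
      Matrix.mul_assoc]
  rw [frob_sq, h1, h2, trace_sub, trace_smul, ← frob_sq, ← frob_sq, smul_eq_mul]
  field_simp

lemma LowLe.frob_le {α β ι : Type*} [Fintype α] [Fintype β] [Fintype ι] {G : Matrix α β ℝ} {s : ℝ}
    (hG : LowLe G s) (hs : 0 ≤ s) (K : Matrix ι α ℝ) : s * frob K ≤ frob (K * G) := by
  refine (pow_le_pow_iff_left₀ (mul_nonneg hs (frob_nonneg _)) (frob_nonneg _) two_ne_zero).1 ?_
  rw [← frob_transpose K, ← frob_transpose (K * G), mul_pow, frob_sq_cols, frob_sq_cols,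
    Finset.mul_sum]
  refine Finset.sum_le_sum fun i _ => ?_
  rw [← mul_pow]
  refine pow_le_pow_left₀ (mul_nonneg hs (vnorm_nonneg _)) ((hG _).trans (le_of_eq ?_)) 2
  congr 1
  funext j
  simp [mulVec, dotProduct, mul_apply, mul_comm]

end Residual

namespace Regime

variable {n d m : ℕ} {A : Matrix (Fin d) (Fin m) ℝ} {N : Matrix (Fin n × Fin d) (Fin m) ℝ}
  {a s w : ℝ} {T : Matrix (Fin n × Fin d) (Fin d) ℝ}

lemma near_topFrame (h : Regime A N a s w) (hT : TopFrame (ZStack n d * A + N) T) :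
    Near (rad a s / 10) T := by
  obtain ⟨R, hR⟩ := exists_isPolar ((ZStack n d)ᵀ * T)
  refine ⟨R, hR.1, ?_⟩
  have hn0 := h.n_pos
  have hal := frob_aligned_sq_le hn0 hT.gram ZStack_transpose_mul_self hR
  have hZR : (ZStack n d * R)ᵀ * (ZStack n d * R) = (n : ℝ) • 1 :=
    (orthBlocks_ZStack_mul hR.1).transpose_mul_self
  have hmax := hT.frob_le _ hZR
  have hn := Real.mul_self_sqrt hn0.le
  have hd := Real.mul_self_sqrt (Nat.cast_nonneg (α := ℝ) d)
  have hfT := frob_eq_of_transpose_mul_self hT.gram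
  have hfZ := frob_eq_of_transpose_mul_self hZR
  have hfZ' := frob_eq_of_transpose_mul_self (ZStack_transpose_mul_self (n := n) (d := d))
  set rn := Real.sqrt n
  set rd := Real.sqrt d
  set D := ZStack n d * A + N with hD
  set Y := T - ZStack n d * R with hY
  have hs := h.s_pos
  have ha := h.a_pos
  have hw := h.w_nonneg
  have hrn : 0 < rn := by linarith [h.one_le_sqrt_n]
  have hrd : 0 ≤ rd := Real.sqrt_nonneg _
  have he := frob_nonneg Y
  have k1 := frob_residual_sq hn0.ne' hT.gram (ZStack n d)
  have k2 := frob_residual_sq hn0.ne' hT.gram (ZStack n d * A)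
  have k3 : (ZStack n d - (n : ℝ)⁻¹ • (T * (Tᵀ * ZStack n d))) * A
      = ZStack n d * A - (n : ℝ)⁻¹ • (T * (Tᵀ * (ZStack n d * A))) := by
    rw [Matrix.sub_mul, Matrix.smul_mul, Matrix.mul_assoc, Matrix.mul_assoc]
  have k4 := h.lowLe_A.frob_le hs.le (ZStack n d - (n : ℝ)⁻¹ • (T * (Tᵀ * ZStack n d)))
  rw [k3] at k4
  set K := ZStack n d - (n : ℝ)⁻¹ • (T * (Tᵀ * ZStack n d))
  set KA := ZStack n d * A - (n : ℝ)⁻¹ • (T * (Tᵀ * (ZStack n d * A)))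
  have hf1 : frob (Tᵀ * ZStack n d) = frob ((ZStack n d)ᵀ * T) := by
    rw [← frob_transpose, transpose_mul, transpose_transpose]
  have heK : frob Y ^ 2 ≤ 2 * frob K ^ 2 := by
    refine hal.trans ?_
    rw [hf1, hfZ', mul_pow, sq rn, sq rd, hn, hd] at k1
    refine le_of_mul_le_mul_left ?_ hn0
    have : (n : ℝ) * (2 * (n * d - frob ((ZStack n d)ᵀ * T) ^ 2 / n))
        = 2 * (n * (n * d) - frob ((ZStack n d)ᵀ * T) ^ 2) := by
      field_simp
    rw [this]
    linarith
  set p := Dᵀ * T with hp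
  set p0 := Dᵀ * (ZStack n d * R) with hp0
  set q := Nᵀ * T with hq
  set q0 := Nᵀ * (ZStack n d * R) with hq0
  have hDt : Dᵀ = Aᵀ * (ZStack n d)ᵀ + Nᵀ := by rw [hD, transpose_add, transpose_mul]
  have e1 : frob (Tᵀ * (ZStack n d * A)) = frob (p - q) := by
    rw [← frob_transpose, hp, hq, hDt, Matrix.add_mul, add_sub_cancel_right, transpose_mul,
      transpose_transpose, transpose_mul]
  have e2 : n * frob (ZStack n d * A) ^ 2 = frob (p0 - q0) ^ 2 := by
    rw [hp0, hq0, hDt, Matrix.add_mul, add_sub_cancel_right, Matrix.mul_assoc, ← Matrix.mul_assoc _ _ R,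
      ZStack_transpose_mul_self, Matrix.smul_mul, Matrix.one_mul, Matrix.mul_smul, frob_smul,
      frob_mul_of_mul_transpose hR.1.2, frob_transpose, Nat.abs_cast, frob_sq, transpose_mul,
      Matrix.mul_assoc, ← Matrix.mul_assoc _ _ A, ZStack_transpose_mul_self, Matrix.smul_mul,
      Matrix.one_mul, Matrix.mul_smul, trace_smul, ← frob_sq, smul_eq_mul]
    ring
  have hpY : frob (p - p0) ≤ 11 / 10 * a * rn * frob Y := by
    rw [hp, hp0, ← Matrix.mul_sub]
    exact (h.opLe_data.transpose h.data_bound_nonneg).frob_mul_le h.data_bound_nonneg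
  have hqY : frob (q - q0) ≤ w * rn * frob Y := by
    rw [hq, hq0, ← Matrix.mul_sub]
    exact (h.opLe_N.transpose h.noise_bound_nonneg).frob_mul_le h.noise_bound_nonneg
  have hpb : frob p ≤ 11 / 10 * a * rn * (rn * rd) := by
    rw [← hfT]
    exact (h.opLe_data.transpose h.data_bound_nonneg).frob_mul_le h.data_bound_nonneg
  have hqb : frob q ≤ w * rn * (rn * rd) := by
    rw [← hfT]
    exact (h.opLe_N.transpose h.noise_bound_nonneg).frob_mul_le h.noise_bound_nonneg
  have hq0b : frob q0 ≤ w * rn * (rn * rd) := by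
    rw [← hfZ]
    exact (h.opLe_N.transpose h.noise_bound_nonneg).frob_mul_le h.noise_bound_nonneg
  have t1 := trace_transpose_mul_le p (q - q0)
  have t2 := trace_transpose_mul_le (p - p0) q0
  have t3 : trace (pᵀ * (q - q0)) + trace ((p - p0)ᵀ * q0) = trace (qᵀ * p) - trace (q0ᵀ * p0) := by
    rw [Matrix.mul_sub, transpose_sub, Matrix.sub_mul, trace_sub, trace_sub,
      trace_transpose_mul_comm p q, trace_transpose_mul_comm p0 q0]
    ring
  have t4 : frob q0 - frob q ≤ frob (q - q0) := by
    have := frob_sub_le q (q - q0)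
    rw [sub_sub_cancel] at this
    linarith
  rw [e1, e2, frob_sub_sq p0 q0, frob_sub_sq p q] at k2
  have u1 : frob p * frob (q - q0) ≤ 11 / 10 * a * rn * (rn * rd) * (w * rn * frob Y) :=
    mul_le_mul hpb hqY (frob_nonneg _) (by positivity)
  have u2 : frob (p - p0) * frob q0 ≤ 11 / 10 * a * rn * frob Y * (w * rn * (rn * rd)) :=
    mul_le_mul hpY hq0b (frob_nonneg _) (by positivity)
  have u3 : frob q0 ^ 2 - frob q ^ 2 ≤ w * rn * frob Y * (2 * (w * rn * (rn * rd))) := by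
    have v1 : (frob q0 - frob q) * (frob q0 + frob q)
        ≤ w * rn * frob Y * (frob q0 + frob q) :=
      mul_le_mul_of_nonneg_right (t4.trans hqY) (add_nonneg (frob_nonneg _) (frob_nonneg _))
    have v2 : w * rn * frob Y * (frob q0 + frob q)
        ≤ w * rn * frob Y * (2 * (w * rn * (rn * rd))) :=
      mul_le_mul_of_nonneg_left (by linarith) (by positivity)
    linarith
  have u4 : w * rn * frob Y * (2 * (w * rn * (rn * rd)))
      ≤ 1 / 10 * a * rn * frob Y * (2 * (w * rn * (rn * rd))) := by
    have : w ≤ 1 / 10 * a := by linarith [h.w_le, h.s_le_a]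
    gcongr
  have u5 : frob p0 ^ 2 ≤ frob p ^ 2 := pow_le_pow_left₀ (frob_nonneg _) hmax 2
  have hKA : n * frob KA ^ 2 ≤ n * (5 * (a * w * rd) * rn * frob Y) := by
    rw [k2, ← hn]
    have : 0 ≤ a * rn * (rn * rd) * (w * rn * frob Y) := by positivity
    linarith
  have hKA' := le_of_mul_le_mul_left hKA hn0
  have hK2 : (s * frob K) ^ 2 ≤ frob KA ^ 2 :=
    pow_le_pow_left₀ (mul_nonneg hs.le (frob_nonneg _)) k4 2
  have hfin : s ^ 2 * frob Y ^ 2 ≤ s ^ 2 * (rad a s / 10 * rn) * frob Y := by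
    have v1 := mul_le_mul_of_nonneg_left heK (pow_pos hs 2).le
    have v2 := mul_le_mul_of_nonneg_right h.noise_le_rad (mul_nonneg hrn.le he)
    change a * w * rd * _ ≤ _ at v2
    linarith
  rcases he.eq_or_lt with h0 | h0
  · rw [← h0]
    have := h.rad_pos
    positivity
  · refine le_of_mul_le_mul_right ?_ h0
    refine le_of_mul_le_mul_left ?_ (pow_pos hs 2)
    linarith

lemma a_mul_rad_le (h : Regime A N a s w) : a * rad a s ≤ s / 64 := by
  have h1 := h.sq_mul_rad
  have h2 := h.a_pos
  refine le_of_mul_le_mul_left ?_ h2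
  nlinarith [mul_le_mul_of_nonneg_right h.s_le_a h.s_pos.le]

lemma lowLe_topFrame (h : Regime A N a s w) (hT : TopFrame (ZStack n d * A + N) T) :
    LowLe (Tᵀ * (ZStack n d * A + N)) (n * s * (9 / 10)) := by
  obtain ⟨R, hR, hY⟩ := h.near_topFrame hT
  have hn := Real.mul_self_sqrt h.n_pos.le
  set rn := Real.sqrt n
  have hs := h.s_pos
  have ha := h.a_pos
  have hw := h.w_nonneg
  have hrad := h.rad_pos
  have hrn : 0 < rn := by linarith [h.one_le_sqrt_n]
  set D := ZStack n d * A + N with hD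
  set Y := T - ZStack n d * R with hYd
  have hdec : Tᵀ * D = (n : ℝ) • (Rᵀ * A) + (Rᵀ * ((ZStack n d)ᵀ * N) + Yᵀ * D) := by
    rw [hYd, transpose_sub, transpose_mul, Matrix.sub_mul, Matrix.mul_assoc Rᵀ, ← add_sub_assoc,
      ← add_sub_assoc]
    rw [eq_sub_iff_add_eq, add_comm _ (Tᵀ * D), ← add_assoc, add_comm _ (Tᵀ * D), add_assoc]
    congr 1
    rw [hD, Matrix.mul_add, ← Matrix.mul_assoc _ _ A, ZStack_transpose_mul_self, Matrix.smul_mul,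
      Matrix.one_mul, Matrix.mul_add, Matrix.mul_smul]
  rw [hdec]
  have h1 : LowLe ((n : ℝ) • (Rᵀ * A)) (n * s) := fun y => by
    rw [transpose_smul, smul_mulVec, vnorm_smul, Nat.abs_cast, mul_assoc, transpose_mul,
      transpose_transpose, ← mulVec_mulVec, ← hR.vnorm_mulVec y]
    exact mul_le_mul_of_nonneg_left (h.lowLe_A _) h.n_pos.le
  have hZ : OpLe (ZStack n d)ᵀ rn := (opLe_of_transpose_mul_self (Nat.cast_nonneg n)
    ZStack_transpose_mul_self).transpose (Real.sqrt_nonneg _)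
  have h2 : OpLe (Rᵀ * ((ZStack n d)ᵀ * N)) (1 * (rn * (w * rn))) :=
    hR.transpose.opLe.mul zero_le_one (hZ.mul hrn.le h.opLe_N)
  have h3 : OpLe (Yᵀ * D) (rad a s / 10 * rn * (11 / 10 * a * rn)) :=
    (((opLe_frob Y).mono hY).transpose (by positivity)).mul (by positivity) h.opLe_data
  refine (h1.add (h2.add h3) (by positivity)).mono ?_
  have h4 : 1 * (rn * (w * rn)) + rad a s / 10 * rn * (11 / 10 * a * rn)
      = n * (w + 11 / 100 * (a * rad a s)) := by
    rw [← hn]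
    ring
  rw [h4]
  have h5 := mul_le_mul_of_nonneg_left (show w + 11 / 100 * (a * rad a s) ≤ s * (1 / 10) by
    linarith [h.w_le, h.a_mul_rad_le]) h.n_pos.le
  linarith

lemma frob_data_mul_le_of_transpose_mul_eq_zero (h : Regime A N a s w)
    (hT : TopFrame (ZStack n d * A + N) T) {k : ℕ} {K : Matrix (Fin n × Fin d) (Fin k) ℝ}
    (hK : Tᵀ * K = 0) :
    frob ((ZStack n d * A + N)ᵀ * K) ≤ s / 100 * Real.sqrt n * frob K := by
  obtain ⟨R, hR, hY⟩ := h.near_topFrame hT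
  set rn := Real.sqrt n
  have hs := h.s_pos
  have ha := h.a_pos
  have hrn : 0 < rn := by linarith [h.one_le_sqrt_n]
  set Y := T - ZStack n d * R with hYd
  have h1 : frob ((ZStack n d)ᵀ * K) ≤ rad a s / 10 * rn * frob K := by
    have e : Yᵀ * K = - (Rᵀ * ((ZStack n d)ᵀ * K)) := by
      rw [hYd, transpose_sub, Matrix.sub_mul, hK, zero_sub, transpose_mul, Matrix.mul_assoc]
    have e2 : frob ((ZStack n d)ᵀ * K) = frob (Yᵀ * K) := by
      rw [e, frob_neg, frob_mul_of_transpose_mul hR.transpose.1]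
    rw [e2]
    refine (frob_mul_le _ _).trans ?_
    rw [frob_transpose]
    exact mul_le_mul_of_nonneg_right hY (frob_nonneg _)
  rw [transpose_add, Matrix.add_mul, transpose_mul, Matrix.mul_assoc]
  refine (frob_add_le _ _).trans ?_
  have h2 := (h.opLe_A.transpose ha.le).frob_mul_le (Y := (ZStack n d)ᵀ * K) ha.le
  have h3 := (h.opLe_N.transpose h.noise_bound_nonneg).frob_mul_le (Y := K) h.noise_bound_nonneg
  have h4 := mul_le_mul_of_nonneg_left h1 ha.le
  have h5 := mul_le_mul_of_nonneg_right (show a * rad a s / 10 + w ≤ s / 100 by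
    linarith [h.w_le, h.a_mul_rad_le]) (mul_nonneg hrn.le (frob_nonneg K))
  change _ ≤ w * rn * _ at h3
  nlinarith

/-- A noiseless block of a top frame is bounded. -/
lemma opLe_blk_topFrame (h : Regime A N a s w) (hT : TopFrame (ZStack n d * A + N) T) {j : Fin n}
    (hj : blk N j = 0) : OpLe (blk T j) (2 * (a / s)) := by
  have hs := h.s_pos
  have ha := h.a_pos
  have hn := h.n_pos
  have hlow := h.lowLe_topFrame hT
  set D := ZStack n d * A + N with hD
  have hpos : 0 ≤ 2 * (a / s) := by positivity
  rw [← transpose_transpose (blk T j)]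
  refine OpLe.transpose (fun y => ?_) hpos
  set z := (blk T j)ᵀ *ᵥ y with hz
  set M := Dᵀ * T with hM
  have e1 : (n : ℝ) • (A * M) = blk T j * (Mᵀ * M) := by
    have := congrArg (fun X => blk X j) hT.mul_eq
    simp only [← hM] at this
    rw [hM, transpose_mul, transpose_transpose, Matrix.mul_assoc Tᵀ, ← hM, ← blk_mul, ← this, blk_smul,
      blk_mul, hD, blk_add, hj, add_zero, blk_ZStack_mul]
  have e2 : vnorm (M *ᵥ z) ^ 2 = n * (y ⬝ᵥ A *ᵥ (M *ᵥ z)) := by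
    rw [vnorm_sq, dotProduct_mulVec, ← mulVec_transpose, mulVec_mulVec, dotProduct_comm,
      show z ⬝ᵥ (Mᵀ * M) *ᵥ z = y ⬝ᵥ (blk T j * (Mᵀ * M)) *ᵥ z by
        nth_rewrite 1 [hz]
        rw [mulVec_transpose, ← dotProduct_mulVec, mulVec_mulVec],
      ← e1, smul_mulVec, dotProduct_smul, smul_eq_mul, ← mulVec_mulVec]
  have e3 : vnorm (M *ᵥ z) ≤ n * (a * vnorm y) := by
    have h1 := dotProduct_le y (A *ᵥ (M *ᵥ z))
    have h2 := mul_le_mul_of_nonneg_left (h.opLe_A (M *ᵥ z)) (vnorm_nonneg y)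
    have h3 := mul_le_mul_of_nonneg_left (h1.trans h2) hn.le
    rcases (vnorm_nonneg (M *ᵥ z)).eq_or_lt with h0 | h0
    · rw [← h0]
      exact mul_nonneg hn.le (mul_nonneg ha.le (vnorm_nonneg _))
    · refine le_of_mul_le_mul_right ?_ h0
      nlinarith
  have e4 := hlow z
  rw [transpose_mul, transpose_transpose, ← hM] at e4
  have e5 : n * (s * (9 / 10) * vnorm z) ≤ n * (a * vnorm y) := by linarith
  have e6 := le_of_mul_le_mul_left e5 hn
  rw [mul_div_assoc', div_mul_eq_mul_div, le_div_iff₀ hs]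
  have := mul_nonneg ha.le (vnorm_nonneg y)
  nlinarith

end Regime

namespace Regime

variable {n d m : ℕ} {A : Matrix (Fin d) (Fin m) ℝ} {N : Matrix (Fin n × Fin d) (Fin m) ℝ}
  {a s w : ℝ} {T T' : Matrix (Fin n × Fin d) (Fin d) ℝ} {j : Fin n}

lemma blk_mask_self (N : Matrix (Fin n × Fin d) (Fin m) ℝ) (j : Fin n) :
    blk (GOPP.mask N j) j = 0 := by
  rw [blk_mask, if_pos rfl]

/-- Leave-one-out perturbation bound for the top singular subspaces. -/
lemma dF_topFrame_le (h : Regime A N a s w) (hT : TopFrame (ZStack n d * A + N) T)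
    (hT' : TopFrame (ZStack n d * A + GOPP.mask N j) T')
    (hind : OpLe (blk N j * ((ZStack n d * A + GOPP.mask N j)ᵀ * T')) (2 * a * n * w)) :
    dF T T' ≤ s ^ 2 / (1000 * a ^ 2) := by
  have hn0 := h.n_pos
  have hs := h.s_pos
  have ha := h.a_pos
  have hw := h.w_nonneg
  have hblk := (h.mask j).opLe_blk_topFrame hT' (blk_mask_self N j)
  have hlow := (h.mask j).lowLe_topFrame hT'
  have hres := frob_residual_sq hn0.ne' hT.gram T'
  have hperp := transpose_mul_residual hn0.ne' hT.gram T'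
  obtain ⟨Q, hQ⟩ := exists_isPolar (Tᵀ * T')
  have hal := frob_aligned_sq_le hn0 hT'.gram hT.gram hQ
  have hfT' := frob_eq_of_transpose_mul_self hT'.gram
  have hn := Real.mul_self_sqrt hn0.le
  have hd := Real.mul_self_sqrt (Nat.cast_nonneg (α := ℝ) d)
  have hDK := h.frob_data_mul_le_of_transpose_mul_eq_zero hT hperp
  set K := T' - (n : ℝ)⁻¹ • (T * (Tᵀ * T')) with hK
  rw [dF_comm, hQ.dF_eq]
  set D := ZStack n d * A + N with hD
  set D' := ZStack n d * A + GOPP.mask N j with hD'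
  set rn := Real.sqrt n
  set rd := Real.sqrt d
  have hrn : 0 < rn := by linarith [h.one_le_sqrt_n]
  have hrd : 0 ≤ rd := Real.sqrt_nonneg _
  have hKn := frob_nonneg K
  have hKT : Kᵀ * T = 0 := by
    rw [← transpose_transpose T, ← transpose_mul, hperp, transpose_zero]
  have hKX : ∀ X : Matrix (Fin n × Fin d) (Fin d) ℝ,
      Kᵀ * (D * (Dᵀ * (T * (Tᵀ * X)))) = 0 := fun X => by
    have h1 : (n : ℝ) • (Kᵀ * (D * (Dᵀ * T))) = 0 := by
      rw [← Matrix.mul_smul, hT.mul_eq, ← Matrix.mul_assoc, hKT, Matrix.zero_mul]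
    have h2 := (smul_eq_zero.1 h1).resolve_left hn0.ne'
    rw [← Matrix.mul_assoc Dᵀ, ← Matrix.mul_assoc D, ← Matrix.mul_assoc Kᵀ, h2, Matrix.zero_mul]
  have hKCT' : trace (Kᵀ * (D * (Dᵀ * T'))) = frob (Dᵀ * K) ^ 2 := by
    rw [frob_sq, transpose_mul, transpose_transpose, Matrix.mul_assoc]
    nth_rewrite 3 [hK]
    rw [Matrix.mul_sub Dᵀ, Matrix.mul_sub D, Matrix.mul_sub Kᵀ, Matrix.mul_smul, Matrix.mul_smul,
      Matrix.mul_smul, hKX, smul_zero, sub_zero]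
  have hKK : Kᵀ * K = Kᵀ * T' := by
    nth_rewrite 2 [hK]
    rw [Matrix.mul_sub, Matrix.mul_smul, ← Matrix.mul_assoc Kᵀ T, hKT, Matrix.zero_mul, smul_zero,
      sub_zero]
  have hKC' : n * trace (Kᵀ * (D' * (D'ᵀ * T'))) = frob (K * (T'ᵀ * D')) ^ 2 := by
    rw [← smul_eq_mul, ← trace_smul, ← Matrix.mul_smul, hT'.mul_eq, ← Matrix.mul_assoc Kᵀ, ← hKK,
      Matrix.mul_assoc Kᵀ, trace_mul_comm, ← frob_transpose, frob_sq, transpose_transpose,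
      transpose_mul, transpose_mul, transpose_transpose]
    simp only [Matrix.mul_assoc]
  set H := D * ((D - D')ᵀ * T') + (D - D') * (D'ᵀ * T') with hH
  have hHeq : H = D * (Dᵀ * T') - D' * (D'ᵀ * T') := by
    rw [hH, transpose_sub, Matrix.sub_mul, Matrix.sub_mul, Matrix.mul_sub]
    abel
  have hDD : D - D' = N - GOPP.mask N j := by rw [hD, hD', add_sub_add_left_eq_sub]
  have hHle : frob H ≤ n * (21 / 5 * (a / s) * (a * w * rd)) := by
    refine (frob_add_le _ _).trans ?_
    have g1 : frob (D * ((D - D')ᵀ * T')) ≤ 11 / 10 * a * rn * (w * rn * (2 * (a / s) * rd)) := by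
      refine (h.opLe_data.frob_mul_le h.data_bound_nonneg).trans
        (mul_le_mul_of_nonneg_left ?_ h.data_bound_nonneg)
      rw [hDD, sub_mask_transpose_mul]
      refine (((h.opLe_N.blk j).transpose h.noise_bound_nonneg).frob_mul_le
        h.noise_bound_nonneg).trans (mul_le_mul_of_nonneg_left ?_ h.noise_bound_nonneg)
      have := hblk.frob_le (by positivity)
      rwa [Fintype.card_fin] at this
    have g2 : frob ((D - D') * (D'ᵀ * T')) ≤ 2 * a * n * w * rd := by
      rw [hDD, frob_sub_mask_mul]
      have := hind.frob_le (by positivity)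
      rwa [Fintype.card_fin] at this
    have g3 : 1 ≤ a / s := (one_le_div hs).2 h.s_le_a
    have g4 : 11 / 10 * a * rn * (w * rn * (2 * (a / s) * rd))
        = n * (11 / 5 * (a / s) * (a * w * rd)) := by
      rw [← hn]
      ring
    have g5 : 1 * (n * (a * w * rd)) ≤ a / s * (n * (a * w * rd)) :=
      mul_le_mul_of_nonneg_right g3 (by positivity)
    linarith
  have hKH := trace_transpose_mul_le K H
  rw [hHeq, Matrix.mul_sub, trace_sub, hKCT', ← hHeq] at hKH
  have hKH' := trace_transpose_mul_le (-K) H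
  rw [transpose_neg, Matrix.neg_mul, trace_neg, frob_neg, hHeq, Matrix.mul_sub, trace_sub, hKCT',
    ← hHeq] at hKH'
  have hl1 := pow_le_pow_left₀ (by positivity) (hlow.frob_le (by positivity) K) 2
  rw [← hKC'] at hl1
  have hDK2 := pow_le_pow_left₀ (frob_nonneg _) hDK 2
  have hl2 : n * (s ^ 2 * (8 / 10)) * frob K ^ 2 ≤ trace (Kᵀ * (D' * (D'ᵀ * T'))) := by
    refine le_of_mul_le_mul_left ?_ hn0
    refine le_trans ?_ hl1
    have : 0 ≤ (n : ℝ) ^ 2 * s ^ 2 * frob K ^ 2 := by positivity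
    linarith
  have hl3 : n * (s ^ 2 * (7 / 10)) * frob K ^ 2
      ≤ frob K * (n * (21 / 5 * (a / s) * (a * w * rd))) := by
    have g1 := mul_le_mul_of_nonneg_left hHle hKn
    have g2 : (s / 100 * rn * frob K) ^ 2 = n * (s ^ 2 / 10000) * frob K ^ 2 := by
      rw [← hn]
      ring
    rw [g2] at hDK2
    have : 0 ≤ n * s ^ 2 * frob K ^ 2 := by positivity
    linarith
  have hl4 : frob K ≤ s ^ 2 / (1600 * a ^ 2) := by
    rcases hKn.eq_or_lt with h0 | h0
    · rw [← h0]
      positivity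
    · have g1 : s ^ 2 * (7 / 10) * frob K ≤ 21 / 5 * (a / s) * (a * w * rd) := by
        refine le_of_mul_le_mul_left ?_ (mul_pos hn0 h0)
        linarith
      have g2 := h.mul_small
      rw [le_div_iff₀ (by positivity)]
      refine le_of_mul_le_mul_left ?_ (pow_pos hs 3)
      have g3 : s * (s ^ 2 * (7 / 10) * frob K) ≤ s * (21 / 5 * (a / s) * (a * w * rd)) :=
        mul_le_mul_of_nonneg_left g1 hs.le
      have g4 : s * (21 / 5 * (a / s) * (a * w * rd)) = 21 / 5 * a * (a * w * rd) := by
        field_simp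
      rw [g4] at g3
      have g5 := mul_le_mul_of_nonneg_left g3 (pow_pos ha 2).le
      change a ^ 3 * (a * w * rd) ≤ _ at g2
      have g6 : 0 < s ^ 5 := pow_pos hs 5
      linarith
  have hl5 : frob (T' - T * Q) ^ 2 ≤ 2 * frob K ^ 2 := by
    refine hal.trans ?_
    rw [hfT', mul_pow, sq rn, sq rd, hn, hd] at hres
    refine le_of_mul_le_mul_left ?_ hn0
    have : (n : ℝ) * (2 * (n * d - frob (Tᵀ * T') ^ 2 / n))
        = 2 * (n * (n * d) - frob (Tᵀ * T') ^ 2) := by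
      field_simp
    rw [this]
    linarith
  have hl6 : frob (T' - T * Q) ≤ 8 / 5 * frob K := by
    refine (pow_le_pow_iff_left₀ (frob_nonneg _) (by positivity) two_ne_zero).1 ?_
    have := sq_nonneg (frob K)
    linarith
  refine hl6.trans ?_
  have : 8 / 5 * (s ^ 2 / (1600 * a ^ 2)) = s ^ 2 / (1000 * a ^ 2) := by
    field_simp
    norm_num
  linarith

lemma sq_div_sq_le_one (h : Regime A N a s w) : s ^ 2 / a ^ 2 ≤ 1 :=
  (div_le_one (pow_pos h.a_pos 2)).2 (pow_le_pow_left₀ h.s_pos.le h.s_le_a 2)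

lemma lowLe_blk_topFrame (h : Regime A N a s w) (hT : TopFrame (ZStack n d * A + N) T)
    (hT' : TopFrame (ZStack n d * A + GOPP.mask N j) T')
    (hind : OpLe (blk N j * ((ZStack n d * A + GOPP.mask N j)ᵀ * T')) (2 * a * n * w)) :
    LowLe (blk T j) (s ^ 2 / (4 * a ^ 2)) := by
  have hn0 := h.n_pos
  have hs := h.s_pos
  have ha := h.a_pos
  have h1 := h.dF_topFrame_le hT hT' hind
  have h2 : dF T T' ≤ 5 * Real.sqrt d := by
    have h3 := h.sq_div_sq_le_one
    have h4 : s ^ 2 / (1000 * a ^ 2) = s ^ 2 / a ^ 2 / 1000 := by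
      field_simp
    linarith [h.one_le_sqrt_d]
  have hnear := (h.near_topFrame hT).mono (show rad a s / 10 ≤ rad a s by linarith [h.rad_pos])
  have hlow := h.lowLe_blk hT.gram hnear h2
    ((h.mask j).opLe_blk_topFrame hT' (blk_mask_self N j)) hind
  have hn := Real.mul_self_sqrt hn0.le
  set D := ZStack n d * A + N with hD
  intro y
  have hop : OpLe (Dᵀ * T) (11 / 10 * a * Real.sqrt n * Real.sqrt n) :=
    (h.opLe_data.transpose h.data_bound_nonneg).mul h.data_bound_nonneg
      (opLe_of_transpose_mul_self hn0.le hT.gram)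
  have hop2 : OpLe ((Dᵀ * T)ᵀ * (Dᵀ * T)) _ :=
    (hop.transpose (by positivity)).mul (by positivity) hop
  have e1 : (n : ℝ) • blk (D * Dᵀ * T) j = blk T j * ((Dᵀ * T)ᵀ * (Dᵀ * T)) := by
    have : blk _ j = blk _ j := congrArg (fun X => blk X j) hT.mul_eq
    rw [transpose_mul, transpose_transpose, Matrix.mul_assoc Tᵀ, ← blk_mul, ← this, blk_smul,
      Matrix.mul_assoc]
  have e2 := hlow y
  have e3 := hop2 ((blk T j)ᵀ *ᵥ y)
  have e4 : ((Dᵀ * T)ᵀ * (Dᵀ * T)) *ᵥ ((blk T j)ᵀ *ᵥ y)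
      = (n : ℝ) • ((blk (D * Dᵀ * T) j)ᵀ *ᵥ y) := by
    rw [← smul_mulVec, ← transpose_smul, e1, transpose_mul (blk T j), transpose_mul (Dᵀ * T)ᵀ,
      transpose_transpose, mulVec_mulVec]
  rw [e4, vnorm_smul, Nat.abs_cast] at e3
  rw [mul_assoc _ (Real.sqrt n) (Real.sqrt n), hn] at e3
  have e5 := mul_le_mul_of_nonneg_left e2 hn0.le
  set t := vnorm ((blk T j)ᵀ *ᵥ y)
  have e6 : (n : ℝ) ^ 2 * (s ^ 2 * vnorm y) ≤ (n : ℝ) ^ 2 * (t * (4 * a ^ 2)) := by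
    have : 0 ≤ (n : ℝ) ^ 2 * (t * a ^ 2) :=
      mul_nonneg (by positivity) (mul_nonneg (vnorm_nonneg _) (by positivity))
    linarith
  rw [div_mul_eq_mul_div, div_le_iff₀ (by positivity)]
  exact le_of_mul_le_mul_left e6 (by positivity)

lemma isPolar_self {R : Matrix (Fin d) (Fin d) ℝ} (hR : IsOrth R) : IsPolar R R :=
  ⟨hR, fun Q _ => by
    rw [sub_self, frob_zero]
    exact frob_nonneg _⟩

lemma lowLe_one {R : Matrix (Fin d) (Fin d) ℝ} (hR : IsOrth R) : LowLe R 1 := fun y => by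
  rw [hR.transpose.vnorm_mulVec, one_mul]

lemma near_start (h : Regime A N a s w) (hT : TopFrame (ZStack n d * A + N) T)
    {S : Matrix (Fin n × Fin d) (Fin d) ℝ} (hS : IsPolarBlocks T S) : Near (rad a s) S := by
  obtain ⟨R, hR, hRT⟩ := h.near_topFrame hT
  refine ⟨R, hR, ?_⟩
  have h1 : frob (ZStack n d * R - S) ≤ 2 / 1 * frob (ZStack n d * R - T) := by
    refine frob_le_mul_of_blk (by positivity) fun k => ?_
    rw [blk_sub, blk_sub, blk_ZStack_mul]
    exact (isPolar_self hR).lipschitz (hS k) one_pos (lowLe_one hR)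
  rw [frob_sub_comm] at h1
  rw [frob_sub_comm (ZStack n d * R)] at h1
  have := mul_nonneg h.rad_pos.le (Real.sqrt_nonneg n)
  linarith

lemma dF_start_le (h : Regime A N a s w) (hT : TopFrame (ZStack n d * A + N) T)
    (hT' : ∀ k, ∃ T', TopFrame (ZStack n d * A + GOPP.mask N k) T' ∧
      OpLe (blk N k * ((ZStack n d * A + GOPP.mask N k)ᵀ * T')) (2 * a * n * w))
    (hTj : TopFrame (ZStack n d * A + GOPP.mask N j) T')
    (hind : OpLe (blk N j * ((ZStack n d * A + GOPP.mask N j)ᵀ * T')) (2 * a * n * w))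
    {S S' : Matrix (Fin n × Fin d) (Fin d) ℝ} (hS : IsPolarBlocks T S) (hS' : IsPolarBlocks T' S') :
    dF S S' ≤ 1 := by
  have hs := h.s_pos
  have ha := h.a_pos
  have h1 := h.dF_topFrame_le hT hTj hind
  obtain ⟨Q, hQ⟩ := exists_isPolar (T'ᵀ * T)
  rw [hQ.dF_eq] at h1
  refine (GOPP.dF_le hQ.1).trans ?_
  have h2 : frob (S - S' * Q) ≤ 2 / (s ^ 2 / (4 * a ^ 2)) * frob (T - T' * Q) := by
    refine frob_le_mul_of_blk (by positivity) fun k => ?_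
    obtain ⟨X, hX, hXi⟩ := hT' k
    rw [blk_sub, blk_sub]
    exact (hS k).lipschitz (hS'.mul_right hQ.1 k) (by positivity) (h.lowLe_blk_topFrame hT hX hXi)
  refine h2.trans ((mul_le_mul_of_nonneg_left h1 (by positivity)).trans ?_)
  have : 2 / (s ^ 2 / (4 * a ^ 2)) * (s ^ 2 / (1000 * a ^ 2)) = 8 / 1000 := by
    field_simp
    norm_num
  rw [this]
  norm_num

end Regime

/-! ### Convergence of the power iterations -/

section Convergence

variable {n d m : ℕ}

/-- Convergence of a sequence on which all pairwise distances contract. -/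
lemma exists_limit_of_contraction {S : ℕ → Matrix (Fin n × Fin d) (Fin d) ℝ}
    (hS : ∀ t, OrthBlocks (S t)) {B : ℝ} (hB : ∀ t, dF (S 0) (S t) ≤ B)
    (hcontr : ∀ t τ, dF (S (t + 1)) (S (τ + 1)) ≤ 1 / 4 * dF (S t) (S τ)) :
    ∃ Sinf, OrthBlocks Sinf ∧
      (∀ t : ℕ, dF (S t) Sinf ≤ (1 / 2 : ℝ) ^ t * dF (S 0) Sinf) ∧
      Tendsto (fun t => dF (S t) Sinf) atTop (nhds 0) ∧
      ∀ Sinf', OrthBlocks Sinf' →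
        Tendsto (fun t => dF (S t) Sinf') atTop (nhds 0) → dF Sinf Sinf' = 0 := by
  have : FirstCountableTopology (Matrix (Fin n × Fin d) (Fin d) ℝ) :=
    inferInstanceAs (FirstCountableTopology (Fin n × Fin d → Fin d → ℝ))
  obtain ⟨Sinf, hinf, φ, hφ, hlim⟩ := (isCompact_orthBlocks n d).tendsto_subseq hS
  have hpow : ∀ t τ, dF (S t) (S (t + τ)) ≤ (1 / 4 : ℝ) ^ t * B := fun t => by
    induction t with
    | zero => simpa using hB
    | succ t ih =>
      intro τ
      rw [Nat.add_right_comm, pow_succ']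
      have := hcontr t (t + τ)
      have := ih τ
      linarith
  have hsub : Tendsto (fun k => dF (S (φ k)) Sinf) atTop (nhds 0) := by
    have h1 : Tendsto (fun k => frob (S (φ k) - Sinf)) atTop (nhds (frob (Sinf - Sinf))) :=
      (continuous_frob.tendsto _).comp (hlim.sub_const Sinf)
    rw [sub_self, frob_zero] at h1
    refine squeeze_zero (fun k => dF_nonneg _ _) (fun k => ?_) h1
    have := dF_le (X := S (φ k)) (Y := Sinf) (IsOrth.one (d := d))
    rwa [Matrix.mul_one] at this
  have hbd : ∀ t, dF (S t) Sinf ≤ (1 / 4 : ℝ) ^ t * B := fun t => by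
    have h1 : Tendsto (fun k => (1 / 4 : ℝ) ^ t * B + dF (S (φ k)) Sinf) atTop
        (nhds ((1 / 4 : ℝ) ^ t * B + 0)) := hsub.const_add _
    rw [add_zero] at h1
    refine ge_of_tendsto h1 ?_
    filter_upwards [eventually_ge_atTop t] with k hk
    obtain ⟨τ, hτ⟩ := Nat.exists_eq_add_of_le (hk.trans (hφ.id_le k))
    have h2 := dF_triangle (S t) (S (φ k)) Sinf
    have h3 := hpow t τ
    rw [← hτ] at h3
    linarith
  have hzero : Tendsto (fun t => dF (S t) Sinf) atTop (nhds 0) := by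
    have h1 : Tendsto (fun t : ℕ => (1 / 4 : ℝ) ^ t * B) atTop (nhds (0 * B)) :=
      (tendsto_pow_atTop_nhds_zero_of_lt_one (by norm_num) (by norm_num)).mul_const B
    rw [zero_mul] at h1
    exact squeeze_zero (fun t => dF_nonneg _ _) hbd h1
  have hstep : ∀ t, dF (S (t + 1)) Sinf ≤ 1 / 4 * dF (S t) Sinf := fun t => by
    have h1 : Tendsto (fun τ => 1 / 4 * (dF (S t) Sinf + dF (S τ) Sinf) + dF (S (τ + 1)) Sinf) atTop
        (nhds (1 / 4 * (dF (S t) Sinf + 0) + 0)) :=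
      ((hzero.const_add _).const_mul _).add ((tendsto_add_atTop_iff_nat 1).2 hzero)
    rw [add_zero, add_zero] at h1
    refine ge_of_tendsto' h1 fun τ => ?_
    have h2 := dF_triangle (S (t + 1)) (S (τ + 1)) Sinf
    have h3 := dF_triangle (S t) Sinf (S τ)
    rw [dF_comm Sinf] at h3
    have h4 := hcontr t τ
    linarith
  refine ⟨Sinf, hinf, fun t => ?_, hzero, fun X _ hX => ?_⟩
  · induction t with
    | zero => simp
    | succ t ih =>
      rw [pow_succ']
      have := hstep t
      have := dF_nonneg (S t) Sinf
      linarith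
  · refine le_antisymm ?_ (dF_nonneg _ _)
    have h1 := hzero.add hX
    rw [add_zero] at h1
    refine ge_of_tendsto' h1 fun t => ?_
    have := dF_triangle Sinf (S t) X
    rwa [dF_comm Sinf (S t)] at this

/-- The leave-one-out hypothesis for the `j`-th noise block: the power iterations run without that
block exist and the block acts on them with small norm. -/
def LeaveOneOut (A : Matrix (Fin d) (Fin m) ℝ) (N : Matrix (Fin n × Fin d) (Fin m) ℝ) (b : ℝ)
    (j : Fin n) : Prop :=
  ∃ (U : Matrix (Fin n × Fin d) (Fin d) ℝ) (S : ℕ → Matrix (Fin n × Fin d) (Fin d) ℝ),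
    IsTopSingVecs (ZStack n d * A + mask N j) U ∧ IsPolarBlocks U (S 0) ∧
    (∀ t, IsPolarBlocks ((ZStack n d * A + mask N j) * (ZStack n d * A + mask N j)ᵀ * S t)
      (S (t + 1))) ∧
    OpLe (blk N j * ((ZStack n d * A + mask N j)ᵀ * (Real.sqrt n • U))) b ∧
    ∀ t ≤ n, OpLe (blk N j * ((ZStack n d * A + mask N j)ᵀ * S t)) b

lemma IsPolarBlocks.smul {X S : Matrix (Fin n × Fin d) (Fin d) ℝ} (h : IsPolarBlocks X S) {r : ℝ}
    (hr : 0 ≤ r) : IsPolarBlocks (r • X) S := fun i => by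
  rw [blk_smul]
  exact (h i).smul hr

namespace Regime

variable {A : Matrix (Fin d) (Fin m) ℝ} {N : Matrix (Fin n × Fin d) (Fin m) ℝ} {a s w : ℝ}

lemma opLe_blk_orthBlocks (h : Regime A N a s w) {S : Matrix (Fin n × Fin d) (Fin d) ℝ}
    (hS : OrthBlocks S) (j : Fin n) : OpLe (blk S j) (2 * (a / s)) := by
  refine (hS j).opLe.mono ?_
  have : 1 ≤ a / s := (one_le_div h.s_pos).2 h.s_le_a
  linarith

lemma near_of_gpm (h : Regime A N a s w) {U : Matrix (Fin n × Fin d) (Fin d) ℝ}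
    {S : ℕ → Matrix (Fin n × Fin d) (Fin d) ℝ} (hU : IsTopSingVecs (ZStack n d * A + N) U)
    (h0 : IsPolarBlocks U (S 0))
    (hS : ∀ t, IsPolarBlocks ((ZStack n d * A + N) * (ZStack n d * A + N)ᵀ * S t) (S (t + 1)))
    (t : ℕ) : OrthBlocks (S t) ∧ Near (rad a s) (S t) := by
  induction t with
  | zero =>
    exact ⟨h0.orthBlocks, h.near_start (hU.topFrame h.one_le_n) (h0.smul (Real.sqrt_nonneg _))⟩
  | succ t ih => exact ⟨(hS t).orthBlocks, h.near_step ih.1.transpose_mul_self ih.2 (hS t)⟩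

theorem linear_convergence (h : Regime A N a s w)
    (hloo : ∀ j, LeaveOneOut A N (2 * a * n * w) j)
    {S : ℕ → Matrix (Fin n × Fin d) (Fin d) ℝ} (hS : IsGPM (ZStack n d * A + N) S) :
    ∃ Sinf, OrthBlocks Sinf ∧
      (∀ t : ℕ, dF (S t) Sinf ≤ (1 / 2 : ℝ) ^ t * dF (S 0) Sinf) ∧
      Tendsto (fun t => dF (S t) Sinf) atTop (nhds 0) ∧
      ∀ Sinf', OrthBlocks Sinf' →
        Tendsto (fun t => dF (S t) Sinf') atTop (nhds 0) → dF Sinf Sinf' = 0 := by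
  obtain ⟨⟨U, hU, h0⟩, hstep⟩ := hS
  choose U' S' hU' h0' hstep' hindU hindS using hloo
  have hT := hU.topFrame h.one_le_n
  have hT' := fun j => (hU' j).topFrame h.one_le_n
  have hnear := h.near_of_gpm hU h0 hstep
  have hnear' := fun j => (h.mask j).near_of_gpm (hU' j) (h0' j) (hstep' j)
  have hrad := h.rad_pos
  have hrad' := h.rad_le
  have hrd := h.one_le_sqrt_d
  have hrn := h.one_le_sqrt_n
  have hdist : ∀ {X Y : Matrix (Fin n × Fin d) (Fin d) ℝ}, Near (rad a s) X → Near (rad a s) Y →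
      dF X Y ≤ 2 * rad a s * Real.sqrt n := fun hX hY => by
    have := hX.dF_le hY
    rwa [← two_mul] at this
  have hloo : ∀ t ≤ n, ∀ j, dF (S t) (S' j t) ≤ 4 * Real.sqrt d := by
    intro t
    induction t with
    | zero =>
      intro _ j
      have := h.dF_start_le hT (fun k => ⟨_, hT' k, hindU k⟩) (hT' j) (hindU j)
        (h0.smul (Real.sqrt_nonneg _)) ((h0' j).smul (Real.sqrt_nonneg _))
      linarith
    | succ t ih =>
      intro ht j
      have ih' := ih (Nat.le_of_succ_le ht)
      refine h.dF_step_mask_le (hnear t).1 (hnear' j t).1 (hnear t).2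
        (hdist (hnear t).2 (hnear' j t).2) (ih' j) (fun k => ?_) (hstep t) (hstep' j t)
      exact h.lowLe_blk (hnear t).1.transpose_mul_self (hnear t).2 (by linarith [ih' k])
        (h.opLe_blk_orthBlocks (hnear' k t).1 k) (hindS k t (Nat.le_of_succ_le ht))
  have hcontr_of : ∀ t, (∀ k, LowLe (blk ((ZStack n d * A + N) * (ZStack n d * A + N)ᵀ * S t) k)
      (n * s ^ 2 / 2)) → ∀ τ, dF (S (t + 1)) (S (τ + 1)) ≤ 1 / 4 * dF (S t) (S τ) :=
    fun t hlow τ => h.dF_step_le (hnear t).1 (hnear τ).1 (hnear t).2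
      (hdist (hnear t).2 (hnear τ).2) hlow (hstep t) (hstep τ)
  have hcontr_le : ∀ t ≤ n, ∀ τ, dF (S (t + 1)) (S (τ + 1)) ≤ 1 / 4 * dF (S t) (S τ) :=
    fun t ht => hcontr_of t fun k => h.lowLe_blk (hnear t).1.transpose_mul_self (hnear t).2
      (by linarith [hloo t ht k]) (h.opLe_blk_orthBlocks (hnear' k t).1 k) (hindS k t ht)
  have hgeom : ∀ t ≤ n, dF (S t) (S (t + 1)) ≤ (1 / 4 : ℝ) ^ t * (1 / 32 * Real.sqrt n) := by
    intro t
    induction t with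
    | zero =>
      intro _
      have := hdist (hnear 0).2 (hnear (0 + 1)).2
      have := mul_le_mul_of_nonneg_right hrad' (Real.sqrt_nonneg n)
      rw [pow_zero]
      linarith
    | succ t ih =>
      intro ht
      have h1 := hcontr_le t (Nat.le_of_succ_le ht) (t + 1)
      have h2 := ih (Nat.le_of_succ_le ht)
      rw [pow_succ']
      linarith
  have hfirst : dF (S n) (S (n + 1)) ≤ 3 / 4 := by
    refine (hgeom n le_rfl).trans ?_
    have h1 : (n : ℝ) ≤ 4 ^ n := by exact_mod_cast (Nat.lt_pow_self (by norm_num : 1 < 4)).le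
    have h2 : Real.sqrt n ≤ 4 ^ n :=
      (Real.sqrt_le_iff.2 ⟨by positivity, le_self_pow₀ (by exact_mod_cast h.one_le_n)
        two_ne_zero⟩).trans h1
    rw [one_div, inv_pow, inv_mul_le_iff₀ (by positivity)]
    linarith
  have htail : ∀ i, dF (S n) (S (n + i)) ≤ 1 := fun i => by
    induction i with
    | zero =>
      have h1 := dF_le (X := S n) (Y := S n) (IsOrth.one (d := d))
      rw [Matrix.mul_one, sub_self, frob_zero] at h1
      exact h1.trans zero_le_one
    | succ i ih =>
      have h1 := dF_triangle (S n) (S (n + 1)) (S (n + (i + 1)))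
      have h2 := hcontr_le n le_rfl (n + i)
      rw [← add_assoc] at h1 ⊢
      linarith
  have hcontr : ∀ t τ, dF (S (t + 1)) (S (τ + 1)) ≤ 1 / 4 * dF (S t) (S τ) := fun t => by
    rcases le_total t n with ht | ht
    · exact hcontr_le t ht
    · obtain ⟨i, rfl⟩ := Nat.exists_eq_add_of_le ht
      refine hcontr_of _ fun k => h.lowLe_blk (T := S' k n) (hnear _).1.transpose_mul_self
        (hnear _).2 ?_ (h.opLe_blk_orthBlocks (hnear' k n).1 k) (hindS k n le_rfl)
      have h1 := dF_triangle (S (n + i)) (S n) (S' k n)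
      have h2 := hloo n le_rfl k
      have h3 := htail i
      rw [dF_comm] at h3
      linarith
  exact exists_limit_of_contraction (fun t => (hnear t).1)
    (fun t => hdist (hnear 0).2 (hnear t).2) hcontr

end Regime

end Convergence

/-! ### Tail bounds for Gaussian matrices -/

section Tail

variable {ι κ l : Type*} [Fintype ι] [Fintype κ] [Fintype l]

lemma continuous_vnorm : Continuous (vnorm : (κ → ℝ) → ℝ) :=
  Real.continuous_sqrt.comp (continuous_finsetSum _ fun j _ => (continuous_apply j).pow 2)

lemma abs_apply_le_vnorm (u : κ → ℝ) (j : κ) : |u j| ≤ vnorm u :=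
  Real.abs_le_sqrt (Finset.single_le_sum (f := fun j => u j ^ 2) (fun _ _ => sq_nonneg _)
    (Finset.mem_univ j))

lemma isCompact_vnorm_le (r : ℝ) : IsCompact {u : κ → ℝ | vnorm u ≤ r} := by
  refine (isCompact_univ_pi fun _ : κ => isCompact_Icc (a := -r) (b := r)).of_isClosed_subset
    (isClosed_le continuous_vnorm continuous_const) fun u hu j _ => ?_
  exact abs_le.1 ((abs_apply_le_vnorm u j).trans hu)

/-- The operator norm is attained at a unit vector. -/
lemma exists_opLe_vnorm_mulVec [Nonempty κ] (X : Matrix ι κ ℝ) :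
    ∃ x, vnorm x = 1 ∧ OpLe X (vnorm (X *ᵥ x)) := by
  have hK : IsCompact {u : κ → ℝ | vnorm u = 1} :=
    (isCompact_vnorm_le 1).of_isClosed_subset (isClosed_eq continuous_vnorm continuous_const)
      fun u hu => le_of_eq hu
  have hne : {u : κ → ℝ | vnorm u = 1}.Nonempty :=
    ⟨_, vnorm_normalize (u := fun _ => (1 : ℝ))
      fun h => one_ne_zero (congrFun h (Classical.arbitrary κ))⟩
  have hc : Continuous fun u : κ → ℝ => vnorm (X *ᵥ u) :=
    continuous_vnorm.comp (continuous_const.matrix_mulVec continuous_id)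
  obtain ⟨x, hx, hmax⟩ := hK.exists_isMaxOn hne hc.continuousOn
  refine ⟨x, hx, fun u => ?_⟩
  by_cases hu : u = 0
  · simp [hu, vnorm_zero]
  have h1 : vnorm (X *ᵥ ((vnorm u)⁻¹ • u)) ≤ vnorm (X *ᵥ x) := hmax (vnorm_normalize hu)
  have hpos : 0 < vnorm u := (vnorm_nonneg u).lt_of_ne' fun h => hu (vnorm_eq_zero.1 h)
  rwa [mulVec_smul, vnorm_smul, abs_of_pos (inv_pos.2 hpos), inv_mul_le_iff₀ hpos, mul_comm] at h1

lemma volume_vnorm_sub_le (x : κ → ℝ) {r : ℝ} (hr : 0 < r) :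
    volume {u : κ → ℝ | vnorm (u - x) ≤ r} =
      ENNReal.ofReal (r ^ Fintype.card κ) * volume {u : κ → ℝ | vnorm u ≤ 1} := by
  have h1 : {u : κ → ℝ | vnorm (u - x) ≤ r} =
      (fun u => u + -x) ⁻¹' ((fun u => r⁻¹ • u) ⁻¹' {u : κ → ℝ | vnorm u ≤ 1}) := by
    ext u
    simp only [Set.mem_ofPred_eq, Set.mem_preimage, vnorm_smul, ← sub_eq_add_neg,
      abs_of_pos (inv_pos.2 hr), inv_mul_le_iff₀ hr, mul_one]
  rw [h1, measure_preimage_add_right, Measure.addHaar_preimage_smul volume (inv_ne_zero hr.ne'),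
    Module.finrank_fintype_fun_eq_card, inv_pow, inv_inv, abs_of_pos (pow_pos hr _)]

lemma volume_vnorm_le_one_ne_zero : volume {u : κ → ℝ | vnorm u ≤ 1} ≠ 0 := by
  refine (Measure.measure_pos_of_mem_nhds volume (x := 0) ?_).ne'
  refine continuous_vnorm.continuousAt.preimage_mem_nhds (Iic_mem_nhds ?_)
  rw [vnorm_zero]
  exact one_pos

lemma lintegral_exp_stdGaussian (c : ι → κ → ℝ) :
    ∫⁻ V, ENNReal.ofReal (Real.exp (∑ i, ∑ j, c i j * V i j)) ∂stdGaussian ι κ =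
      ENNReal.ofReal (Real.exp ((∑ i, ∑ j, c i j ^ 2) / 2)) := by
  have hintegrable : ∀ t : ℝ, Integrable (fun x => Real.exp (t * x))
      (ProbabilityTheory.gaussianReal 0 1) := fun t =>
    ProbabilityTheory.integrable_exp_mul_gaussianReal t
  have h1 : Integrable (fun V : ι → κ → ℝ => ∏ i, ∏ j, Real.exp (c i j * V i j))
      (stdGaussian ι κ) :=
    Integrable.fintype_prod (f := fun i (v : κ → ℝ) => ∏ j, Real.exp (c i j * v j)) fun i =>
      Integrable.fintype_prod (f := fun j (x : ℝ) => Real.exp (c i j * x)) fun j => hintegrable _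
  have h2 : ∫ V, ∏ i, ∏ j, Real.exp (c i j * V i j) ∂stdGaussian ι κ =
      ∏ i, ∏ j, Real.exp (c i j ^ 2 / 2) := by
    rw [stdGaussian, integral_fintype_prod_eq_prod
      (fun i (v : κ → ℝ) => ∏ j, Real.exp (c i j * v j))]
    refine Finset.prod_congr rfl fun i _ => ?_
    rw [integral_fintype_prod_eq_prod (fun j (x : ℝ) => Real.exp (c i j * x))]
    refine Finset.prod_congr rfl fun j _ => ?_
    have := congrFun (ProbabilityTheory.mgf_fun_id_gaussianReal (μ := 0) (v := 1)) (c i j)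
    simpa [ProbabilityTheory.mgf] using this
  simp only [Real.exp_sum, Finset.sum_div]
  rw [← h2, ofReal_integral_eq_lintegral_ofReal h1
    (Eventually.of_forall fun V => Finset.prod_nonneg fun i _ => Finset.prod_nonneg fun j _ =>
      (Real.exp_pos _).le)]

lemma dotProduct_mul_mulVec (V : Matrix ι κ ℝ) (B : Matrix κ l ℝ) (u : l → ℝ) (v : ι → ℝ) :
    v ⬝ᵥ ((V * B) *ᵥ u) = ∑ i, ∑ j, v i * (B *ᵥ u) j * V i j := by
  rw [← mulVec_mulVec]
  simp only [dotProduct, mulVec, Finset.mul_sum, Finset.sum_mul]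
  refine Finset.sum_congr rfl fun i _ => Finset.sum_congr rfl fun j _ =>
    Finset.sum_congr rfl fun k _ => ?_
  ring

lemma lintegral_exp_dotProduct_le {B : Matrix κ l ℝ} {β t : ℝ} (hB : OpLe B β) (u : l → ℝ)
    (v : ι → ℝ) :
    ∫⁻ V, ENNReal.ofReal (Real.exp (t * (v ⬝ᵥ ((Matrix.of V * B) *ᵥ u)))) ∂stdGaussian ι κ ≤
      ENNReal.ofReal (Real.exp (t ^ 2 * (β * (vnorm u * vnorm v)) ^ 2 / 2)) := by
  have h1 : ∀ V : ι → κ → ℝ, t * (v ⬝ᵥ ((Matrix.of V * B) *ᵥ u)) =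
      ∑ i, ∑ j, t * (v i * (B *ᵥ u) j) * V i j := fun V => by
    rw [dotProduct_mul_mulVec]
    simp only [Finset.mul_sum, of_apply, mul_assoc]
  simp only [h1]
  rw [lintegral_exp_stdGaussian]
  refine ENNReal.ofReal_le_ofReal (Real.exp_le_exp.2 ?_)
  have h2 : ∑ i, ∑ j, (t * (v i * (B *ᵥ u) j)) ^ 2 = t ^ 2 * (vnorm v * vnorm (B *ᵥ u)) ^ 2 := by
    rw [mul_pow, vnorm_sq, vnorm_sq, dotProduct, dotProduct, Finset.sum_mul_sum, Finset.mul_sum]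
    refine Finset.sum_congr rfl fun i _ => ?_
    rw [Finset.mul_sum]
    exact Finset.sum_congr rfl fun j _ => by ring
  rw [h2]
  have h3 : vnorm v * vnorm (B *ᵥ u) ≤ β * (vnorm u * vnorm v) := by
    have := mul_le_mul_of_nonneg_left (hB u) (vnorm_nonneg v)
    linarith
  have h4 := pow_le_pow_left₀ (mul_nonneg (vnorm_nonneg v) (vnorm_nonneg _)) h3 2
  have h5 := mul_le_mul_of_nonneg_left h4 (sq_nonneg t)
  linarith

/-- A bilinear form stays large near a pair of vectors at which its norm is attained. -/
lemma OpLe.dotProduct_mulVec_ge_of_near {X : Matrix ι l ℝ} {k r : ℝ} (hk : 0 < k) (hX : OpLe X k)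
    {x u : l → ℝ} {v : ι → ℝ} (hxk : vnorm (X *ᵥ x) = k)
    (hr : 0 ≤ r) (hu : vnorm (u - x) ≤ r) (hv : vnorm (v - k⁻¹ • (X *ᵥ x)) ≤ r) :
    k * (1 - 2 * r - r ^ 2) ≤ v ⬝ᵥ (X *ᵥ u) := by
  set y := k⁻¹ • (X *ᵥ x) with hy
  have hy1 : vnorm y = 1 := by
    rw [hy, vnorm_smul, hxk, abs_of_pos (inv_pos.2 hk), inv_mul_cancel₀ hk.ne']
  have hyx : y ⬝ᵥ (X *ᵥ x) = k := by
    rw [hy, smul_dotProduct, ← vnorm_sq, hxk, smul_eq_mul]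
    field_simp
  have hXh : vnorm (X *ᵥ (u - x)) ≤ k * r := (hX _).trans (mul_le_mul_of_nonneg_left hu hk.le)
  have key : ∀ p : ι → ℝ, ∀ q : ι → ℝ, -(vnorm p * vnorm q) ≤ p ⬝ᵥ q := fun p q => by
    have := dotProduct_le (-p) q
    rw [neg_dotProduct, vnorm_neg] at this
    linarith
  have h1 : v ⬝ᵥ (X *ᵥ u) = y ⬝ᵥ (X *ᵥ x) + (v - y) ⬝ᵥ (X *ᵥ x) + y ⬝ᵥ (X *ᵥ (u - x)) +
      (v - y) ⬝ᵥ (X *ᵥ (u - x)) := by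
    simp only [mulVec_sub, dotProduct_sub, sub_dotProduct]
    ring
  have h2 := key (v - y) (X *ᵥ x)
  have h3 := key y (X *ᵥ (u - x))
  have h4 := key (v - y) (X *ᵥ (u - x))
  have h5 := mul_le_mul_of_nonneg_right hv hk.le
  have h6 := mul_le_mul hv hXh (vnorm_nonneg _) hr
  rw [hxk] at h2
  rw [hy1] at h3
  rw [h1, hyx]
  linarith

end Tail

section Tail

variable {ι κ l : Type*} [Fintype ι] [Fintype κ] [Fintype l]

instance : IsProbabilityMeasure (stdGaussian ι κ) := by
  unfold stdGaussian
  infer_instance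

lemma continuous_dotProduct_mul_mulVec (B : Matrix κ l ℝ) :
    Continuous fun p : (ι → κ → ℝ) × (l → ℝ) × (ι → ℝ) =>
      p.2.2 ⬝ᵥ ((Matrix.of p.1 * B) *ᵥ p.2.1) := by
  have h1 : (fun p : (ι → κ → ℝ) × (l → ℝ) × (ι → ℝ) =>
      p.2.2 ⬝ᵥ ((Matrix.of p.1 * B) *ᵥ p.2.1)) =
      fun p => ∑ i, ∑ j, p.2.2 i * (∑ k, B j k * p.2.1 k) * p.1 i j := by
    ext p
    rw [dotProduct_mul_mulVec]
    rfl
  rw [h1]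
  fun_prop

/-- Averages over balls of the exponentials of the bilinear form of a Gaussian matrix. -/
lemma lintegral_ball_exp_le {B : Matrix κ l ℝ} {β t : ℝ} (hβ : 0 ≤ β) (hB : OpLe B β) {ρ : ℝ}
    (hρ : 0 < ρ) :
    ∫⁻ V, (∫⁻ p in {u : l → ℝ | vnorm u ≤ ρ} ×ˢ {v : ι → ℝ | vnorm v ≤ ρ},
        ENNReal.ofReal (Real.exp (t * (p.2 ⬝ᵥ ((Matrix.of V * B) *ᵥ p.1))))) ∂stdGaussian ι κ ≤
      ENNReal.ofReal (Real.exp (t ^ 2 * (β * (ρ * ρ)) ^ 2 / 2)) *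
        (volume {u : l → ℝ | vnorm u ≤ ρ} * volume {v : ι → ℝ | vnorm v ≤ ρ}) := by
  have hmeas : Measurable fun q : (ι → κ → ℝ) × (l → ℝ) × (ι → ℝ) =>
      ENNReal.ofReal (Real.exp (t * (q.2.2 ⬝ᵥ ((Matrix.of q.1 * B) *ᵥ q.2.1)))) :=
    (Real.continuous_exp.comp
      (continuous_const.mul (continuous_dotProduct_mul_mulVec B))).measurable.ennreal_ofReal
  have hset : MeasurableSet ({u : l → ℝ | vnorm u ≤ ρ} ×ˢ {v : ι → ℝ | vnorm v ≤ ρ}) :=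
    (isCompact_vnorm_le ρ).measurableSet.prod (isCompact_vnorm_le ρ).measurableSet
  rw [lintegral_lintegral_swap hmeas.aemeasurable, ← Measure.prod_prod, ← Measure.volume_eq_prod,
    ← setLIntegral_const]
  refine setLIntegral_mono' hset fun p hp => ?_
  refine (lintegral_exp_dotProduct_le hB p.1 p.2).trans
    (ENNReal.ofReal_le_ofReal (Real.exp_le_exp.2 ?_))
  have h1 := mul_le_mul hp.1 hp.2 (vnorm_nonneg _) hρ.le
  have h2 := pow_le_pow_left₀ (mul_nonneg hβ (mul_nonneg (vnorm_nonneg _) (vnorm_nonneg _)))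
    (mul_le_mul_of_nonneg_left h1 hβ) 2
  have h3 := mul_le_mul_of_nonneg_left h2 (sq_nonneg t)
  linarith

lemma le_lintegral_ball_exp {X : Matrix ι l ℝ} {b t r : ℝ} (hX : ¬ OpLe X b) (hb : 0 ≤ b)
    (ht : 0 ≤ t) (hr : 0 < r) (hr1 : 0 ≤ 1 - 2 * r - r ^ 2) :
    ENNReal.ofReal (Real.exp (t * (b * (1 - 2 * r - r ^ 2)))) *
        (ENNReal.ofReal (r ^ Fintype.card l) * volume {u : l → ℝ | vnorm u ≤ 1} *
          (ENNReal.ofReal (r ^ Fintype.card ι) * volume {v : ι → ℝ | vnorm v ≤ 1})) ≤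
      ∫⁻ p in {u : l → ℝ | vnorm u ≤ 1 + r} ×ˢ {v : ι → ℝ | vnorm v ≤ 1 + r},
        ENNReal.ofReal (Real.exp (t * (p.2 ⬝ᵥ (X *ᵥ p.1)))) := by
  obtain ⟨u₀, hu₀⟩ : ∃ u, b * vnorm u < vnorm (X *ᵥ u) := by
    simpa [OpLe] using hX
  have : Nonempty l := by
    by_contra h
    rw [not_nonempty_iff] at h
    have : u₀ = 0 := Subsingleton.elim _ _
    simp [this, vnorm_zero] at hu₀
  obtain ⟨x, hx, hXx⟩ := exists_opLe_vnorm_mulVec X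
  have hbk : b < vnorm (X *ᵥ x) := by
    by_contra h
    exact hX (hXx.mono (not_lt.1 h))
  set k := vnorm (X *ᵥ x) with hk
  have hk0 : 0 < k := hb.trans_lt hbk
  have hy : vnorm (k⁻¹ • (X *ᵥ x)) = 1 := by
    rw [vnorm_smul, ← hk, abs_of_pos (inv_pos.2 hk0), inv_mul_cancel₀ hk0.ne']
  rw [← volume_vnorm_sub_le x hr, ← volume_vnorm_sub_le (k⁻¹ • (X *ᵥ x)) hr, ← Measure.prod_prod,
    ← Measure.volume_eq_prod, ← setLIntegral_const]
  refine (setLIntegral_mono' ?_ fun p hp => ?_).trans (lintegral_mono_set (Set.prod_mono ?_ ?_))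
  · exact (isClosed_le (continuous_vnorm.comp (continuous_id.sub continuous_const))
      continuous_const).measurableSet.prod
      (isClosed_le (continuous_vnorm.comp (continuous_id.sub continuous_const))
      continuous_const).measurableSet
  · refine ENNReal.ofReal_le_ofReal (Real.exp_le_exp.2 (mul_le_mul_of_nonneg_left ?_ ht))
    exact (mul_le_mul_of_nonneg_right hbk.le hr1).trans
      (hXx.dotProduct_mulVec_ge_of_near hk0 hk.symm hr.le hp.1 hp.2)
  · intro w hw
    have := vnorm_add_le x (w - x)
    rw [add_sub_cancel] at this
    exact this.trans (add_le_add hx.le hw)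
  · intro w hw
    have := vnorm_add_le (k⁻¹ • (X *ᵥ x)) (w - k⁻¹ • (X *ᵥ x))
    rw [add_sub_cancel] at this
    exact this.trans (add_le_add hy.le hw)

/-- Tail bound for the operator norm of the product of a Gaussian matrix with a fixed matrix. -/
lemma stdGaussian_not_opLe_mul_le {B : Matrix κ l ℝ} {β M : ℝ} (hβ : 0 < β) (hB : OpLe B β)
    (hM : 0 ≤ M) :
    stdGaussian ι κ {V | ¬ OpLe (Matrix.of V * B) (M * β)} ≤
      ENNReal.ofReal (8 ^ (Fintype.card ι + Fintype.card l) * Real.exp (-(M ^ 2 / 8))) := by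
  set t : ℝ := 2 * M / (5 * β) with ht
  have ht0 : 0 ≤ t := by positivity
  set v := volume {u : l → ℝ | vnorm u ≤ 1} * volume {v : ι → ℝ | vnorm v ≤ 1} with hv
  have hv0 : v ≠ 0 := mul_ne_zero volume_vnorm_le_one_ne_zero volume_vnorm_le_one_ne_zero
  have hvt : v ≠ ⊤ := ENNReal.mul_ne_top (isCompact_vnorm_le 1).measure_lt_top.ne
    (isCompact_vnorm_le 1).measure_lt_top.ne
  set F : (ι → κ → ℝ) → ENNReal := fun V =>
    ∫⁻ p in {u : l → ℝ | vnorm u ≤ 1 + 1 / 7} ×ˢ {v : ι → ℝ | vnorm v ≤ 1 + 1 / 7},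
        ENNReal.ofReal (Real.exp (t * (p.2 ⬝ᵥ ((Matrix.of V * B) *ᵥ p.1)))) with hF
  set e : ENNReal := ENNReal.ofReal (Real.exp (t * (M * β * (1 - 2 * (1 / 7) - (1 / 7) ^ 2))) *
    (1 / 7) ^ (Fintype.card ι + Fintype.card l)) * v with he
  have hsub : {V | ¬ OpLe (Matrix.of V * B) (M * β)} ⊆ {V | e ≤ F V} := fun V hV => by
    refine le_trans (le_of_eq ?_) (le_lintegral_ball_exp (t := t) (r := 1 / 7) hV (by positivity)
      ht0 (by norm_num) (by norm_num))
    rw [he, hv, ENNReal.ofReal_mul (by positivity), pow_add, ENNReal.ofReal_mul (by positivity)]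
    ring
  have hFm : Measurable F := by
    have h1 : Measurable fun q : (ι → κ → ℝ) × (l → ℝ) × (ι → ℝ) =>
        ENNReal.ofReal (Real.exp (t * (q.2.2 ⬝ᵥ ((Matrix.of q.1 * B) *ᵥ q.2.1)))) :=
      (Real.continuous_exp.comp
        (continuous_const.mul (continuous_dotProduct_mul_mulVec B))).measurable.ennreal_ofReal
    exact h1.lintegral_prod_right'
  have hup : ∫⁻ V, F V ∂stdGaussian ι κ ≤
      ENNReal.ofReal (Real.exp (t ^ 2 * (β * ((1 + 1 / 7) * (1 + 1 / 7))) ^ 2 / 2) *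
        (1 + 1 / 7) ^ (Fintype.card ι + Fintype.card l)) * v := by
    refine (lintegral_ball_exp_le hβ.le hB (by norm_num)).trans (le_of_eq ?_)
    have h1 := volume_vnorm_sub_le (0 : l → ℝ) (r := 1 + 1 / 7) (by norm_num)
    have h2 := volume_vnorm_sub_le (0 : ι → ℝ) (r := 1 + 1 / 7) (by norm_num)
    simp only [sub_zero] at h1 h2
    rw [h1, h2, hv, ENNReal.ofReal_mul (by positivity), pow_add, ENNReal.ofReal_mul (by positivity)]
    ring
  have hmk := (mul_meas_ge_le_lintegral₀ (μ := stdGaussian ι κ) hFm.aemeasurable e).trans hup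
  have h3 : ENNReal.ofReal (Real.exp (t ^ 2 * (β * ((1 + 1 / 7) * (1 + 1 / 7))) ^ 2 / 2) *
      (1 + 1 / 7) ^ (Fintype.card ι + Fintype.card l)) * v ≤
      e * ENNReal.ofReal (8 ^ (Fintype.card ι + Fintype.card l) * Real.exp (-(M ^ 2 / 8))) := by
    rw [he, mul_right_comm, ← ENNReal.ofReal_mul (by positivity)]
    refine mul_le_mul_left (ENNReal.ofReal_le_ofReal ?_) _
    have h4 : (1 / 7 : ℝ) ^ (Fintype.card ι + Fintype.card l) *
        8 ^ (Fintype.card ι + Fintype.card l) = (1 + 1 / 7) ^ (Fintype.card ι + Fintype.card l) := by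
      rw [← mul_pow]
      norm_num
    have h5 : t * β = 2 * M / 5 := by
      rw [ht]
      field_simp
    have h6 : t ^ 2 * (β * ((1 + 1 / 7) * (1 + 1 / 7))) ^ 2 / 2 ≤
        t * (M * β * (1 - 2 * (1 / 7) - (1 / 7) ^ 2)) + -(M ^ 2 / 8) := by
      have h7 : t ^ 2 * (β * ((1 + 1 / 7) * (1 + 1 / 7))) ^ 2 / 2 =
          (t * β) ^ 2 * ((1 + 1 / 7) * (1 + 1 / 7)) ^ 2 / 2 := by ring
      have h8 : t * (M * β * (1 - 2 * (1 / 7) - (1 / 7) ^ 2)) =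
          (t * β) * M * (1 - 2 * (1 / 7) - (1 / 7) ^ 2) := by ring
      rw [h7, h8, h5]
      have := sq_nonneg M
      linarith
    have h9 := mul_le_mul_of_nonneg_right (Real.exp_le_exp.2 h6)
      (show (0 : ℝ) ≤ (1 + 1 / 7) ^ (Fintype.card ι + Fintype.card l) by positivity)
    refine h9.trans (le_of_eq ?_)
    rw [← h4, Real.exp_add]
    ring
  have he0 : e ≠ 0 := mul_ne_zero (ENNReal.ofReal_pos.2 (by positivity)).ne' hv0
  have het : e ≠ ⊤ := ENNReal.mul_ne_top ENNReal.ofReal_ne_top hvt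
  exact (measure_mono hsub).trans ((ENNReal.mul_le_mul_iff_right he0 het).1 (hmk.trans h3))

end Tail

/-! ### The leave-one-out event -/

section LeaveOneOutEvent

variable {n d m : ℕ}

lemma isClosed_setOf_opLe {E α β : Type*} [TopologicalSpace E] [Fintype α] [Fintype β]
    {f : E → Matrix α β ℝ} (hf : Continuous f) (b : ℝ) : IsClosed {x | OpLe (f x) b} := by
  simp only [OpLe, Set.ofPred_forall]
  exact isClosed_iInter fun u =>
    isClosed_le (continuous_vnorm.comp (hf.matrix_mulVec continuous_const)) continuous_const

lemma isClosed_setOf_isPolarBlocks {E : Type*} [TopologicalSpace E]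
    {f g : E → Matrix (Fin n × Fin d) (Fin d) ℝ} (hf : Continuous f) (hg : Continuous g) :
    IsClosed {x | IsPolarBlocks (f x) (g x)} := by
  have hblk : ∀ {f : E → Matrix (Fin n × Fin d) (Fin d) ℝ}, Continuous f → ∀ i,
      Continuous fun x => blk (f x) i := fun hf i =>
    continuous_matrix fun a b => hf.matrix_elem (i, a) b
  simp only [IsPolarBlocks, IsPolar, Set.ofPred_forall, Set.ofPred_and]
  refine isClosed_iInter fun i => IsClosed.inter ?_
    (isClosed_iInter fun Q => isClosed_iInter fun _ => ?_)
  · exact (isCompact_orth d).isClosed.preimage (hblk hg i)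
  · exact isClosed_le (continuous_frob.comp ((hblk hf i).sub (hblk hg i)))
      (continuous_frob.comp ((hblk hf i).sub continuous_const))

lemma isClosed_setOf_isTopSingVecs {E N : Type*} [TopologicalSpace E] [Fintype N]
    {f : E → Matrix N (Fin m) ℝ} {g : E → Matrix N (Fin d) ℝ} (hf : Continuous f)
    (hg : Continuous g) : IsClosed {x | IsTopSingVecs (f x) (g x)} := by
  simp only [IsTopSingVecs, Set.ofPred_forall, Set.ofPred_and]
  refine IsClosed.inter (isClosed_eq (hg.matrix_transpose.matrix_mul hg) continuous_const)
    (isClosed_iInter fun Q => isClosed_iInter fun _ => isClosed_le ?_ ?_)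
  · exact ((continuous_const.matrix_mul (hf.matrix_mul hf.matrix_transpose)).matrix_mul
      continuous_const).matrix_trace
  · exact ((hg.matrix_transpose.matrix_mul (hf.matrix_mul hf.matrix_transpose)).matrix_mul
      hg).matrix_trace

lemma continuous_mask (j : Fin n) :
    Continuous fun X : Matrix (Fin n × Fin d) (Fin m) ℝ => mask X j :=
  continuous_matrix fun p b => by
    by_cases h : p.1 = j
    · simpa [mask, h] using continuous_const
    · simpa [mask, h] using continuous_id.matrix_elem p b

/-- The noise matrices for which given data certify the leave-one-out event form a closed set. -/
lemma isClosed_setOf_leaveOneOut_data {E : Type*} [TopologicalSpace E]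
    {D B : E → Matrix (Fin n × Fin d) (Fin m) ℝ} {U : E → Matrix (Fin n × Fin d) (Fin d) ℝ}
    {S : ℕ → E → Matrix (Fin n × Fin d) (Fin d) ℝ} (hD : Continuous D) (hB : Continuous B)
    (hU : Continuous U) (hS : ∀ t, Continuous (S t)) (b : ℝ) (j : Fin n) :
    IsClosed {x | IsTopSingVecs (D x) (U x) ∧ IsPolarBlocks (U x) (S 0 x) ∧
      (∀ t, IsPolarBlocks (D x * (D x)ᵀ * S t x) (S (t + 1) x)) ∧
      OpLe (blk (B x) j * ((D x)ᵀ * (Real.sqrt n • U x))) b ∧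
      ∀ t ≤ n, OpLe (blk (B x) j * ((D x)ᵀ * S t x)) b} := by
  have hb : Continuous fun x => blk (B x) j :=
    continuous_matrix fun a c => hB.matrix_elem (j, a) c
  have hU' : Continuous fun x => Real.sqrt n • U x := continuous_matrix fun p c =>
    continuous_const.mul (hU.matrix_elem p c)
  have h2 : IsClosed {x | IsPolarBlocks (U x) (S 0 x)} := isClosed_setOf_isPolarBlocks hU (hS 0)
  have h3 : IsClosed {x | ∀ t, IsPolarBlocks (D x * (D x)ᵀ * S t x) (S (t + 1) x)} := by
    rw [Set.ofPred_forall]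
    exact isClosed_iInter fun t => isClosed_setOf_isPolarBlocks
      ((hD.matrix_mul hD.matrix_transpose).matrix_mul (hS t)) (hS (t + 1))
  have h4 : IsClosed {x | OpLe (blk (B x) j * ((D x)ᵀ * (Real.sqrt n • U x))) b} :=
    isClosed_setOf_opLe (hb.matrix_mul (hD.matrix_transpose.matrix_mul hU')) b
  have h5 : IsClosed {x | ∀ t ≤ n, OpLe (blk (B x) j * ((D x)ᵀ * S t x)) b} := by
    simp only [Set.ofPred_forall]
    exact isClosed_iInter fun t => isClosed_iInter fun _ =>
      isClosed_setOf_opLe (hb.matrix_mul (hD.matrix_transpose.matrix_mul (hS t))) b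
  rw [Set.ofPred_and, Set.ofPred_and, Set.ofPred_and, Set.ofPred_and]
  exact (isClosed_setOf_isTopSingVecs hD hU).inter (h2.inter (h3.inter (h4.inter h5)))

lemma isClosed_setOf_leaveOneOut (A : Matrix (Fin d) (Fin m) ℝ) (b : ℝ) (j : Fin n) :
    IsClosed {N : Matrix (Fin n × Fin d) (Fin m) ℝ | LeaveOneOut A N b j} := by
  set K : Set (Matrix (Fin n × Fin d) (Fin d) ℝ × (ℕ → Matrix (Fin n × Fin d) (Fin d) ℝ)) :=
    {U | Uᵀ * U = 1} ×ˢ Set.univ.pi fun _ => {S | OrthBlocks S} with hK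
  have hKc : IsCompact K := (isCompact_stiefel (Fin n × Fin d) (Fin d)).prod
    (isCompact_univ_pi fun _ => isCompact_orthBlocks n d)
  have : CompactSpace K := isCompact_iff_compactSpace.1 hKc
  have hfst : Continuous fun q : Matrix (Fin n × Fin d) (Fin m) ℝ × K => q.1 := continuous_fst
  have hU : Continuous fun q : Matrix (Fin n × Fin d) (Fin m) ℝ × K => q.2.1.1 :=
    continuous_fst.comp (continuous_subtype_val.comp continuous_snd)
  have hS : ∀ t, Continuous fun q : Matrix (Fin n × Fin d) (Fin m) ℝ × K => q.2.1.2 t := fun t =>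
    (continuous_apply t).comp (continuous_snd.comp (continuous_subtype_val.comp continuous_snd))
  have hD : Continuous fun q : Matrix (Fin n × Fin d) (Fin m) ℝ × K =>
      ZStack n d * A + mask q.1 j := continuous_const.add ((continuous_mask j).comp hfst)
  have hT := isClosedMap_fst_of_compactSpace _
    (isClosed_setOf_leaveOneOut_data hD hfst hU hS b j)
  convert hT using 1
  ext N
  constructor
  · rintro ⟨U, S, h1, h2, h3, h4⟩
    refine ⟨(N, ⟨(U, S), h1.1, fun t _ => ?_⟩), ⟨h1, h2, h3, h4⟩, rfl⟩
    cases t with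
    | zero => exact h2.orthBlocks
    | succ t => exact (h3 t).orthBlocks
  · rintro ⟨⟨N', q⟩, h, rfl⟩
    exact ⟨q.1.1, q.1.2, h⟩

lemma exists_isTopSingVecs (hn : 1 ≤ n) (D : Matrix (Fin n × Fin d) (Fin m) ℝ) :
    ∃ U : Matrix (Fin n × Fin d) (Fin d) ℝ, IsTopSingVecs D U := by
  have hne : {U : Matrix (Fin n × Fin d) (Fin d) ℝ | Uᵀ * U = 1}.Nonempty := by
    refine ⟨(Real.sqrt n)⁻¹ • ZStack n d, ?_⟩
    have h1 : (0 : ℝ) < n := by exact_mod_cast hn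
    have h2 : (Real.sqrt n)⁻¹ * (Real.sqrt n)⁻¹ * (n : ℝ) = 1 := by
      have := Real.mul_self_sqrt h1.le
      have := Real.sqrt_pos.2 h1
      field_simp
      linarith
    rw [Set.mem_ofPred_eq, transpose_smul, Matrix.smul_mul, Matrix.mul_smul,
      ZStack_transpose_mul_self, smul_smul, smul_smul, h2, one_smul]
  have hc : Continuous fun Q : Matrix (Fin n × Fin d) (Fin d) ℝ =>
      trace (Qᵀ * (D * Dᵀ) * Q) :=
    ((continuous_id.matrix_transpose.matrix_mul continuous_const).matrix_mul
      continuous_id).matrix_trace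
  obtain ⟨U, hU, hmax⟩ := (isCompact_stiefel (Fin n × Fin d) (Fin d)).exists_isMaxOn hne
    hc.continuousOn
  exact ⟨U, hU, fun Q hQ => hmax hQ⟩

lemma exists_isGPM (hn : 1 ≤ n) (D : Matrix (Fin n × Fin d) (Fin m) ℝ) :
    ∃ (U : Matrix (Fin n × Fin d) (Fin d) ℝ) (S : ℕ → Matrix (Fin n × Fin d) (Fin d) ℝ),
      IsTopSingVecs D U ∧ IsPolarBlocks U (S 0) ∧
        ∀ t, IsPolarBlocks (D * Dᵀ * S t) (S (t + 1)) := by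
  obtain ⟨U, hU⟩ := exists_isTopSingVecs hn D
  choose P hP using exists_isPolarBlocks (n := n) (d := d)
  exact ⟨U, fun t => Nat.rec (P U) (fun _ S => P (D * Dᵀ * S)) t, hU, hP U, fun t => hP _⟩

end LeaveOneOutEvent

/-! ### Probability of the leave-one-out event -/

section LeaveOneOutProbability

lemma stdGaussian_le_of_slices {ι κ : Type*} [Fintype ι] [Fintype κ] (p : ι → Prop)
    [DecidablePred p] {s : Set (ι → κ → ℝ)} (hs : MeasurableSet s) {ε : ENNReal}
    (h : ∀ y : {i // ¬ p i} → κ → ℝ, stdGaussian {i // p i} κ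
      {x | (MeasurableEquiv.piEquivPiSubtypeProd (fun _ => κ → ℝ) p).symm (x, y) ∈ s} ≤ ε) :
    stdGaussian ι κ s ≤ ε := by
  have hmp := (measurePreserving_piEquivPiSubtypeProd
    (fun _ : ι => Measure.pi fun _ : κ => ProbabilityTheory.gaussianReal 0 1) p).symm
  have hs' := (MeasurableEquiv.piEquivPiSubtypeProd (fun _ : ι => κ → ℝ) p).symm.measurable hs
  rw [stdGaussian, ← hmp.measure_preimage_equiv s, Measure.prod_apply_symm hs']
  calc _ ≤ ∫⁻ _, ε ∂(stdGaussian {i // ¬ p i} κ) := lintegral_mono fun y => h y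
    _ = ε := by simp

lemma vnorm_comp_equiv {α β : Type*} [Fintype α] [Fintype β] (e : α ≃ β) (v : β → ℝ) :
    vnorm (v ∘ e) = vnorm v := by
  simp only [vnorm, Function.comp_apply]
  rw [e.sum_comp fun i => v i ^ 2]

lemma OpLe.of_submatrix {α β l : Type*} [Fintype α] [Fintype β] [Fintype l] (e : α ≃ β)
    {X : Matrix β l ℝ} {b : ℝ} (h : OpLe X b) : OpLe (X.submatrix e id) b := fun u => by
  rw [← show (X *ᵥ u) ∘ e = X.submatrix e id *ᵥ u from rfl, vnorm_comp_equiv]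
  exact h u

variable {n d m : ℕ}

lemma LeaveOneOut.mono {A : Matrix (Fin d) (Fin m) ℝ} {N : Matrix (Fin n × Fin d) (Fin m) ℝ}
    {b c : ℝ} {j : Fin n} (h : LeaveOneOut A N b j) (hbc : b ≤ c) : LeaveOneOut A N c j := by
  obtain ⟨U, S, h1, h2, h3, h4, h5⟩ := h
  exact ⟨U, S, h1, h2, h3, h4.mono hbc, fun t ht => (h5 t ht).mono hbc⟩

/-- The indices of the `j`-th block. -/
def blockEquiv (j : Fin n) : Fin d ≃ {q : Fin n × Fin d // q.1 = j} where
  toFun a := ⟨(j, a), rfl⟩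
  invFun q := q.1.2
  left_inv _ := rfl
  right_inv := by rintro ⟨⟨i, a⟩, rfl⟩; rfl

lemma stdGaussian_not_leaveOneOut_le (hn : 1 ≤ n) (A : Matrix (Fin d) (Fin m) ℝ) {σ β M : ℝ}
    (hσ : 0 < σ) (hβ : 0 < β) (hM : 0 ≤ M) (j : Fin n) :
    stdGaussian (Fin n × Fin d) (Fin m) {W | OpLe (ZStack n d * A + mask (σ • Matrix.of W) j) β ∧
      ¬ LeaveOneOut A (σ • Matrix.of W) (σ * (M * (β * Real.sqrt n))) j} ≤
      (n + 2) * ENNReal.ofReal (8 ^ (d + d) * Real.exp (-(M ^ 2 / 8))) := by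
  have hcont : Continuous fun W : Fin n × Fin d → Fin m → ℝ => σ • Matrix.of W :=
    continuous_matrix fun p b => continuous_const.mul
      ((continuous_apply b).comp (continuous_apply p))
  refine stdGaussian_le_of_slices (fun q => q.1 = j) (by
    rw [Set.ofPred_and]
    exact (isClosed_setOf_opLe
      (continuous_const.add ((continuous_mask j).comp hcont)) β).measurableSet.inter
      ((isClosed_setOf_leaveOneOut A _ j).preimage hcont).measurableSet.compl) fun y => ?_
  set e := MeasurableEquiv.piEquivPiSubtypeProd (fun _ : Fin n × Fin d => Fin m → ℝ)
    (fun q => q.1 = j) with he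
  have hmask : ∀ x, mask (σ • Matrix.of (e.symm (x, y))) j =
      mask (σ • Matrix.of (e.symm (0, y))) j := fun x => by
    ext q b
    by_cases hq : q.1 = j
    · simp [mask, hq]
    · simp [mask, hq, he, MeasurableEquiv.piEquivPiSubtypeProd, Equiv.piEquivPiSubtypeProd]
  have hblk : ∀ x, blk (Matrix.of (e.symm (x, y))) j =
      (Matrix.of x).submatrix (blockEquiv j) id := fun x => by
    ext a b
    simp [blk, blockEquiv, he, MeasurableEquiv.piEquivPiSubtypeProd, Equiv.piEquivPiSubtypeProd]
  set D := ZStack n d * A + mask (σ • Matrix.of (e.symm (0, y))) j with hD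
  by_cases hDop : OpLe D β
  swap
  · refine le_trans (measure_mono_null (fun x hx => hDop ?_) measure_empty).le zero_le
    have : OpLe (ZStack n d * A + mask (σ • Matrix.of (e.symm (x, y))) j) β := hx.1
    rwa [hmask] at this
  obtain ⟨U, S, hU, hS0, hS⟩ := exists_isGPM hn D
  have hb : 0 < β * Real.sqrt n :=
    mul_pos hβ (Real.sqrt_pos.2 (by exact_mod_cast hn))
  have hprob : ∀ B : Matrix (Fin m) (Fin d) ℝ, OpLe B (β * Real.sqrt n) →
      stdGaussian {q : Fin n × Fin d // q.1 = j} (Fin m)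
        {x | ¬ OpLe (Matrix.of x * B) (M * (β * Real.sqrt n))} ≤
        ENNReal.ofReal (8 ^ (d + d) * Real.exp (-(M ^ 2 / 8))) := fun B hB => by
    have := stdGaussian_not_opLe_mul_le (ι := {q : Fin n × Fin d // q.1 = j}) hb hB hM
    rwa [Fintype.card_fin, ← Fintype.card_congr (blockEquiv (d := d) j), Fintype.card_fin] at this
  have hop : ∀ x (B : Matrix (Fin m) (Fin d) ℝ), OpLe (Matrix.of x * B) (M * (β * Real.sqrt n)) →
      OpLe (blk (σ • Matrix.of (e.symm (x, y))) j * B) (σ * (M * (β * Real.sqrt n))) := by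
    intro x B hx
    rw [blk_smul, hblk, Matrix.smul_mul]
    have := (hx.of_submatrix (blockEquiv j)).smul σ
    rwa [abs_of_pos hσ] at this
  have hsub : {x | e.symm (x, y) ∈ {W | OpLe (ZStack n d * A + mask (σ • Matrix.of W) j) β ∧
      ¬ LeaveOneOut A (σ • Matrix.of W) (σ * (M * (β * Real.sqrt n))) j}} ⊆
      {x | ¬ OpLe (Matrix.of x * (Dᵀ * (Real.sqrt n • U))) (M * (β * Real.sqrt n))} ∪
        ⋃ t ∈ Finset.range (n + 1),
          {x | ¬ OpLe (Matrix.of x * (Dᵀ * S t)) (M * (β * Real.sqrt n))} := by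
    rintro x ⟨-, hx⟩
    by_contra hcon
    simp only [Set.mem_union, Set.mem_ofPred_eq, Set.mem_iUnion, not_or, not_not,
      not_exists] at hcon
    refine hx ⟨U, S, ?_⟩
    rw [hmask, ← hD]
    exact ⟨hU, hS0, hS, hop x _ hcon.1,
      fun t ht => hop x _ (hcon.2 t (Finset.mem_range.2 (Nat.lt_succ_of_le ht)))⟩
  refine (measure_mono hsub).trans ((measure_union_le _ _).trans ?_)
  have hDt := hDop.transpose hβ.le
  have h1 := hprob (Dᵀ * (Real.sqrt n • U)) (hDt.mul hβ.le (by
    have := (opLe_of_transpose_mul_self (r := 1) zero_le_one (by rw [hU.1, one_smul])).smul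
      (Real.sqrt n)
    rwa [Real.sqrt_one, mul_one, abs_of_nonneg (Real.sqrt_nonneg _)] at this))
  have h2 : ∀ t ∈ Finset.range (n + 1), _ := fun t _ => hprob (Dᵀ * S t) (hDt.mul hβ.le
    (opLe_of_transpose_mul_self n.cast_nonneg (by
      cases t with
      | zero => exact hS0.orthBlocks.transpose_mul_self
      | succ t => exact (hS t).orthBlocks.transpose_mul_self)))
  refine (add_le_add h1 ((measure_biUnion_finset_le _ _).trans (Finset.sum_le_sum h2))).trans ?_
  rw [Finset.sum_const, Finset.card_range, nsmul_eq_mul]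
  push_cast
  ring_nf
  rfl

end LeaveOneOutProbability

/-! ### Linear convergence with high probability -/

section HighProbability

lemma opLe_opNorm {α β : Type*} [Fintype α] [Fintype β] [Nonempty β] (X : Matrix α β ℝ) :
    OpLe X (opNorm X) := by
  obtain ⟨x, hx, hX⟩ := exists_opLe_vnorm_mulVec X
  have : IsGreatest {r : ℝ | ∃ u : β → ℝ, vnorm u = 1 ∧ r = vnorm (X.mulVec u)}
      (vnorm (X *ᵥ x)) := by
    refine ⟨⟨x, hx, rfl⟩, ?_⟩
    rintro r ⟨u, hu, rfl⟩
    have := hX u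
    rwa [hu, mul_one] at this
  rwa [opNorm, this.csSup_eq]

lemma lowLe_sigmaMin {α β : Type*} [Fintype α] [Fintype β] (X : Matrix α β ℝ) :
    LowLe X (sigmaMin X) := fun y => by
  by_cases hy : y = 0
  · simp [hy, vnorm_zero]
  have hpos : 0 < vnorm y := (vnorm_nonneg y).lt_of_ne fun h => hy (vnorm_eq_zero.1 h.symm)
  have hle : sigmaMin X ≤ vnorm (((vnorm y)⁻¹ • y) ᵥ* X) := by
    refine csInf_le ⟨0, ?_⟩ ⟨_, vnorm_normalize hy, rfl⟩
    rintro r ⟨u, -, rfl⟩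
    exact vnorm_nonneg _
  rw [← mulVec_transpose, mulVec_smul, vnorm_smul, abs_of_pos (inv_pos.2 hpos)] at hle
  rwa [← le_div_iff₀ hpos, div_eq_inv_mul]

variable {n d m : ℕ}

lemma sigmaMin_le_opNorm (hd : 1 ≤ d) [Nonempty (Fin m)] (A : Matrix (Fin d) (Fin m) ℝ) :
    sigmaMin A ≤ opNorm A := by
  have ha := opLe_opNorm A
  have h0 : 0 ≤ opNorm A := by
    refine Real.sSup_nonneg ?_
    rintro r ⟨u, -, rfl⟩
    exact vnorm_nonneg _
  have hne : (fun _ : Fin d => (1 : ℝ)) ≠ 0 := fun h => by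
    simpa using congrFun h ⟨0, hd⟩
  have hu := vnorm_normalize hne
  have h1 := lowLe_sigmaMin A ((vnorm fun _ : Fin d => (1 : ℝ))⁻¹ • fun _ => 1)
  have h2 := ha.transpose h0 ((vnorm fun _ : Fin d => (1 : ℝ))⁻¹ • fun _ => 1)
  rw [hu, mul_one] at h1 h2
  exact h1.trans h2

lemma eight_pow_mul_exp_le {k : ℕ} {x t : ℝ} (h : 3 * k + t ≤ x) :
    8 ^ k * Real.exp (-x) ≤ Real.exp (-t) := by
  have h8 : (8 : ℝ) ≤ Real.exp 3 := by
    have h2 : (2 : ℝ) ≤ Real.exp 1 := by linarith [Real.exp_one_gt_d9]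
    calc (8 : ℝ) = 2 ^ 3 := by norm_num
      _ ≤ Real.exp 1 ^ 3 := by gcongr
      _ = Real.exp 3 := by rw [← Real.exp_nat_mul]; norm_num
  calc (8 : ℝ) ^ k * Real.exp (-x) ≤ Real.exp 3 ^ k * Real.exp (-x) := by gcongr
    _ = Real.exp (k * 3 - x) := by rw [← Real.exp_nat_mul, ← Real.exp_add, sub_eq_add_neg]
    _ ≤ Real.exp (-t) := Real.exp_le_exp.2 (by linarith)

lemma regime_of_noise_le (hn : 1 ≤ n) (hd : 1 ≤ d) (hdm : d ≤ m)
    {A : Matrix (Fin d) (Fin m) ℝ} (hA : 0 < sigmaMin A) {N : Matrix (Fin n × Fin d) (Fin m) ℝ}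
    (hN : OpLe N (sigmaMin A / (10000 * kappa A ^ 4 * Real.sqrt d) * Real.sqrt n)) :
    Regime A N (opNorm A) (sigmaMin A)
      (sigmaMin A / (10000 * kappa A ^ 4 * Real.sqrt d)) := by
  have : Nonempty (Fin m) := ⟨⟨0, by omega⟩⟩
  have hle := sigmaMin_le_opNorm hd A
  have ha : 0 < opNorm A := hA.trans_le hle
  have hsd : 0 < Real.sqrt d := Real.sqrt_pos.2 (by exact_mod_cast hd)
  refine ⟨hn, hd, hA, hle, opLe_opNorm A, lowLe_sigmaMin A, ?_, ?_, hN⟩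
  · rw [kappa]; positivity
  · rw [kappa]
    refine le_of_eq ?_
    field_simp

/-- On these two events the power iterations converge linearly. -/
lemma linear_convergence_of_events (hn : 1 ≤ n) (hd : 1 ≤ d) (hdm : d ≤ m)
    {A : Matrix (Fin d) (Fin m) ℝ} (hA : 0 < sigmaMin A) {N : Matrix (Fin n × Fin d) (Fin m) ℝ}
    (hN : OpLe N (sigmaMin A / (10000 * kappa A ^ 4 * Real.sqrt d) * Real.sqrt n)) {q : ℝ}
    (hq : q ≤ sigmaMin A / (10000 * kappa A ^ 4 * Real.sqrt d))
    (hloo : ∀ j, OpLe (ZStack n d * A + mask N j) (11 / 10 * opNorm A * Real.sqrt n) →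
      LeaveOneOut A N (q * (11 / 10 * opNorm A * Real.sqrt n * Real.sqrt n)) j)
    {S : ℕ → Matrix (Fin n × Fin d) (Fin d) ℝ} (hS : IsGPM (ZStack n d * A + N) S) :
    ∃ Sinf, OrthBlocks Sinf ∧
      (∀ t : ℕ, dF (S t) Sinf ≤ (1 / 2 : ℝ) ^ t * dF (S 0) Sinf) ∧
      Tendsto (fun t => dF (S t) Sinf) atTop (nhds 0) ∧
      ∀ Sinf', OrthBlocks Sinf' →
        Tendsto (fun t => dF (S t) Sinf') atTop (nhds 0) → dF Sinf Sinf' = 0 := by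
  have h := regime_of_noise_le hn hd hdm hA hN
  refine h.linear_convergence (fun j => (hloo j (h.mask j).opLe_data).mono ?_) hS
  have ha := h.a_pos
  have hn' := h.n_pos
  rw [mul_assoc _ (Real.sqrt n), Real.mul_self_sqrt hn'.le]
  have h1 : 0 ≤ opNorm A * n := by positivity
  have h2 := mul_le_mul_of_nonneg_right hq h1
  have h3 := mul_nonneg h.w_nonneg h1
  linarith

lemma sqrt_mul_add_le_bnd1 (n d m : ℕ) {γ : ℝ} :
    Real.sqrt n * (Real.sqrt d + Real.sqrt (2 * γ * Real.log n)) ≤ bnd1 n d m γ := by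
  rw [bnd1, mul_add, ← Real.sqrt_mul n.cast_nonneg, ← Real.sqrt_mul n.cast_nonneg,
    show (n : ℝ) * (2 * γ * Real.log n) = 2 * γ * n * Real.log n by ring]
  linarith [Real.sqrt_nonneg (m : ℝ)]

lemma le_bnd1_sq (n d m : ℕ) {γ : ℝ} (hγ : 0 ≤ γ) :
    (n : ℝ) * d + m + 2 * γ * n * Real.log n ≤ bnd1 n d m γ ^ 2 := by
  have hl := Real.log_natCast_nonneg n
  have h1 := Real.sq_sqrt (show 0 ≤ (n : ℝ) * d by positivity)
  have h2 := Real.sq_sqrt (show 0 ≤ (m : ℝ) by positivity)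
  have h3 := Real.sq_sqrt (show 0 ≤ 2 * γ * n * Real.log n by positivity)
  rw [bnd1]
  have h4 := mul_nonneg (Real.sqrt_nonneg ((n : ℝ) * d)) (Real.sqrt_nonneg (m : ℝ))
  have h5 := mul_nonneg (Real.sqrt_nonneg ((n : ℝ) * d))
    (Real.sqrt_nonneg (2 * γ * n * Real.log n))
  have h6 := mul_nonneg (Real.sqrt_nonneg (m : ℝ)) (Real.sqrt_nonneg (2 * γ * n * Real.log n))
  linarith

lemma stdGaussian_not_opLe_bnd1_le (hn : 1 ≤ n) (d m : ℕ) {γ : ℝ} (hγ : 0 ≤ γ) :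
    stdGaussian (Fin n × Fin d) (Fin m) {W | ¬ OpLe (Matrix.of W) (8 * bnd1 n d m γ)} ≤
      ENNReal.ofReal (Real.exp (-(γ * Real.log n))) := by
  have hb : 0 ≤ bnd1 n d m γ := by rw [bnd1]; positivity
  have h := stdGaussian_not_opLe_mul_le (ι := Fin n × Fin d) one_pos (opLe_one (α := Fin m))
    (show 0 ≤ 8 * bnd1 n d m γ by positivity)
  simp only [Matrix.mul_one, mul_one] at h
  refine h.trans (ENNReal.ofReal_le_ofReal (eight_pow_mul_exp_le ?_))
  have h1 := le_bnd1_sq n d m hγ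
  have hn' : (1 : ℝ) ≤ n := by exact_mod_cast hn
  have h2 := mul_le_mul_of_nonneg_left hn' (mul_nonneg hγ (Real.log_natCast_nonneg n))
  have h3 := mul_nonneg hγ (Real.log_natCast_nonneg n)
  have h4 : (0 : ℝ) ≤ n * d + m := by positivity
  simp only [Fintype.card_prod, Fintype.card_fin]
  push_cast
  linarith

lemma stdGaussian_iUnion_not_leaveOneOut_le (hn : 1 ≤ n) (A : Matrix (Fin d) (Fin m) ℝ)
    {σ β γ : ℝ} (hσ : 0 < σ) (hβ : 0 < β) (hγ : 0 ≤ γ) :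
    stdGaussian (Fin n × Fin d) (Fin m) (⋃ j, {W |
      OpLe (ZStack n d * A + mask (σ • Matrix.of W) j) β ∧
      ¬ LeaveOneOut A (σ • Matrix.of W)
        (σ * (8 * (Real.sqrt d + Real.sqrt (2 * γ * Real.log n)) * (β * Real.sqrt n))) j}) ≤
      n * ((n + 2) * ENNReal.ofReal (Real.exp (-(γ * Real.log n)))) := by
  have hl := mul_nonneg hγ (Real.log_natCast_nonneg n)
  have h1 : 8 ^ (d + d) *
      Real.exp (-((8 * (Real.sqrt d + Real.sqrt (2 * γ * Real.log n))) ^ 2 / 8)) ≤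
      Real.exp (-(γ * Real.log n)) := by
    refine eight_pow_mul_exp_le ?_
    have h2 := Real.sq_sqrt (show 0 ≤ (d : ℝ) by positivity)
    have h3 := Real.sq_sqrt (show 0 ≤ 2 * γ * Real.log n by linarith)
    have h4 := mul_nonneg (Real.sqrt_nonneg (d : ℝ)) (Real.sqrt_nonneg (2 * γ * Real.log n))
    have h5 : (0 : ℝ) ≤ d := d.cast_nonneg
    push_cast
    linarith
  calc _ ≤ ∑ _ : Fin n, (n + 2) * ENNReal.ofReal (Real.exp (-(γ * Real.log n))) := by
        refine (measure_iUnion_fintype_le _ _).trans (Finset.sum_le_sum fun j _ => ?_)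
        refine (stdGaussian_not_leaveOneOut_le hn A hσ hβ (by positivity) j).trans ?_
        gcongr
    _ = _ := by simp

end HighProbability

/-- Theorem 3.2, convergence part: with high probability the GPM sequence with
spectral initialization converges linearly (rate ρ = 1/2) to a unique limit S^∞ ∈ O(d)^{⊗n}. -/
theorem gpm_linear_convergence :
    ∃ c C : ℝ, 0 < c ∧ 0 < C ∧
      ∀ (n d m : ℕ), 1 ≤ n → 1 ≤ d → d ≤ m →
      ∀ A : Matrix (Fin d) (Fin m) ℝ, 0 < sigmaMin A →
      ∀ σ γ : ℝ, 0 < σ → 2 ≤ γ →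
      σ ≤ c * (sigmaMin A / kappa A ^ 4) * Real.sqrt (n : ℝ) /
        (Real.sqrt (d : ℝ) * bnd1 n d m γ) →
      ENNReal.ofReal (1 - C * (n : ℝ) ^ (-γ + 2)) ≤
        stdGaussian (Fin n × Fin d) (Fin m) {W |
          ∀ S : ℕ → Matrix (Fin n × Fin d) (Fin d) ℝ,
            IsGPM (ZStack n d * A + σ • Matrix.of W) S →
            ∃ Sinf, OrthBlocks Sinf ∧
              (∀ t : ℕ, dF (S t) Sinf ≤ (1 / 2 : ℝ) ^ t * dF (S 0) Sinf) ∧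
              Tendsto (fun t => dF (S t) Sinf) atTop (nhds 0) ∧
              ∀ Sinf', OrthBlocks Sinf' →
                Tendsto (fun t => dF (S t) Sinf') atTop (nhds 0) →
                dF Sinf Sinf' = 0} := by
  refine ⟨1 / 80000, 4, by norm_num, by norm_num, fun n d m hn hd hdm A hA σ γ hσ hγ hle => ?_⟩
  have : Nonempty (Fin m) := ⟨⟨0, by omega⟩⟩
  have : IsProbabilityMeasure (stdGaussian (Fin n × Fin d) (Fin m)) := inferInstance
  have hn0 : (1 : ℝ) ≤ n := by exact_mod_cast hn
  have hsn : 0 < Real.sqrt n := Real.sqrt_pos.2 (by linarith)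
  have hd0 : (1 : ℝ) ≤ d := by exact_mod_cast hd
  have hsd : 0 < Real.sqrt d := Real.sqrt_pos.2 (by linarith)
  have ha : 0 < opNorm A := hA.trans_le (sigmaMin_le_opNorm hd A)
  have hκ : 0 < kappa A := div_pos ha hA
  have hb : 0 < bnd1 n d m γ := by
    have : 0 < Real.sqrt ((n : ℝ) * d) := Real.sqrt_pos.2 (by positivity)
    rw [bnd1]; positivity
  set w := sigmaMin A / (10000 * kappa A ^ 4 * Real.sqrt d) with hw
  have hσw : σ * (8 * bnd1 n d m γ) ≤ w * Real.sqrt n := by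
    calc _ ≤ 1 / 80000 * (sigmaMin A / kappa A ^ 4) * Real.sqrt n /
          (Real.sqrt d * bnd1 n d m γ) * (8 * bnd1 n d m γ) := by gcongr
      _ = w * Real.sqrt n := by
        rw [hw]; field_simp; norm_num
  set M := 8 * (Real.sqrt d + Real.sqrt (2 * γ * Real.log n)) with hM
  have hσM : σ * M ≤ w := by
    refine le_of_mul_le_mul_right (le_trans ?_ hσw) hsn
    rw [mul_assoc]
    have := sqrt_mul_add_le_bnd1 n d m (γ := γ)
    refine mul_le_mul_of_nonneg_left ?_ hσ.le
    rw [hM]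
    linarith
  set β := 11 / 10 * opNorm A * Real.sqrt n with hβ
  have hβ0 : 0 < β := by positivity
  set good : Set (Fin n × Fin d → Fin m → ℝ) := {W |
    ∀ S : ℕ → Matrix (Fin n × Fin d) (Fin d) ℝ, IsGPM (ZStack n d * A + σ • Matrix.of W) S →
      ∃ Sinf, OrthBlocks Sinf ∧
        (∀ t : ℕ, dF (S t) Sinf ≤ (1 / 2 : ℝ) ^ t * dF (S 0) Sinf) ∧
        Tendsto (fun t => dF (S t) Sinf) atTop (nhds 0) ∧
        ∀ Sinf', OrthBlocks Sinf' →
          Tendsto (fun t => dF (S t) Sinf') atTop (nhds 0) → dF Sinf Sinf' = 0}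
  set bad : Set (Fin n × Fin d → Fin m → ℝ) := ⋃ j, {W |
    OpLe (ZStack n d * A + mask (σ • Matrix.of W) j) β ∧
      ¬ LeaveOneOut A (σ • Matrix.of W) (σ * (M * (β * Real.sqrt n))) j} with hbad
  have hcover : Set.univ ⊆ good ∪ ({W | ¬ OpLe (Matrix.of W) (8 * bnd1 n d m γ)} ∪ bad) := by
    intro W _
    by_contra hW
    simp only [Set.mem_union, not_or, Set.mem_ofPred_eq, not_not] at hW
    obtain ⟨hgood, hop, hloo⟩ := hW
    refine hgood fun S hS => linear_convergence_of_events hn hd hdm hA ?_ hσM (fun j hj => ?_) hS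
    · have := hop.smul σ
      rw [abs_of_pos hσ] at this
      exact this.mono hσw
    · rw [mul_assoc σ M]
      by_contra hcon
      exact hloo (Set.mem_iUnion.2 ⟨j, hj, hcon⟩)
  set q := Real.exp (-(γ * Real.log n)) with hq
  have hq0 : 0 < q := Real.exp_pos _
  have hpow : (n : ℝ) ^ (-γ + 2) = q * n ^ 2 := by
    rw [Real.rpow_add (by linarith), Real.rpow_two, hq,
      Real.rpow_def_of_pos (by linarith)]
    ring_nf
  have hsmall : ENNReal.ofReal q + n * ((n + 2) * ENNReal.ofReal q) ≤
      ENNReal.ofReal (4 * (n : ℝ) ^ (-γ + 2)) := by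
    have hcast : ENNReal.ofReal q + n * ((n + 2) * ENNReal.ofReal q) =
        ENNReal.ofReal (q + n * ((n + 2) * q)) := by
      rw [ENNReal.ofReal_add hq0.le (by positivity), ENNReal.ofReal_mul (by positivity),
        ENNReal.ofReal_mul (by positivity), ENNReal.ofReal_add (by positivity) (by norm_num),
        ENNReal.ofReal_natCast, ENNReal.ofReal_ofNat]
    rw [hcast, hpow]
    refine ENNReal.ofReal_le_ofReal ?_
    have : q * (1 + n * (n + 2)) ≤ q * (4 * n ^ 2) := by gcongr; nlinarith
    linarith
  rw [ENNReal.ofReal_sub _ (by positivity), ENNReal.ofReal_one, tsub_le_iff_right]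
  calc (1 : ENNReal) = stdGaussian (Fin n × Fin d) (Fin m) Set.univ := measure_univ.symm
    _ ≤ stdGaussian (Fin n × Fin d) (Fin m) good +
        (stdGaussian (Fin n × Fin d) (Fin m) {W | ¬ OpLe (Matrix.of W) (8 * bnd1 n d m γ)} +
          stdGaussian (Fin n × Fin d) (Fin m) bad) :=
      (measure_mono hcover).trans ((measure_union_le _ _).trans
        (add_le_add_right (measure_union_le _ _) _))
    _ ≤ _ := by
      refine add_le_add_right (le_trans (add_le_add ?_ ?_) hsmall) _
      · exact stdGaussian_not_opLe_bnd1_le hn d m (by linarith)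
      · exact stdGaussian_iUnion_not_leaveOneOut_le hn A hσ hβ0 (by linarith)

end GOPP
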